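/- arXiv:2406.03335 — 4 statements merged into one kernel-verified Lean document; each statement's English description precedes it below -/
import Mathlib

section
/- Fix c ∈ [1,∞), ℓ ∈ ℕ, and functions f₁, …, f_ℓ ∈ ℱ. Let (n_j) and (m_j) be sequences of positive integers with n_j → ∞ and m_j/n_j → c. For each j, let μ₁, …, μ_{n_j} be the eigenvalues of a random matrix sampled from the complex Wishart–Laguerre ensemble with parameters n_j, m_j, and for each i ≤ ℓ set X_i = Σ_{k=1}^{n_j} f_i(μ_k/n_j). Then for each i ≤ ℓ we have the L¹-convergence E|X_i/n_j − γ_c(f_i)| → 0 as j → ∞. -/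
open MeasureTheory ProbabilityTheory Filter Topology

noncomputable section

instance {n m α : Type*} [MeasurableSpace α] : MeasurableSpace (Matrix n m α) :=
  inferInstanceAs (MeasurableSpace (n → m → α))

/-- Standard complex Gaussian: `Z = X + iY` with `X, Y` independent real Gaussians of mean 0
and variance 1/2, so that `E[|Z|²] = 1`. -/
def stdCGaussian : Measure ℂ :=
  ((gaussianReal 0 (1/2)).prod (gaussianReal 0 (1/2))).map
    (fun p : ℝ × ℝ => (p.1 : ℂ) + p.2 * Complex.I)

/-- The law of an `n × m` matrix with i.i.d. standard complex Gaussian entries. -/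
def gaussMatrix (n m : ℕ) : Measure (Matrix (Fin n) (Fin m) ℂ) :=
  Measure.pi fun _ : Fin n => Measure.pi fun _ : Fin m => stdCGaussian

/-- The complex Wishart--Laguerre ensemble with parameters `n, m`: the law of `G Gᴴ` where
`G` is an `n × m` matrix with i.i.d. standard complex Gaussian entries. -/
def wishart (n m : ℕ) : Measure (Matrix (Fin n) (Fin n) ℂ) :=
  (gaussMatrix n m).map fun G => G * G.conjTranspose

/-- The trace-normalised complex Wishart--Laguerre ensemble: the law of `M / tr M` where `M`
is sampled from the complex Wishart--Laguerre ensemble. -/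
def wishartNorm (n m : ℕ) : Measure (Matrix (Fin n) (Fin n) ℂ) :=
  (wishart n m).map fun M => (Matrix.trace M)⁻¹ • M

/-- The (real) eigenvalues of a Hermitian matrix (junk value `0` if not Hermitian). -/
def eigs {n : ℕ} (M : Matrix (Fin n) (Fin n) ℂ) : Fin n → ℝ :=
  if h : M.IsHermitian then h.eigenvalues else 0

/-- `a₊ = (1 + √c)²`. -/
def aplus (c : ℝ) : ℝ := (1 + Real.sqrt c) ^ 2

/-- `a₋ = (1 − √c)²`. -/
def aminus (c : ℝ) : ℝ := (1 - Real.sqrt c) ^ 2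

/-- `γ_c(f) = (1/2π) ∫_{a₋}^{a₊} f(x) √((a₊ − x)(x − a₋))/x dx`. -/
def gamC (c : ℝ) (f : ℝ → ℝ) : ℝ :=
  (1 / (2 * Real.pi)) *
    ∫ x in aminus c..aplus c, f x * Real.sqrt ((aplus c - x) * (x - aminus c)) / x

/-- The class ℱ of continuously differentiable functions `f : ℝ → ℝ` of sub-exponential
growth, i.e. `log |f(x)| / |x| → 0` as `|x| → ∞`. -/
def MemF (f : ℝ → ℝ) : Prop :=
  ContDiff ℝ 1 f ∧ Tendsto (fun x => Real.log |f x| / |x|) (Filter.cocompact ℝ) (𝓝 0)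

lemma integrable_eval_gaussianReal (P : Polynomial ℂ) :
    Integrable (fun x : ℝ => P.eval (x : ℂ)) (gaussianReal 0 (1/2)) := by
  induction P using Polynomial.induction_on' with
  | add p q hp hq => exact (hp.add hq).congr (.of_forall fun x => by simp)
  | monomial k a =>
    simp only [Polynomial.eval_monomial]
    refine Integrable.const_mul ?_ a
    have h := (memLp_id_gaussianReal' (μ := 0) (v := 1/2) (k : ENNReal) (by simp)).integrable_norm_pow'
    refine h.mono (by fun_prop) (.of_forall fun x => ?_)
    simp

lemma integrable_pow_gaussianReal (k : ℕ) :
    Integrable (fun x : ℝ => x ^ k) (gaussianReal 0 (1/2)) := by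
  have h := (memLp_id_gaussianReal' (μ := 0) (v := 1/2) (k : ENNReal) (by simp)).integrable_norm_pow'
  refine h.mono (by fun_prop) (.of_forall fun x => ?_)
  simp

lemma integral_pow_succ_gaussianReal (k : ℕ) :
    ∫ x, x ^ (k + 1) ∂gaussianReal 0 (1/2) =
      (1/2) * (k * ∫ x, x ^ (k - 1) ∂gaussianReal 0 (1/2)) := by
  have hint (j : ℕ) : Integrable (fun x : ℝ => gaussianPDFReal 0 (1/2) x * x ^ j) := by
    have h := integrable_pow_gaussianReal j
    rw [gaussianReal_of_var_ne_zero _ (by norm_num)] at h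
    rw [integrable_withDensity_iff_integrable_smul' (by fun_prop) (by simp [gaussianPDF])] at h
    refine h.congr (.of_forall fun x => ?_)
    simp [gaussianPDF, ENNReal.toReal_ofReal (gaussianPDFReal_nonneg _ _ _)]
  rw [integral_gaussianReal_eq_integral_smul (by norm_num),
    integral_gaussianReal_eq_integral_smul (by norm_num)]
  simp only [smul_eq_mul]
  have hd (x : ℝ) : HasDerivAt (fun x : ℝ => gaussianPDFReal 0 (1/2) x * x ^ k)
      (k * (gaussianPDFReal 0 (1/2) x * x ^ (k - 1))
        - 2 * (gaussianPDFReal 0 (1/2) x * x ^ (k + 1))) x := by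
    have h1 : HasDerivAt (fun x : ℝ => gaussianPDFReal 0 (1/2) x)
        (gaussianPDFReal 0 (1/2) x * (-2 * x)) x := by
      unfold gaussianPDFReal
      have : HasDerivAt (fun x : ℝ => -(x - 0) ^ 2 / (2 * ((1/2 : NNReal) : ℝ))) (-2 * x) x := by
        have := ((((hasDerivAt_id x).sub_const 0).pow 2).neg).div_const (2 * ((1/2 : NNReal) : ℝ))
        refine this.congr_deriv ?_
        norm_num
      exact ((this.exp).const_mul _).congr_deriv (by ring)
    exact (h1.mul (hasDerivAt_pow k x)).congr_deriv (by simp; ring)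
  have h := integral_eq_zero_of_hasDerivAt_of_integrable hd
    (((hint (k - 1)).const_mul _).sub ((hint (k + 1)).const_mul _)) (hint k)
  rw [integral_sub ((hint (k - 1)).const_mul _) ((hint (k + 1)).const_mul _),
    integral_const_mul, integral_const_mul] at h
  linarith

/-- Stein's identity for polynomials. -/
lemma integral_mul_eval_gaussianReal (P : Polynomial ℂ) :
    ∫ x : ℝ, (x : ℂ) * P.eval (x : ℂ) ∂gaussianReal 0 (1/2) =
      (1/2) * ∫ x : ℝ, P.derivative.eval (x : ℂ) ∂gaussianReal 0 (1/2) := by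
  induction P using Polynomial.induction_on' with
  | add p q hp hq =>
    have h1 := integrable_eval_gaussianReal (Polynomial.X * p)
    have h2 := integrable_eval_gaussianReal (Polynomial.X * q)
    simp only [Polynomial.eval_mul, Polynomial.eval_X] at h1 h2
    simp only [Polynomial.eval_add, mul_add, Polynomial.derivative_add]
    rw [integral_add h1 h2, integral_add (integrable_eval_gaussianReal _)
      (integrable_eval_gaussianReal _), hp, hq, mul_add]
  | monomial k a =>
    have h := integral_pow_succ_gaussianReal k
    have h1 : ∀ j : ℕ, ∫ x : ℝ, (x : ℂ) ^ j ∂gaussianReal 0 (1/2)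
        = ((∫ x : ℝ, x ^ j ∂gaussianReal 0 (1/2) : ℝ) : ℂ) := by
      intro j
      rw [← integral_complex_ofReal]
      simp
    have h2 : ∀ x : ℝ, (x : ℂ) * (a * (x : ℂ) ^ k) = a * (x : ℂ) ^ (k + 1) := fun x => by ring
    simp only [Polynomial.eval_monomial, Polynomial.derivative_monomial, h2]
    rw [integral_const_mul, integral_const_mul, h1, h1, h]
    push_cast
    ring

/-- The real Gaussian product measure underlying `stdCGaussian`. -/
def gaussPair : Measure (ℝ × ℝ) := (gaussianReal 0 (1/2)).prod (gaussianReal 0 (1/2))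

instance : IsProbabilityMeasure gaussPair := by unfold gaussPair; infer_instance

/-- The complex number with given real and imaginary part. -/
def toC (p : ℝ × ℝ) : ℂ := (p.1 : ℂ) + p.2 * Complex.I

lemma continuous_toC : Continuous toC := by unfold toC; fun_prop

lemma measurable_toC : Measurable toC := continuous_toC.measurable

lemma stdCGaussian_eq : stdCGaussian = gaussPair.map toC := rfl

instance : IsProbabilityMeasure stdCGaussian := by
  rw [stdCGaussian_eq]
  exact Measure.isProbabilityMeasure_map measurable_toC.aemeasurable

lemma conj_toC (p : ℝ × ℝ) : star (toC p) = (p.1 : ℂ) - p.2 * Complex.I := by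
  simp [toC, sub_eq_add_neg]

lemma memLp_toC (k : ℕ) : MemLp toC k gaussPair := by
  have hid := memLp_id_gaussianReal' (μ := 0) (v := 1/2) (k : ENNReal) (by simp)
  have h1 : MemLp (fun p : ℝ × ℝ => p.1) k gaussPair :=
    hid.comp_measurePreserving measurePreserving_fst
  have h2 : MemLp (fun p : ℝ × ℝ => p.2) k gaussPair :=
    hid.comp_measurePreserving measurePreserving_snd
  have h3 : MemLp (fun p : ℝ × ℝ => (p.1 : ℂ)) k gaussPair := h1.ofReal
  have h4 : MemLp (fun p : ℝ × ℝ => (p.2 : ℂ)) k gaussPair := h2.ofReal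
  have h5 : MemLp (fun p : ℝ × ℝ => (p.2 : ℂ) * Complex.I) k gaussPair := by
    simpa only [mul_comm] using h4.const_mul Complex.I
  exact h3.add h5

lemma integrable_toC (p q : ℕ) :
    Integrable (fun w => toC w ^ p * star (toC w) ^ q) gaussPair := by
  refine (memLp_toC (p + q)).integrable_norm_pow'.mono ?_ (.of_forall fun w => ?_)
  · have := continuous_toC
    exact Continuous.aestronglyMeasurable (by fun_prop)
  · simp [pow_add]

/-- Mixed moments of a standard complex Gaussian. -/
def cMoment (p q : ℕ) : ℂ := ∫ z, z ^ p * star z ^ q ∂stdCGaussian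

lemma integrable_stdCGaussian (p q : ℕ) :
    Integrable (fun z => z ^ p * star z ^ q) stdCGaussian := by
  rw [stdCGaussian_eq, integrable_map_measure (Continuous.aestronglyMeasurable (by fun_prop))
    measurable_toC.aemeasurable]
  exact integrable_toC p q

lemma cMoment_eq (p q : ℕ) :
    cMoment p q = ∫ w, toC w ^ p * star (toC w) ^ q ∂gaussPair := by
  rw [cMoment, stdCGaussian_eq, integral_map measurable_toC.aemeasurable
    (Continuous.aestronglyMeasurable (by fun_prop))]

open Polynomial in
lemma integral_fst_mul_toC (p q : ℕ) :
    ∫ w, (w.1 : ℂ) * (toC w ^ p * star (toC w) ^ q) ∂gaussPair =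
      (1/2) * (p * cMoment (p - 1) q + q * cMoment p (q - 1)) := by
  have hF : Integrable (fun w : ℝ × ℝ => (w.1 : ℂ) * (toC w ^ p * star (toC w) ^ q)) gaussPair := by
    refine (((integrable_toC (p + 1) q).add (integrable_toC p (q + 1))).const_mul (1/2)).congr
      (.of_forall fun w => ?_)
    simp only [Pi.add_apply, conj_toC]
    simp only [toC]
    ring
  have hA := (integrable_toC (p - 1) q).const_mul (p : ℂ)
  have hB := (integrable_toC p (q - 1)).const_mul (q : ℂ)
  rw [cMoment_eq, cMoment_eq, ← integral_const_mul, ← integral_const_mul, ← integral_add hA hB,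
    ← integral_const_mul]
  have hG := (hA.add hB).const_mul (1/2)
  simp only [Pi.add_apply] at hG
  unfold gaussPair at hF hG ⊢
  rw [integral_prod_symm _ hF, integral_prod_symm _ hG]
  congr 1 with y
  have h := integral_mul_eval_gaussianReal
    ((X + C ((y : ℂ) * Complex.I)) ^ p * (X - C ((y : ℂ) * Complex.I)) ^ q)
  rw [← integral_const_mul] at h
  refine Eq.trans (integral_congr_ae (.of_forall fun x => ?_))
    (h.trans (integral_congr_ae (.of_forall fun x => ?_)))
  · simp [toC, sub_eq_add_neg]
  · simp only [toC]
    simp [derivative_pow]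
    ring

open Polynomial in
lemma integral_snd_mul_toC (p q : ℕ) :
    ∫ w, (w.2 : ℂ) * (toC w ^ p * star (toC w) ^ q) ∂gaussPair =
      (1/2) * (Complex.I * p * cMoment (p - 1) q - Complex.I * q * cMoment p (q - 1)) := by
  have hF : Integrable (fun w : ℝ × ℝ => (w.2 : ℂ) * (toC w ^ p * star (toC w) ^ q)) gaussPair := by
    refine (((integrable_toC (p + 1) q).sub (integrable_toC p (q + 1))).const_mul
      (-Complex.I/2)).congr (.of_forall fun w => ?_)
    simp only [Pi.sub_apply, conj_toC]
    simp only [toC]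
    ring_nf
    simp only [Complex.I_sq]
    ring
  have hA := (integrable_toC (p - 1) q).const_mul (Complex.I * p : ℂ)
  have hB := (integrable_toC p (q - 1)).const_mul (Complex.I * q : ℂ)
  rw [cMoment_eq, cMoment_eq, ← integral_const_mul, ← integral_const_mul, ← integral_sub hA hB,
    ← integral_const_mul]
  have hG := (hA.sub hB).const_mul (1/2)
  simp only [Pi.sub_apply] at hG
  unfold gaussPair at hF hG ⊢
  rw [integral_prod _ hF, integral_prod _ hG]
  congr 1 with x
  have h := integral_mul_eval_gaussianReal
    ((C (x : ℂ) + X * C Complex.I) ^ p * (C (x : ℂ) - X * C Complex.I) ^ q)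
  rw [← integral_const_mul] at h
  refine Eq.trans (integral_congr_ae (.of_forall fun y => ?_))
    (h.trans (integral_congr_ae (.of_forall fun y => ?_)))
  · simp only [conj_toC]
    simp only [toC, eval_mul, eval_pow, eval_add, eval_sub, eval_C, eval_X]
  · simp [toC, derivative_pow]
    ring

/-- Stein's identity for the mixed moments of a standard complex Gaussian. -/
lemma cMoment_succ (p q : ℕ) : cMoment (p + 1) q = q * cMoment p (q - 1) := by
  have h : cMoment (p + 1) q = (∫ w, (w.1 : ℂ) * (toC w ^ p * star (toC w) ^ q) ∂gaussPair)
      + Complex.I * ∫ w, (w.2 : ℂ) * (toC w ^ p * star (toC w) ^ q) ∂gaussPair := by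
    have hF : Integrable (fun w : ℝ × ℝ => (w.1 : ℂ) * (toC w ^ p * star (toC w) ^ q))
        gaussPair := by
      refine (((integrable_toC (p + 1) q).add (integrable_toC p (q + 1))).const_mul (1/2)).congr
        (.of_forall fun w => ?_)
      simp only [Pi.add_apply, conj_toC]
      simp only [toC]
      ring
    have hF' : Integrable (fun w : ℝ × ℝ => Complex.I * ((w.2 : ℂ) *
        (toC w ^ p * star (toC w) ^ q))) gaussPair := by
      refine (((integrable_toC (p + 1) q).sub (integrable_toC p (q + 1))).const_mul
        (1/2)).congr (.of_forall fun w => ?_)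
      simp only [Pi.sub_apply, conj_toC]
      simp only [toC]
      ring
    rw [← integral_const_mul, ← integral_add hF hF', cMoment_eq]
    congr 1 with w
    simp only [toC]
    ring
  rw [h, integral_fst_mul_toC, integral_snd_mul_toC]
  linear_combination (1/2) * (p * cMoment (p - 1) q - q * cMoment p (q - 1)) * Complex.I_sq

/-- Variables for the entries of an `n × m` matrix (`true`) and their conjugates (`false`). -/
abbrev EntryVar (n m : ℕ) := (Fin n × Fin m) × Bool

/-- Polynomials in the entries of a matrix and their conjugates. -/
abbrev EntryPoly (n m : ℕ) := MvPolynomial (EntryVar n m) ℂ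

/-- Evaluation of a polynomial in the entries and conjugate entries at a matrix. -/
def evalAt {n m : ℕ} (G : Matrix (Fin n) (Fin m) ℂ) : EntryPoly n m →ₐ[ℂ] ℂ :=
  MvPolynomial.aeval fun v => if v.2 then G v.1.1 v.1.2 else star (G v.1.1 v.1.2)

instance (n m : ℕ) : IsProbabilityMeasure (gaussMatrix n m) := by
  unfold gaussMatrix
  exact inferInstanceAs (IsProbabilityMeasure
    (Measure.pi fun _ : Fin n => Measure.pi fun _ : Fin m => stdCGaussian))

lemma evalAt_monomial {n m : ℕ} (G : Matrix (Fin n) (Fin m) ℂ) (s : EntryVar n m →₀ ℕ) (a : ℂ) :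
    evalAt G (MvPolynomial.monomial s a) =
      a * ∏ i, ∏ j, (G i j ^ s ((i, j), true) * star (G i j) ^ s ((i, j), false)) := by
  rw [evalAt, MvPolynomial.aeval_monomial, Finsupp.prod_fintype _ _ (by simp),
    Fintype.prod_prod_type, Fintype.prod_prod_type]
  simp

lemma integral_prod_gaussMatrix (n m : ℕ) (f : Fin n → Fin m → ℂ → ℂ) :
    ∫ G, ∏ i, ∏ j, f i j (G i j) ∂gaussMatrix n m =
      ∏ i, ∏ j, ∫ z, f i j z ∂stdCGaussian := by
  have h := integral_fintype_prod_eq_prod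
    (μ := fun _ : Fin n => Measure.pi fun _ : Fin m => stdCGaussian)
    (fun i (r : Fin m → ℂ) => ∏ j, f i j (r j))
  refine h.trans ?_
  refine Finset.prod_congr rfl fun i _ => ?_
  exact integral_fintype_prod_eq_prod (μ := fun _ : Fin m => stdCGaussian) (fun j => f i j)

lemma integrable_prod_gaussMatrix (n m : ℕ) (f : Fin n → Fin m → ℂ → ℂ)
    (hf : ∀ i j, Integrable (f i j) stdCGaussian) :
    Integrable (fun G => ∏ i, ∏ j, f i j (G i j)) (gaussMatrix n m) :=
  Integrable.fintype_prod_dep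
    (μ := fun _ : Fin n => Measure.pi fun _ : Fin m => stdCGaussian)
    (f := fun i (r : Fin m → ℂ) => ∏ j, f i j (r j))
    fun i => Integrable.fintype_prod_dep (μ := fun _ : Fin m => stdCGaussian)
      (f := fun j => f i j) fun j => hf i j

lemma integrable_evalAt {n m : ℕ} (P : EntryPoly n m) :
    Integrable (fun G => evalAt G P) (gaussMatrix n m) := by
  induction P using MvPolynomial.induction_on' with
  | monomial s a =>
    simp only [evalAt_monomial]
    exact (integrable_prod_gaussMatrix n m
      (fun i j z => z ^ s ((i, j), true) * star z ^ s ((i, j), false))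
      fun i j => integrable_stdCGaussian _ _).const_mul a
  | add p q hp hq => exact (hp.add hq).congr (.of_forall fun G => by simp)

/-- Expectation of a polynomial in the entries of a Gaussian matrix. -/
def gaussEL (n m : ℕ) : EntryPoly n m →ₗ[ℂ] ℂ where
  toFun P := ∫ G, evalAt G P ∂gaussMatrix n m
  map_add' P Q := by
    simp only [map_add]
    exact integral_add (integrable_evalAt P) (integrable_evalAt Q)
  map_smul' a P := by
    simp only [map_smul, RingHom.id_apply, smul_eq_mul]
    exact integral_const_mul _ _

lemma gaussEL_apply {n m : ℕ} (P : EntryPoly n m) :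
    gaussEL n m P = ∫ G, evalAt G P ∂gaussMatrix n m := rfl

lemma gaussEL_monomial {n m : ℕ} (s : EntryVar n m →₀ ℕ) (a : ℂ) :
    gaussEL n m (MvPolynomial.monomial s a) =
      a * ∏ e : Fin n × Fin m, cMoment (s (e, true)) (s (e, false)) := by
  simp only [gaussEL_apply, evalAt_monomial]
  rw [integral_const_mul, Fintype.prod_prod_type]
  congr 1
  exact integral_prod_gaussMatrix n m
    (fun i j z => z ^ s ((i, j), true) * star z ^ s ((i, j), false))

/-- Gaussian integration by parts for polynomials in the entries of a Gaussian matrix. -/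
lemma gaussEL_X_mul {n m : ℕ} (e : Fin n × Fin m) (P : EntryPoly n m) :
    gaussEL n m (MvPolynomial.X (e, true) * P) =
      gaussEL n m (MvPolynomial.pderiv (e, false) P) := by
  induction P using MvPolynomial.induction_on' with
  | add p q hp hq => rw [mul_add, map_add, hp, hq, map_add, map_add]
  | monomial s a =>
    rw [MvPolynomial.pderiv_monomial, MvPolynomial.X, MvPolynomial.monomial_mul,
      gaussEL_monomial, gaussEL_monomial, one_mul, mul_assoc]
    congr 1
    rw [← Finset.mul_prod_erase _ _ (Finset.mem_univ e),
      ← Finset.mul_prod_erase _ _ (Finset.mem_univ e), ← mul_assoc]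
    congr 1
    · simp [add_comm 1, cMoment_succ]
    · refine Finset.prod_congr rfl fun d hd => ?_
      have : e ≠ d := (Finset.ne_of_mem_erase hd).symm
      simp [this]

lemma Matrix.map_derivation_mul {R A : Type*} [CommRing R] [CommRing A] [Algebra R A]
    (D : Derivation R A A) {p q r : Type*} [Fintype q] (M : Matrix p q A) (N : Matrix q r A) :
    (M * N).map D = M.map D * N + M * N.map D := by
  ext i j
  simp only [Matrix.map_apply, Matrix.mul_apply, Matrix.add_apply, map_sum, Derivation.leibniz,
    smul_eq_mul, ← Finset.sum_add_distrib]
  exact Finset.sum_congr rfl fun x _ => by ring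

lemma Matrix.map_derivation_pow {R A : Type*} [CommRing R] [CommRing A] [Algebra R A]
    (D : Derivation R A A) {p : Type*} [Fintype p] [DecidableEq p] (M : Matrix p p A) (k : ℕ) :
    (M ^ k).map D = ∑ l ∈ Finset.range k, M ^ l * M.map D * M ^ (k - 1 - l) := by
  induction k with
  | zero =>
    ext i j
    simp only [pow_zero, Matrix.map_apply, Matrix.one_apply]
    split_ifs <;> simp
  | succ k ih =>
    rw [pow_succ, Matrix.map_derivation_mul, ih, Finset.sum_range_succ, Finset.sum_mul]
    congr 1
    · refine Finset.sum_congr rfl fun l hl => ?_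
      have : k + 1 - 1 - l = k - 1 - l + 1 := by have := Finset.mem_range.1 hl; omega
      rw [this, pow_succ, mul_assoc]
    · simp

section LoopEquation

variable (n m : ℕ)

/-- The matrix of entry variables. -/
def entryMat : Matrix (Fin n) (Fin m) (EntryPoly n m) :=
  .of fun i a => MvPolynomial.X ((i, a), true)

/-- The conjugate transpose of the matrix of entry variables. -/
def conjMat : Matrix (Fin m) (Fin n) (EntryPoly n m) :=
  .of fun a i => MvPolynomial.X ((i, a), false)

/-- The Wishart matrix of entry variables. -/
def wishMat : Matrix (Fin n) (Fin n) (EntryPoly n m) := entryMat n m * conjMat n m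

/-- The trace of the `k`-th power of the Wishart matrix of entry variables. -/
def tau (k : ℕ) : EntryPoly n m := (wishMat n m ^ k).trace

/-- Differentiation in a conjugate entry. -/
def dConj (i : Fin n) (a : Fin m) : Derivation ℂ (EntryPoly n m) (EntryPoly n m) :=
  MvPolynomial.pderiv ((i, a), false)

variable {n m}

lemma map_dConj_entryMat (i : Fin n) (a : Fin m) : (entryMat n m).map (dConj n m i a) = 0 := by
  ext j b : 2
  simp [entryMat, dConj, MvPolynomial.pderiv_X]

lemma map_dConj_conjMat (i : Fin n) (a : Fin m) :
    (conjMat n m).map (dConj n m i a) = Matrix.single a i 1 := by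
  ext b j : 2
  simp [conjMat, dConj, MvPolynomial.pderiv_X, Pi.single_apply, Matrix.single_apply, and_comm,
    eq_comm]

lemma map_dConj_wishMat_pow (i : Fin n) (a : Fin m) (k : ℕ) :
    (wishMat n m ^ k).map (dConj n m i a) =
      ∑ l ∈ Finset.range k,
        wishMat n m ^ l * entryMat n m * Matrix.single a i (1 : EntryPoly n m) * wishMat n m ^ (k - 1 - l) := by
  have h : (wishMat n m).map (dConj n m i a) =
      entryMat n m * Matrix.single a i (1 : EntryPoly n m) := by
    rw [wishMat, Matrix.map_derivation_mul, map_dConj_entryMat, map_dConj_conjMat]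
    simp
  rw [Matrix.map_derivation_pow, h]
  simp only [Matrix.mul_assoc]

lemma dConj_tau (i : Fin n) (a : Fin m) (r : ℕ) :
    dConj n m i a (tau n m r) = r * (wishMat n m ^ (r - 1) * entryMat n m) i a := by
  have h : dConj n m i a (tau n m r) = ((wishMat n m ^ r).map (dConj n m i a)).trace := by
    simp [tau, Matrix.trace]
  rw [h, map_dConj_wishMat_pow, Matrix.trace_sum]
  rw [Finset.sum_congr rfl (g := fun _ => (wishMat n m ^ (r - 1) * entryMat n m) i a)]
  · simp
  · intro l hl
    have hl' : r - 1 - l + l = r - 1 := by have := Finset.mem_range.1 hl; omega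
    rw [Matrix.trace_mul_comm, ← Matrix.mul_assoc, ← Matrix.mul_assoc, ← pow_add, hl',
      Matrix.trace_mul_single]
    simp

lemma trace_conj_pow_entry (k : ℕ) :
    (conjMat n m * wishMat n m ^ k * entryMat n m).trace = tau n m (k + 1) := by
  rw [Matrix.mul_assoc, Matrix.trace_mul_comm, Matrix.mul_assoc, ← wishMat, ← pow_succ, tau]

lemma sum_dConj_conj_pow (k : ℕ) :
    ∑ i, ∑ a, dConj n m i a ((conjMat n m * wishMat n m ^ k) a i) =
      m * tau n m k + ∑ l ∈ Finset.range k, tau n m (l + 1) * tau n m (k - 1 - l) := by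
  have h (i : Fin n) (a : Fin m) : dConj n m i a ((conjMat n m * wishMat n m ^ k) a i) =
      (wishMat n m ^ k) i i + ∑ l ∈ Finset.range k,
        (conjMat n m * wishMat n m ^ l * entryMat n m) a a * (wishMat n m ^ (k - 1 - l)) i i := by
    rw [← Matrix.map_apply (f := dConj n m i a), Matrix.map_derivation_mul, map_dConj_conjMat,
      map_dConj_wishMat_pow, Matrix.add_apply, Matrix.mul_sum, Matrix.sum_apply]
    congr 1
    · simp [Matrix.single_mul_apply_same]
    · refine Finset.sum_congr rfl fun l _ => ?_
      rw [← Matrix.mul_assoc, ← Matrix.mul_assoc, ← Matrix.mul_assoc, Matrix.mul_assoc _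
        (Matrix.single a i (1 : EntryPoly n m)), Matrix.mul_apply]
      rw [Finset.sum_eq_single a]
      · simp [Matrix.single_mul_apply_same]
      · intro b _ hb
        simp [Matrix.single_mul_apply_of_ne _ _ _ _ _ hb]
      · simp
  simp only [h, Finset.sum_add_distrib]
  congr 1
  · simp [tau, Matrix.trace, Finset.mul_sum]
  · simp only [← trace_conj_pow_entry]
    simp only [tau, Matrix.trace, Matrix.diag_apply, Finset.sum_mul_sum]
    rw [Finset.sum_congr rfl fun i _ => Finset.sum_comm, Finset.sum_comm]
    exact Finset.sum_congr rfl fun l _ => Finset.sum_comm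

variable (n m) in
/-- The derivation `∑ (G* W ^ k)_{ai} ∂/∂(conj G_{ia})`. -/
def loopD (k : ℕ) : Derivation ℂ (EntryPoly n m) (EntryPoly n m) :=
  ∑ i, ∑ a, (conjMat n m * wishMat n m ^ k) a i • dConj n m i a

lemma loopD_apply (k : ℕ) (Q : EntryPoly n m) :
    loopD n m k Q = ∑ i, ∑ a, (conjMat n m * wishMat n m ^ k) a i * dConj n m i a Q := by
  have h (D : Derivation ℂ (EntryPoly n m) (EntryPoly n m)) :
      D Q = Derivation.coeFnAddMonoidHom D Q := rfl
  rw [h, loopD, map_sum, Finset.sum_apply]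
  refine Finset.sum_congr rfl fun i _ => ?_
  rw [map_sum, Finset.sum_apply]
  rfl

lemma loopD_tau (k r : ℕ) : loopD n m k (tau n m r) = r * tau n m (k + r) := by
  rw [loopD_apply]
  rcases r with _ | r
  · simp [dConj_tau]
  · have h : tau n m (k + (r + 1)) =
        ∑ i, ∑ a, (conjMat n m * wishMat n m ^ k) a i * (wishMat n m ^ r * entryMat n m) i a := by
      rw [← add_assoc, ← trace_conj_pow_entry, pow_add, ← Matrix.mul_assoc, Matrix.mul_assoc]
      rw [Matrix.trace_mul_comm]
      refine Finset.sum_congr rfl fun i _ => ?_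
      rw [Matrix.diag_apply, Matrix.mul_apply]
      exact Finset.sum_congr rfl fun a _ => mul_comm _ _
    rw [h, Finset.mul_sum]
    refine Finset.sum_congr rfl fun i _ => ?_
    rw [Finset.mul_sum]
    refine Finset.sum_congr rfl fun a _ => ?_
    rw [dConj_tau, Nat.add_sub_cancel]
    ring

/-- The loop (Schwinger–Dyson) equation for the Wishart ensemble. -/
lemma gaussEL_loop (k : ℕ) (Q : EntryPoly n m) :
    gaussEL n m (tau n m (k + 1) * Q) =
      m * gaussEL n m (tau n m k * Q)
      + ∑ l ∈ Finset.range k, gaussEL n m (tau n m (l + 1) * (tau n m (k - 1 - l) * Q))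
      + gaussEL n m (loopD n m k Q) := by
  have h : tau n m (k + 1) * Q = ∑ i, ∑ a, MvPolynomial.X ((i, a), true) *
      ((conjMat n m * wishMat n m ^ k) a i * Q) := by
    rw [tau, pow_succ', wishMat, Matrix.mul_assoc, ← wishMat, Matrix.trace, Finset.sum_mul]
    refine Finset.sum_congr rfl fun i _ => ?_
    rw [Matrix.diag_apply, Matrix.mul_apply, Finset.sum_mul]
    refine Finset.sum_congr rfl fun a _ => ?_
    rw [mul_assoc]
    rfl
  have h2 : ∑ i, ∑ a, dConj n m i a ((conjMat n m * wishMat n m ^ k) a i * Q) =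
      (m : ℂ) • (tau n m k * Q)
      + ∑ l ∈ Finset.range k, tau n m (l + 1) * (tau n m (k - 1 - l) * Q) + loopD n m k Q := by
    have h3 : (m : ℂ) • (tau n m k * Q)
      + ∑ l ∈ Finset.range k, tau n m (l + 1) * (tau n m (k - 1 - l) * Q) =
      (∑ i, ∑ a, dConj n m i a ((conjMat n m * wishMat n m ^ k) a i)) * Q := by
      rw [sum_dConj_conj_pow, add_mul, Finset.sum_mul, MvPolynomial.smul_eq_C_mul, map_natCast]
      simp only [mul_assoc]
    rw [h3, loopD_apply, Finset.sum_mul, ← Finset.sum_add_distrib]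
    refine Finset.sum_congr rfl fun i _ => ?_
    rw [Finset.sum_mul, ← Finset.sum_add_distrib]
    refine Finset.sum_congr rfl fun a _ => ?_
    rw [Derivation.leibniz, smul_eq_mul, smul_eq_mul]
    ring
  rw [h, map_sum]
  simp only [map_sum, gaussEL_X_mul]
  have h4 := congrArg (gaussEL n m) h2
  simpa only [map_add, map_sum, map_smul, smul_eq_mul, dConj] using h4

end LoopEquation

lemma Matrix.IsHermitian.trace_pow_eq_sum {n : ℕ} {M : Matrix (Fin n) (Fin n) ℂ}
    (hM : M.IsHermitian) (k : ℕ) :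
    (M ^ k).trace = ∑ i, ((hM.eigenvalues i : ℂ)) ^ k := by
  conv_lhs => rw [hM.spectral_theorem]
  rw [← map_pow, Matrix.diagonal_pow, Unitary.conjStarAlgAut_apply, Matrix.trace_mul_comm,
    ← mul_assoc, Unitary.coe_star_mul_self, one_mul, Matrix.trace_diagonal]
  simp

/-- The normalised eigenvalues of `G Gᴴ`. -/
def normEig {n m : ℕ} (G : Matrix (Fin n) (Fin m) ℂ) (i : Fin n) : ℝ :=
  eigs (G * G.conjTranspose) i / n

open scoped ComplexOrder in
lemma normEig_nonneg {n m : ℕ} (G : Matrix (Fin n) (Fin m) ℂ) (i : Fin n) : 0 ≤ normEig G i := by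
  have h := Matrix.posSemidef_self_mul_conjTranspose G
  rw [normEig, eigs, dif_pos h.isHermitian]
  exact div_nonneg (h.eigenvalues_nonneg i) (Nat.cast_nonneg n)

/-- The moments of the empirical measure of the normalised eigenvalues of `G Gᴴ`. -/
def empMoment {n m : ℕ} (G : Matrix (Fin n) (Fin m) ℂ) (k : ℕ) : ℝ :=
  (∑ i, normEig G i ^ k) / n

lemma empMoment_nonneg {n m : ℕ} (G : Matrix (Fin n) (Fin m) ℂ) (k : ℕ) : 0 ≤ empMoment G k :=
  div_nonneg (Finset.sum_nonneg fun i _ => pow_nonneg (normEig_nonneg G i) k) (Nat.cast_nonneg n)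

lemma empMoment_zero {n m : ℕ} (hn : 0 < n) (G : Matrix (Fin n) (Fin m) ℂ) :
    empMoment G 0 = 1 := by
  have : (n : ℝ) ≠ 0 := by positivity
  simp [empMoment, this]

/-- Chebyshev's inequality for the empirical moments. -/
lemma empMoment_mul_le {n m : ℕ} (hn : 0 < n) (G : Matrix (Fin n) (Fin m) ℂ) (a b : ℕ) :
    empMoment G a * empMoment G b ≤ empMoment G (a + b) := by
  have hmono : Monovary (fun i => normEig G i ^ a) (fun i => normEig G i ^ b) := by
    intro i j hij
    have := lt_of_pow_lt_pow_left₀ _ (normEig_nonneg G j) hij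
    exact pow_le_pow_left₀ (normEig_nonneg G i) this.le a
  have h := hmono.sum_mul_sum_le_card_mul_sum
  simp only [Fintype.card_fin, ← pow_add] at h
  have hn' : (0 : ℝ) < n := by positivity
  rw [empMoment, empMoment, empMoment, div_mul_div_comm, div_le_div_iff₀ (by positivity) hn']
  nlinarith

open scoped ComplexOrder in
lemma evalAt_tau {n m : ℕ} (G : Matrix (Fin n) (Fin m) ℂ) (k : ℕ) :
    evalAt G (tau n m k) = ∑ i, ((eigs (G * G.conjTranspose) i : ℝ) : ℂ) ^ k := by
  have hH := (Matrix.posSemidef_self_mul_conjTranspose G).isHermitian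
  have h : (wishMat n m).map (evalAt G) = G * G.conjTranspose := by
    rw [wishMat, Matrix.map_mul]
    congr 1
    · ext i a
      simp [entryMat, evalAt]
    · ext a i
      simp [conjMat, evalAt]
  have h2 : evalAt G (tau n m k) = ((G * G.conjTranspose) ^ k).trace := by
    rw [← h, tau, AddMonoidHom.map_trace (evalAt G)]
    congr 1
    exact map_pow (evalAt G).toRingHom.mapMatrix (wishMat n m) k
  rw [h2, hH.trace_pow_eq_sum, eigs, dif_pos hH]

variable (n m : ℕ) in
/-- Normalised traces of powers. -/
def ntau (k : ℕ) : EntryPoly n m := ((n : ℂ) ^ (k + 1))⁻¹ • tau n m k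

lemma evalAt_ntau {n m : ℕ} (G : Matrix (Fin n) (Fin m) ℂ) (k : ℕ) :
    evalAt G (ntau n m k) = (empMoment G k : ℂ) := by
  rw [ntau, map_smul, evalAt_tau, empMoment, smul_eq_mul, pow_succ]
  simp only [normEig, div_pow]
  rw [← Finset.sum_div]
  push_cast
  rw [mul_inv]
  ring

lemma evalAt_ntau_prod {n m : ℕ} (G : Matrix (Fin n) (Fin m) ℂ) (L : List ℕ) :
    evalAt G (L.map (ntau n m)).prod = ((L.map (empMoment G)).prod : ℝ) := by
  induction L with
  | nil => simp
  | cons k L ih => simp [evalAt_ntau, ih]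

lemma integrable_empMoment_prod {n m : ℕ} (L : List ℕ) :
    Integrable (fun G => (L.map (empMoment G)).prod) (gaussMatrix n m) := by
  have h := (integrable_evalAt (L.map (ntau n m)).prod).re
  exact h.congr (.of_forall fun G => by simp [evalAt_ntau_prod])

lemma integrable_empMoment {n m : ℕ} (k : ℕ) :
    Integrable (fun G => empMoment G k) (gaussMatrix n m) := by
  simpa using integrable_empMoment_prod (n := n) (m := m) [k]

/-- Mixed moments of the empirical moments. -/
def mixedE (n m : ℕ) (L : List ℕ) : ℝ := ∫ G, (L.map (empMoment G)).prod ∂gaussMatrix n m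

lemma gaussEL_ntau_prod {n m : ℕ} (L : List ℕ) :
    gaussEL n m (L.map (ntau n m)).prod = (mixedE n m L : ℂ) := by
  rw [gaussEL_apply, mixedE, ← integral_complex_ofReal]
  simp only [evalAt_ntau_prod]

/-- The ways of increasing one entry `r` of a list by `k`, with weight `r`. -/
def bumps (k : ℕ) : List ℕ → List (ℕ × List ℕ)
  | [] => []
  | r :: L => (r, (k + r) :: L) :: (bumps k L).map fun p => (p.1, r :: p.2)

lemma sum_of_mem_bumps {k : ℕ} {L : List ℕ} {p : ℕ × List ℕ} (hp : p ∈ bumps k L) :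
    p.2.sum = k + L.sum := by
  induction L generalizing p with
  | nil => simp [bumps] at hp
  | cons r L ih =>
    simp only [bumps, List.mem_cons, List.mem_map] at hp
    rcases hp with rfl | ⟨q, hq, rfl⟩
    · simp [add_assoc]
    · simp [ih hq]; ring

lemma loopD_ntau {n m : ℕ} (hn : 0 < n) (k r : ℕ) :
    loopD n m k (ntau n m r) = ((n : ℂ) ^ k * r) • ntau n m (k + r) := by
  have hn' : (n : ℂ) ≠ 0 := by exact_mod_cast hn.ne'
  rw [ntau, ntau, Derivation.map_smul, loopD_tau, ← nsmul_eq_mul, ← Nat.cast_smul_eq_nsmul ℂ,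
    smul_smul, smul_smul]
  congr 1
  field_simp
  ring

lemma loopD_ntau_prod {n m : ℕ} (hn : 0 < n) (k : ℕ) (L : List ℕ) :
    loopD n m k (L.map (ntau n m)).prod =
      (n : ℂ) ^ k • ((bumps k L).map fun p => (p.1 : ℂ) • (p.2.map (ntau n m)).prod).sum := by
  induction L with
  | nil => simp [bumps]
  | cons r L ih =>
    rw [List.map_cons, List.prod_cons, Derivation.leibniz, ih, loopD_ntau hn]
    simp only [bumps, List.map_cons, List.sum_cons, List.map_map, List.prod_cons, smul_add,
      Function.comp_def]
    rw [add_comm]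
    congr 1
    · simp only [smul_eq_mul, smul_smul, mul_comm (ntau n m (k + r)), mul_smul_comm]
    · rw [smul_eq_mul, mul_smul_comm, ← List.sum_map_mul_left]
      simp only [mul_smul_comm]

/-- The loop equation for mixed moments. -/
lemma mixedE_loop {n m : ℕ} (hn : 0 < n) (k : ℕ) (L : List ℕ) :
    mixedE n m ((k + 1) :: L) =
      (m / n : ℝ) * mixedE n m (k :: L)
      + ∑ l ∈ Finset.range k, mixedE n m ((l + 1) :: (k - 1 - l) :: L)
      + ((n : ℝ) ^ 2)⁻¹ * ((bumps k L).map fun p => (p.1 : ℝ) * mixedE n m p.2).sum := by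
  have hn' : (n : ℂ) ≠ 0 := by exact_mod_cast hn.ne'
  have htau (r : ℕ) : tau n m r = ((n : ℂ) ^ (r + 1)) • ntau n m r := by
    rw [ntau, smul_smul, mul_inv_cancel₀ (pow_ne_zero _ hn'), one_smul]
  have h := gaussEL_loop (n := n) (m := m) k (L.map (ntau n m)).prod
  rw [loopD_ntau_prod hn] at h
  have hsum : ∑ l ∈ Finset.range k, gaussEL n m (tau n m (l + 1) *
      (tau n m (k - 1 - l) * (L.map (ntau n m)).prod)) =
      (n : ℂ) ^ (k + 2) * ∑ l ∈ Finset.range k, (mixedE n m ((l + 1) :: (k - 1 - l) :: L) : ℂ) := by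
    rw [Finset.mul_sum]
    refine Finset.sum_congr rfl fun l hl => ?_
    have hl' : l + 1 + 1 + (k - 1 - l + 1) = k + 2 := by
      have := Finset.mem_range.1 hl; omega
    rw [htau, htau, smul_mul_assoc, smul_mul_assoc, mul_smul_comm, smul_smul, map_smul,
      ← gaussEL_ntau_prod, smul_eq_mul, ← pow_add, hl']
    simp
  have hb : gaussEL n m ((n : ℂ) ^ k •
      ((bumps k L).map fun p => (p.1 : ℂ) • (p.2.map (ntau n m)).prod).sum) =
      (n : ℂ) ^ k * ((((bumps k L).map fun p => (p.1 : ℝ) * mixedE n m p.2).sum : ℝ) : ℂ) := by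
    rw [map_smul, smul_eq_mul]
    congr 1
    generalize bumps k L = B
    induction B with
    | nil => simp
    | cons p B ih =>
      simp only [List.map_cons, List.sum_cons, map_add, ih, map_smul, gaussEL_ntau_prod,
        smul_eq_mul]
      push_cast
      rfl
  rw [hsum, hb, htau, htau, smul_mul_assoc, smul_mul_assoc, map_smul, map_smul,
    ← List.prod_cons, ← List.map_cons, ← List.prod_cons, ← List.map_cons, gaussEL_ntau_prod,
    gaussEL_ntau_prod, smul_eq_mul, smul_eq_mul] at h
  have h' : (mixedE n m ((k + 1) :: L) : ℂ) =
      (m / n : ℂ) * mixedE n m (k :: L)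
      + ∑ l ∈ Finset.range k, (mixedE n m ((l + 1) :: (k - 1 - l) :: L) : ℂ)
      + ((n : ℂ) ^ 2)⁻¹ *
        ((((bumps k L).map fun p => (p.1 : ℝ) * mixedE n m p.2).sum : ℝ) : ℂ) := by
    have hk : (n : ℂ) ^ (k + 2) ≠ 0 := pow_ne_zero _ hn'
    apply mul_left_cancel₀ hk
    rw [show k + 1 + 1 = k + 2 from rfl] at h
    rw [h]
    field_simp
    ring
  apply Complex.ofReal_injective
  push_cast at h' ⊢
  exact h'

section MarchenkoPastur

/-- The parametrisation of the support of the Marchenko–Pastur law by an angle. -/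
def mpX (c θ : ℝ) : ℝ := 1 + c + 2 * √c * Real.cos θ

lemma continuous_mpX (c : ℝ) : Continuous (mpX c) := by unfold mpX; fun_prop

lemma aplus_eq {c : ℝ} (hc : 0 ≤ c) : aplus c = 1 + c + 2 * √c := by
  rw [aplus]; nlinarith [Real.sq_sqrt hc]

lemma aminus_eq {c : ℝ} (hc : 0 ≤ c) : aminus c = 1 + c - 2 * √c := by
  rw [aminus]; nlinarith [Real.sq_sqrt hc]

lemma mpX_pos {c θ : ℝ} (hc : 0 < c) (hθ : θ ∈ Set.Ioo 0 Real.pi) : 0 < mpX c θ := by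
  have h1 : -1 < Real.cos θ := by
    rw [← Real.cos_pi]
    exact Real.cos_lt_cos_of_nonneg_of_le_pi hθ.1.le le_rfl hθ.2
  have h2 := Real.sqrt_pos.2 hc
  have h3 := Real.sq_sqrt hc.le
  rw [mpX]
  nlinarith [sq_nonneg (1 - √c), mul_pos h2 (by linarith : 0 < 1 + Real.cos θ)]

lemma image_mpX {c : ℝ} (hc : 0 < c) :
    mpX c '' Set.Ioo 0 Real.pi = Set.Ioo (aminus c) (aplus c) := by
  have hb := Real.sqrt_pos.2 hc
  rw [aplus_eq hc.le, aminus_eq hc.le]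
  ext y
  constructor
  · rintro ⟨θ, hθ, rfl⟩
    have h1 : -1 < Real.cos θ := by
      rw [← Real.cos_pi]
      exact Real.cos_lt_cos_of_nonneg_of_le_pi hθ.1.le le_rfl hθ.2
    have h2 : Real.cos θ < 1 := by
      rw [← Real.cos_zero]
      exact Real.cos_lt_cos_of_nonneg_of_le_pi le_rfl hθ.2.le hθ.1
    constructor <;> · rw [mpX]; nlinarith
  · rintro ⟨h1, h2⟩
    have h3 : -1 < (y - 1 - c) / (2 * √c) := by rw [lt_div_iff₀ (by positivity)]; linarith
    have h4 : (y - 1 - c) / (2 * √c) < 1 := by rw [div_lt_iff₀ (by positivity)]; linarith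
    refine ⟨Real.arccos ((y - 1 - c) / (2 * √c)), ⟨Real.arccos_pos.2 h4, ?_⟩, ?_⟩
    · refine lt_of_le_of_ne (Real.arccos_le_pi _) fun h => ?_
      rw [Real.arccos_eq_pi] at h
      linarith
    · rw [mpX, Real.cos_arccos h3.le h4.le]
      field_simp
      ring

lemma gamC_eq {c : ℝ} (hc : 0 < c) (f : ℝ → ℝ) :
    gamC c f = (2 * c / Real.pi) *
      ∫ θ in Set.Ioo 0 Real.pi, f (mpX c θ) * (Real.sin θ ^ 2 / mpX c θ) := by
  have hb := Real.sqrt_pos.2 hc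
  have hle : aminus c ≤ aplus c := by rw [aplus_eq hc.le, aminus_eq hc.le]; linarith
  have hder : ∀ θ ∈ Set.Ioo 0 Real.pi,
      HasDerivWithinAt (mpX c) (2 * √c * -Real.sin θ) (Set.Ioo 0 Real.pi) θ := fun θ _ =>
    (((Real.hasDerivAt_cos θ).const_mul (2 * √c)).const_add (1 + c)).hasDerivWithinAt
  have hinj : Set.InjOn (mpX c) (Set.Ioo 0 Real.pi) := by
    intro x hx y hy hxy
    refine Real.injOn_cos ⟨hx.1.le, hx.2.le⟩ ⟨hy.1.le, hy.2.le⟩ ?_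
    simp only [mpX] at hxy
    have : 2 * √c ≠ 0 := by positivity
    exact mul_left_cancel₀ this (by linarith)
  rw [gamC, intervalIntegral.integral_of_le hle, integral_Ioc_eq_integral_Ioo, ← image_mpX hc,
    integral_image_eq_integral_abs_deriv_smul measurableSet_Ioo hder hinj]
  have : ∀ θ ∈ Set.Ioo 0 Real.pi, |2 * √c * -Real.sin θ| • (f (mpX c θ) *
      √((aplus c - mpX c θ) * (mpX c θ - aminus c)) / mpX c θ) =
      (4 * c) * (f (mpX c θ) * (Real.sin θ ^ 2 / mpX c θ)) := by
    intro θ hθ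
    have hs : 0 < Real.sin θ := Real.sin_pos_of_mem_Ioo hθ
    have h1 : (aplus c - mpX c θ) * (mpX c θ - aminus c) = (2 * √c * Real.sin θ) ^ 2 := by
      rw [aplus_eq hc.le, aminus_eq hc.le, mpX]
      nlinarith [Real.sin_sq_add_cos_sq θ, Real.sq_sqrt hc.le]
    rw [h1, Real.sqrt_sq (by positivity), mul_neg, abs_neg, abs_of_pos (by positivity),
      smul_eq_mul]
    have h2 := Real.sq_sqrt hc.le
    calc _ = 4 * (√c ^ 2) * (f (mpX c θ) * (Real.sin θ ^ 2 / mpX c θ)) := by ring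
      _ = _ := by rw [h2]
  rw [setIntegral_congr_fun measurableSet_Ioo this, integral_const_mul]
  ring

/-- Sine coefficients. -/
def sinCoeff (g : ℝ → ℝ) (n : ℕ) : ℝ :=
  (2 / Real.pi) * ∫ θ in 0..Real.pi, g θ * (Real.sin θ * Real.sin (n * θ))

lemma sinCoeff_zero (g : ℝ → ℝ) : sinCoeff g 0 = 0 := by simp [sinCoeff]

lemma integral_cos_nat_mul (n : ℕ) (hn : n ≠ 0) : ∫ θ in 0..Real.pi, Real.cos (n * θ) = 0 := by
  have : (n : ℝ) ≠ 0 := by exact_mod_cast hn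
  rw [intervalIntegral.integral_comp_mul_left (fun x => Real.cos x) this]
  simp

lemma sinCoeff_one (n : ℕ) : sinCoeff (fun _ => 1) n = if n = 1 then 1 else 0 := by
  have hpi := Real.pi_pos
  rcases n with _ | _ | n
  · simp [sinCoeff]
  · have : ∫ θ in 0..Real.pi, Real.sin θ ^ 2 = Real.pi / 2 := by rw [integral_sin_sq]; simp
    simp only [sinCoeff, one_mul, zero_add, Nat.cast_one, ← pow_two, this, if_true]
    field_simp
  · have h : ∀ θ : ℝ, (1 : ℝ) * (Real.sin θ * Real.sin (((n + 1 + 1 : ℕ) : ℝ) * θ)) =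
        (1/2) * (Real.cos (((n + 1 : ℕ) : ℝ) * θ) - Real.cos (((n + 3 : ℕ) : ℝ) * θ)) := by
      intro θ
      have h1 : ((n + 1 : ℕ) : ℝ) * θ = ((n + 1 + 1 : ℕ) : ℝ) * θ - θ := by push_cast; ring
      have h2 : ((n + 3 : ℕ) : ℝ) * θ = ((n + 1 + 1 : ℕ) : ℝ) * θ + θ := by push_cast; ring
      rw [h1, h2, Real.cos_sub, Real.cos_add]
      ring
    simp only [sinCoeff, h]
    rw [intervalIntegral.integral_const_mul, intervalIntegral.integral_sub,
      integral_cos_nat_mul _ (by omega), integral_cos_nat_mul _ (by omega)]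
    · simp
    · exact Continuous.intervalIntegrable (by fun_prop) _ _
    · exact Continuous.intervalIntegrable (by fun_prop) _ _

lemma sinCoeff_mpX_mul (c : ℝ) {g : ℝ → ℝ} (hg : Continuous g) (n : ℕ) :
    sinCoeff (fun θ => mpX c θ * g θ) (n + 1) =
      (1 + c) * sinCoeff g (n + 1) + √c * sinCoeff g (n + 2) + √c * sinCoeff g n := by
  have hi (k : ℕ) : IntervalIntegrable (fun θ => g θ * (Real.sin θ * Real.sin (k * θ)))
      volume 0 Real.pi := Continuous.intervalIntegrable (by fun_prop) _ _
  have h : ∀ θ : ℝ, mpX c θ * g θ * (Real.sin θ * Real.sin (((n + 1 : ℕ) : ℝ) * θ)) =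
      (1 + c) * (g θ * (Real.sin θ * Real.sin (((n + 1 : ℕ) : ℝ) * θ)))
      + √c * (g θ * (Real.sin θ * Real.sin (((n + 2 : ℕ) : ℝ) * θ)))
      + √c * (g θ * (Real.sin θ * Real.sin ((n : ℝ) * θ))) := by
    intro θ
    have h1 : (n : ℝ) * θ = ((n + 1 : ℕ) : ℝ) * θ - θ := by push_cast; ring
    have h2 : ((n + 2 : ℕ) : ℝ) * θ = ((n + 1 : ℕ) : ℝ) * θ + θ := by push_cast; ring
    rw [h1, h2, Real.sin_sub, Real.sin_add, mpX]
    ring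
  simp only [sinCoeff, h]
  rw [intervalIntegral.integral_add (((hi _).const_mul _).add ((hi _).const_mul _))
      ((hi _).const_mul _), intervalIntegral.integral_add ((hi _).const_mul _) ((hi _).const_mul _),
    intervalIntegral.integral_const_mul, intervalIntegral.integral_const_mul,
    intervalIntegral.integral_const_mul]
  ring

/-- First-passage decomposition for a constant-coefficient Jacobi recursion. -/
lemma first_passage {α b : ℝ} {H : ℕ → ℕ → ℝ} (h0 : ∀ k, H k 0 = 0) (h1 : H 0 1 = 1)
    (h2 : ∀ n, H 0 (n + 2) = 0)
    (hrec : ∀ k n, H (k + 1) (n + 1) = α * H k (n + 1) + b * H k (n + 2) + b * H k n) (k n : ℕ) :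
    H k (n + 2) = b * ∑ i ∈ Finset.range k, H i (n + 1) * H (k - 1 - i) 1 := by
  induction k generalizing n with
  | zero => simp [h2]
  | succ k ih =>
    have key : H k (n + 1) = b * ∑ i ∈ Finset.range k, H i n * H (k - 1 - i) 1
        + H 0 (n + 1) * H k 1 := by
      rcases n with _ | n
      · simp [h0, h1]
      · rw [ih n, h2]; ring
    have e1 := hrec k (n + 1)
    rw [ih n, ih (n + 1)] at e1
    rw [e1, Finset.sum_range_succ']
    have e2 : ∀ i ∈ Finset.range k, H (i + 1) (n + 1) * H (k + 1 - 1 - (i + 1)) 1 =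
        α * (H i (n + 1) * H (k - 1 - i) 1) + b * (H i (n + 2) * H (k - 1 - i) 1)
          + b * (H i n * H (k - 1 - i) 1) := by
      intro i _
      rw [hrec, show k + 1 - 1 - (i + 1) = k - 1 - i by omega]
      ring
    rw [Finset.sum_congr rfl e2, Finset.sum_add_distrib, Finset.sum_add_distrib,
      ← Finset.mul_sum, ← Finset.mul_sum, ← Finset.mul_sum, key]
    simp only [Nat.add_sub_cancel, Nat.sub_zero]
    ring

/-- Shifted Marchenko–Pastur moments. -/
def mpR (c : ℝ) (k : ℕ) : ℝ := sinCoeff (fun θ => mpX c θ ^ k) 1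

lemma mpR_zero (c : ℝ) : mpR c 0 = 1 := by simp [mpR, sinCoeff_one]

lemma mpR_succ {c : ℝ} (hc : 0 ≤ c) (k : ℕ) :
    mpR c (k + 1) = (1 + c) * mpR c k + c * ∑ i ∈ Finset.range k, mpR c i * mpR c (k - 1 - i) := by
  have hcont (k : ℕ) : Continuous fun θ => mpX c θ ^ k := (continuous_mpX c).pow k
  have hrec (k n : ℕ) := sinCoeff_mpX_mul c (hcont k) n
  simp only [← pow_succ'] at hrec
  have h := first_passage (α := 1 + c) (b := √c) (H := fun k n => sinCoeff (fun θ => mpX c θ ^ k) n)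
    (fun k => sinCoeff_zero _) (by simp [sinCoeff_one]) (fun n => by simp [sinCoeff_one]) hrec k 0
  simp only [mpR]
  rw [hrec k 0, h, sinCoeff_zero, ← mul_assoc (√c) (√c), Real.mul_self_sqrt hc]
  simp

lemma gamC_pow_succ {c : ℝ} (hc : 0 < c) (k : ℕ) :
    gamC c (fun x => x ^ (k + 1)) = c * mpR c k := by
  rw [gamC_eq hc, mpR, sinCoeff, intervalIntegral.integral_of_le Real.pi_pos.le,
    integral_Ioc_eq_integral_Ioo]
  rw [setIntegral_congr_fun (g := fun θ => mpX c θ ^ k * (Real.sin θ * Real.sin ((1 : ℕ) * θ)))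
    measurableSet_Ioo]
  · ring
  · intro θ hθ
    have := (mpX_pos hc hθ).ne'
    simp only [Nat.cast_one, one_mul]
    field_simp
    ring

lemma gamC_one_of_one_lt {c : ℝ} (hc : 1 < c) : gamC c (fun _ => 1) = 1 := by
  have hc0 : 0 < c := by linarith
  have hpi := Real.pi_pos
  set b := √c with hb
  have hb1 : 1 < b := by rw [hb, Real.lt_sqrt (by norm_num)]; simpa using hc
  have hbc : b ^ 2 = c := Real.sq_sqrt hc0.le
  have hlow (θ : ℝ) : (b - 1) ^ 2 ≤ mpX c θ := by
    rw [mpX, ← hb]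
    nlinarith [Real.neg_one_le_cos θ]
  have hpos (θ : ℝ) : 0 < mpX c θ := lt_of_lt_of_le (by nlinarith) (hlow θ)
  have hcont : Continuous fun θ => (mpX c θ)⁻¹ :=
    (continuous_mpX c).inv₀ fun θ => (hpos θ).ne'
  set w := sinCoeff fun θ => (mpX c θ)⁻¹ with hw
  have hrec (n : ℕ) : (if n + 1 = 1 then 1 else 0) =
      (1 + c) * w (n + 1) + b * w (n + 2) + b * w n := by
    rw [← sinCoeff_mpX_mul c hcont n, ← sinCoeff_one]
    congr 1
    ext θ
    rw [mul_inv_cancel₀ (hpos θ).ne']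
  have hbound (n : ℕ) : |w n| ≤ 2 * ((b - 1) ^ 2)⁻¹ := by
    have h1 : ‖∫ θ in 0..Real.pi, (mpX c θ)⁻¹ * (Real.sin θ * Real.sin (n * θ))‖ ≤
        ((b - 1) ^ 2)⁻¹ * |Real.pi - 0| := by
      refine intervalIntegral.norm_integral_le_of_norm_le_const fun θ _ => ?_
      rw [norm_mul, norm_mul, norm_inv, Real.norm_of_nonneg (hpos θ).le]
      have h2 : (mpX c θ)⁻¹ ≤ ((b - 1) ^ 2)⁻¹ := inv_anti₀ (by nlinarith) (hlow θ)
      have h3 : ‖Real.sin θ‖ * ‖Real.sin (n * θ)‖ ≤ 1 :=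
        mul_le_one₀ (Real.abs_sin_le_one _) (norm_nonneg _) (Real.abs_sin_le_one _)
      calc _ ≤ ((b - 1) ^ 2)⁻¹ * 1 :=
            mul_le_mul h2 h3 (by positivity) (by positivity)
        _ = _ := mul_one _
    rw [hw, sinCoeff, abs_mul, abs_of_pos (by positivity)]
    rw [Real.norm_eq_abs, sub_zero, abs_of_pos hpi] at h1
    calc _ ≤ 2 / Real.pi * (((b - 1) ^ 2)⁻¹ * Real.pi) := by gcongr
      _ = _ := by field_simp
  have hv (n : ℕ) : b * w (n + 2) + w (n + 1) = (-b) ^ n * (b * w 2 + w 1) := by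
    induction n with
    | zero => simp
    | succ n ih =>
      have h := hrec (n + 1)
      simp only [Nat.add_eq_right, Nat.add_eq_zero_iff, one_ne_zero, and_false, if_false] at h
      rw [pow_succ, mul_assoc, mul_comm (-b), ← mul_assoc, ← ih]
      rw [← hbc] at h
      linear_combination -h
  have hv0 : b * w 2 + w 1 = 0 := by
    by_contra hne
    have hlim : Tendsto (fun n : ℕ => b ^ n * |b * w 2 + w 1|) atTop atTop :=
      (tendsto_pow_atTop_atTop_of_one_lt hb1).atTop_mul_const (abs_pos.2 hne)
    obtain ⟨n, hn⟩ := (hlim.eventually_gt_atTop ((b + 1) * (2 * ((b - 1) ^ 2)⁻¹))).exists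
    have h1 : b ^ n * |b * w 2 + w 1| = |b * w (n + 2) + w (n + 1)| := by
      rw [hv n, abs_mul, abs_pow, abs_neg, abs_of_pos (by linarith : 0 < b)]
    rw [h1] at hn
    have h2 := abs_add_le (b * w (n + 2)) (w (n + 1))
    rw [abs_mul, abs_of_pos (by linarith : 0 < b)] at h2
    nlinarith [hbound (n + 1), mul_le_mul_of_nonneg_left (hbound (n + 2)) (by linarith : 0 ≤ b)]
  have h0 := hrec 0
  simp only [zero_add, if_true] at h0
  have hw0 : w 0 = 0 := sinCoeff_zero _
  have hfin : c * w 1 = 1 := by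
    rw [hw0] at h0
    linear_combination -h0 - hv0
  refine Eq.trans ?_ hfin
  rw [gamC_eq hc0, hw, sinCoeff, intervalIntegral.integral_of_le hpi.le,
    integral_Ioc_eq_integral_Ioo]
  have e : ∀ θ : ℝ, (mpX c θ)⁻¹ * (Real.sin θ * Real.sin ((1 : ℕ) * θ)) =
      1 * (Real.sin θ ^ 2 / mpX c θ) := fun θ => by
    simp only [Nat.cast_one, one_mul]
    ring
  simp only [e]
  ring

lemma gamC_one_one : gamC 1 (fun _ => 1) = 1 := by
  have hpi := Real.pi_pos
  rw [gamC_eq one_pos, setIntegral_congr_fun (g := fun θ => (1 - Real.cos θ) / 2)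
    measurableSet_Ioo]
  · rw [← integral_Ioc_eq_integral_Ioo, ← intervalIntegral.integral_of_le hpi.le,
      intervalIntegral.integral_div, intervalIntegral.integral_sub (by simp)
      (Continuous.intervalIntegrable (by fun_prop) _ _)]
    simp
  · intro θ hθ
    have h := mpX_pos one_pos hθ
    simp only [one_mul]
    rw [div_eq_div_iff h.ne' (by norm_num)]
    simp only [mpX, Real.sqrt_one]
    nlinarith [Real.sin_sq_add_cos_sq θ]

lemma gamC_one {c : ℝ} (hc : 1 ≤ c) : gamC c (fun _ => 1) = 1 := by
  rcases hc.eq_or_lt with rfl | hc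
  · exact gamC_one_one
  · exact gamC_one_of_one_lt hc

/-- The recursion satisfied by the Marchenko–Pastur moments. -/
lemma gamC_pow_rec {c : ℝ} (hc : 1 ≤ c) (k : ℕ) :
    gamC c (fun x => x ^ (k + 1)) = c * gamC c (fun x => x ^ k) +
      ∑ l ∈ Finset.range k, gamC c (fun x => x ^ (l + 1)) * gamC c (fun x => x ^ (k - 1 - l)) := by
  have hc0 : 0 < c := by linarith
  have hone : gamC c (fun x => x ^ 0) = 1 := by simpa using gamC_one hc
  rcases k with _ | k
  · rw [gamC_pow_succ hc0, hone, mpR_zero]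
    simp
  · have e : ∀ l ∈ Finset.range k, gamC c (fun x => x ^ (l + 1)) *
        gamC c (fun x => x ^ (k + 1 - 1 - l)) = c ^ 2 * (mpR c l * mpR c (k - 1 - l)) := by
      intro l hl
      have : k + 1 - 1 - l = k - 1 - l + 1 := by have := Finset.mem_range.1 hl; omega
      rw [this, gamC_pow_succ hc0, gamC_pow_succ hc0]
      ring
    rw [Finset.sum_range_succ, Finset.sum_congr rfl e, ← Finset.mul_sum, Nat.add_sub_cancel,
      Nat.sub_self, hone, gamC_pow_succ hc0, gamC_pow_succ hc0, mpR_succ hc0.le]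
    ring

end MarchenkoPastur

section MomentLimits

variable {c : ℝ} {n m : ℕ → ℕ}

lemma mixedE_zero_cons {n m : ℕ} (hn : 0 < n) (L : List ℕ) :
    mixedE n m (0 :: L) = mixedE n m L := by
  simp [mixedE, empMoment_zero hn]

lemma tendsto_list_sum_map {α : Type*} (l : List α) {u : ℕ → α → ℝ} {v : α → ℝ}
    (h : ∀ a ∈ l, Tendsto (fun j => u j a) atTop (𝓝 (v a))) :
    Tendsto (fun j => (l.map (u j)).sum) atTop (𝓝 (l.map v).sum) := by
  induction l with
  | nil => simp
  | cons a l ih =>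
    simp only [List.map_cons, List.sum_cons]
    exact (h a (by simp)).add (ih fun b hb => h b (by simp [hb]))

/-- Mixed moments of the empirical spectral distribution factorise in the limit. -/
lemma tendsto_mixedE (hc : 1 ≤ c) (hn0 : ∀ j, 0 < n j) (hn : Tendsto n atTop atTop)
    (hratio : Tendsto (fun j => (m j : ℝ) / (n j : ℝ)) atTop (𝓝 c)) (L : List ℕ) :
    Tendsto (fun j => mixedE (n j) (m j) L) atTop
      (𝓝 (L.map fun k => gamC c fun x => x ^ k).prod) := by
  have hone : gamC c (fun x => x ^ 0) = 1 := by simpa using gamC_one hc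
  have hninv : Tendsto (fun j => ((n j : ℝ) ^ 2)⁻¹) atTop (𝓝 0) :=
    tendsto_inv_atTop_zero.comp
      ((tendsto_pow_atTop two_ne_zero).comp (tendsto_natCast_atTop_atTop.comp hn))
  suffices H : ∀ s, ∀ L : List ℕ, L.sum = s → Tendsto (fun j => mixedE (n j) (m j) L) atTop
      (𝓝 (L.map fun k => gamC c fun x => x ^ k).prod) from H _ L rfl
  intro s
  induction s using Nat.strong_induction_on with
  | _ s IH =>
    intro L
    induction L with
    | nil => intro _; simp [mixedE]
    | cons a L ihL =>
      intro hL
      rcases a with _ | k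
      · simp only [mixedE_zero_cons (hn0 _), List.map_cons, List.prod_cons, hone, one_mul]
        exact ihL (by simpa using hL)
      · have hs : k + 1 + L.sum = s := by simpa using hL
        refine Tendsto.congr (fun j => (mixedE_loop (hn0 j) k L).symm) ?_
        have h1 := IH (k + L.sum) (by omega) (k :: L) (by simp)
        have h2 : ∀ l ∈ Finset.range k, Tendsto
            (fun j => mixedE (n j) (m j) ((l + 1) :: (k - 1 - l) :: L)) atTop
            (𝓝 (gamC c (fun x => x ^ (l + 1)) * (gamC c (fun x => x ^ (k - 1 - l)) *
              (L.map fun k => gamC c fun x => x ^ k).prod))) := fun l hl => by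
          have hl' := Finset.mem_range.1 hl
          have := IH (k + L.sum) (by omega) ((l + 1) :: (k - 1 - l) :: L) (by simp; omega)
          simpa using this
        have h3 := tendsto_list_sum_map (bumps k L)
          (u := fun j p => (p.1 : ℝ) * mixedE (n j) (m j) p.2)
          (v := fun p => (p.1 : ℝ) * (p.2.map fun k => gamC c fun x => x ^ k).prod)
          fun p hp => (IH (k + L.sum) (by omega) p.2 (sum_of_mem_bumps hp)).const_mul _
        have h4 := ((hratio.mul h1).add (tendsto_finsetSum _ h2)).add (hninv.mul h3)
        convert h4 using 2
        rw [List.map_cons, List.prod_cons, gamC_pow_rec hc, zero_mul, add_zero, List.map_cons,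
          List.prod_cons, add_mul, Finset.sum_mul, mul_assoc]
        simp only [mul_assoc]

/-- `L¹`-convergence of the empirical moments. -/
lemma tendsto_integral_abs_empMoment_sub (hc : 1 ≤ c) (hn0 : ∀ j, 0 < n j)
    (hn : Tendsto n atTop atTop)
    (hratio : Tendsto (fun j => (m j : ℝ) / (n j : ℝ)) atTop (𝓝 c)) (k : ℕ) :
    Tendsto (fun j => ∫ G, |empMoment G k - gamC c fun x => x ^ k| ∂gaussMatrix (n j) (m j))
      atTop (𝓝 0) := by
  set a := gamC c fun x => x ^ k
  have h1 : Tendsto (fun j => ∫ G, empMoment G k ∂gaussMatrix (n j) (m j)) atTop (𝓝 a) := by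
    simpa [mixedE] using tendsto_mixedE hc hn0 hn hratio [k]
  have h2 : Tendsto (fun j => ∫ G, empMoment G k * empMoment G k ∂gaussMatrix (n j) (m j)) atTop
      (𝓝 (a * a)) := by
    simpa [mixedE] using tendsto_mixedE hc hn0 hn hratio [k, k]
  have hi (j : ℕ) : Integrable (fun G => empMoment G k) (gaussMatrix (n j) (m j)) :=
    integrable_empMoment k
  have hi2 (j : ℕ) : Integrable (fun G => empMoment G k * empMoment G k)
      (gaussMatrix (n j) (m j)) := by
    simpa using integrable_empMoment_prod (n := n j) (m := m j) [k, k]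
  have hsq (j : ℕ) : Integrable (fun G => (empMoment G k - a) ^ 2) (gaussMatrix (n j) (m j)) := by
    have := ((hi2 j).sub ((hi j).const_mul (2 * a))).add (integrable_const (a ^ 2))
    refine this.congr (Eventually.of_forall fun G => ?_)
    simp only [Pi.add_apply, Pi.sub_apply]
    ring
  have h3 : Tendsto (fun j => ∫ G, (empMoment G k - a) ^ 2 ∂gaussMatrix (n j) (m j)) atTop
      (𝓝 0) := by
    have := (h2.sub (h1.const_mul (2 * a))).add_const (a ^ 2)
    convert this using 2 with j
    · have e : ∀ G : Matrix (Fin (n j)) (Fin (m j)) ℂ, (empMoment G k - a) ^ 2 =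
          empMoment G k * empMoment G k - 2 * a * empMoment G k + a ^ 2 := fun G => by ring
      have hi3 : Integrable (fun G => empMoment G k * empMoment G k - 2 * a * empMoment G k)
        (gaussMatrix (n j) (m j)) := (hi2 j).sub ((hi j).const_mul _)
      simp only [e]
      rw [integral_add hi3 (integrable_const _), integral_sub (hi2 j) ((hi j).const_mul _),
        integral_const_mul]
      simp
    · ring
  rw [Metric.tendsto_atTop]
  intro ε hε
  obtain ⟨N, hN⟩ := Metric.tendsto_atTop.1 h3 (ε ^ 2) (by positivity)
  refine ⟨N, fun j hj => ?_⟩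
  have h4 := hN j hj
  rw [Real.dist_eq, sub_zero] at h4 ⊢
  rw [abs_of_nonneg (integral_nonneg fun _ => sq_nonneg _)] at h4
  rw [abs_of_nonneg (integral_nonneg fun _ => abs_nonneg _)]
  calc ∫ G, |empMoment G k - a| ∂gaussMatrix (n j) (m j)
      ≤ ∫ G, (ε / 2 + (2 * ε)⁻¹ * (empMoment G k - a) ^ 2) ∂gaussMatrix (n j) (m j) := by
        refine integral_mono ((hi j).sub (integrable_const a)).abs
          ((integrable_const _).add ((hsq j).const_mul _)) fun G => ?_
        have e : ε / 2 + (2 * ε)⁻¹ * (empMoment G k - a) ^ 2 - |empMoment G k - a| =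
            (2 * ε)⁻¹ * (ε - |empMoment G k - a|) ^ 2 := by
          rw [← sq_abs (empMoment G k - a)]
          field_simp
          ring
        have : 0 ≤ (2 * ε)⁻¹ * (ε - |empMoment G k - a|) ^ 2 := by positivity
        simp only
        linarith
    _ = ε / 2 + (2 * ε)⁻¹ * ∫ G, (empMoment G k - a) ^ 2 ∂gaussMatrix (n j) (m j) := by
        rw [integral_add (integrable_const _) ((hsq j).const_mul _), integral_const_mul]
        simp
    _ < ε / 2 + (2 * ε)⁻¹ * ε ^ 2 := by gcongr
    _ = ε := by field_simp; ring

end MomentLimits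

section ExponentialMoments

lemma integral_empMoment_succ_le {n m : ℕ} (hn : 0 < n) (k : ℕ) :
    ∫ G, empMoment G (k + 1) ∂gaussMatrix n m ≤
      ((m : ℝ) / n + k) * ∫ G, empMoment G k ∂gaussMatrix n m := by
  have h := mixedE_loop (m := m) hn k []
  have hle : ∀ l ∈ Finset.range k, mixedE n m [l + 1, k - 1 - l] ≤ mixedE n m [k] := by
    intro l hl
    refine integral_mono (integrable_empMoment_prod _) (integrable_empMoment_prod _) fun G => ?_
    have hl' := Finset.mem_range.1 hl
    have := empMoment_mul_le hn G (l + 1) (k - 1 - l)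
    rw [show l + 1 + (k - 1 - l) = k by omega] at this
    simpa using this
  have hs := Finset.sum_le_sum hle
  have e (k : ℕ) : ∫ G, empMoment G k ∂gaussMatrix n m = mixedE n m [k] := by simp [mixedE]
  rw [e, e, h, add_mul]
  simpa [bumps] using hs

lemma integral_empMoment_le {n m M : ℕ} (hn : 0 < n) (hM : (m : ℝ) / n ≤ M + 1) (k : ℕ) :
    ∫ G, empMoment G k ∂gaussMatrix n m ≤ k.factorial * ((k + M).choose M : ℕ) := by
  have h : ∫ G, empMoment G k ∂gaussMatrix n m ≤ ((M + 1).ascFactorial k : ℕ) := by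
    induction k with
    | zero => simp [empMoment_zero hn]
    | succ k ih =>
      refine (integral_empMoment_succ_le hn k).trans ?_
      rw [Nat.ascFactorial_succ]
      push_cast
      have h0 : 0 ≤ ∫ G, empMoment G k ∂gaussMatrix n m :=
        integral_nonneg fun G => empMoment_nonneg G k
      gcongr
  rw [Nat.ascFactorial_eq_factorial_mul_choose, ← Nat.choose_symm_add, add_comm M k] at h
  exact_mod_cast h

/-- The normalised trace of `exp (G Gᴴ / (2n))`. -/
def empExp {n m : ℕ} (G : Matrix (Fin n) (Fin m) ℂ) : ℝ :=
  (∑ i, Real.exp (normEig G i / 2)) / n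

lemma hasSum_empExp {n m : ℕ} (G : Matrix (Fin n) (Fin m) ℂ) :
    HasSum (fun k : ℕ => (1 / 2) ^ k / (k.factorial : ℝ) * empMoment G k) (empExp G) := by
  have h (i : Fin n) : HasSum (fun k : ℕ => (normEig G i / 2) ^ k / (k.factorial : ℝ))
      (Real.exp (normEig G i / 2)) := by
    rw [Real.exp_eq_exp_ℝ]
    exact NormedSpace.expSeries_div_hasSum_exp _
  have e (k : ℕ) : (1 / 2) ^ k / (k.factorial : ℝ) * empMoment G k =
      (∑ i, (normEig G i / 2) ^ k / (k.factorial : ℝ)) / n := by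
    rw [empMoment, mul_div_assoc', Finset.mul_sum]
    congr 1
    refine Finset.sum_congr rfl fun i _ => ?_
    rw [div_pow, div_pow, one_pow]
    ring
  simp only [e]
  exact (hasSum_sum fun i (_ : i ∈ Finset.univ) => h i).div_const (n : ℝ)

/-- A uniform exponential moment bound for the empirical spectral distribution. -/
lemma exists_bound_integral_empExp (M : ℕ) : ∃ B : ℝ, 0 ≤ B ∧ ∀ n m : ℕ, 0 < n →
    (m : ℝ) / n ≤ M + 1 → Integrable (fun G => empExp G) (gaussMatrix n m) ∧
      ∫ G, empExp G ∂gaussMatrix n m ≤ B := by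
  have hsum : Summable fun k : ℕ => ((k + M).choose M : ℝ) * (1 / 2 : ℝ) ^ k :=
    summable_choose_mul_geometric_of_norm_lt_one M (by norm_num)
  have hnn (k : ℕ) : 0 ≤ ((k + M).choose M : ℝ) * (1 / 2 : ℝ) ^ k := by positivity
  refine ⟨∑' k : ℕ, ((k + M).choose M : ℝ) * (1 / 2 : ℝ) ^ k, tsum_nonneg hnn, fun n m hn hM => ?_⟩
  set μ := gaussMatrix n m
  let F (k : ℕ) (G : Matrix (Fin n) (Fin m) ℂ) : ℝ :=
    (1 / 2) ^ k / (k.factorial : ℝ) * empMoment G k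
  have hF (k : ℕ) : Integrable (F k) μ := (integrable_empMoment k).const_mul _
  have hF0 (k : ℕ) (G) : 0 ≤ F k G := mul_nonneg (by positivity) (empMoment_nonneg G k)
  have hFle (k : ℕ) : ∫ G, F k G ∂μ ≤ ((k + M).choose M : ℝ) * (1 / 2 : ℝ) ^ k := by
    rw [integral_const_mul]
    calc _ ≤ (1 / 2) ^ k / (k.factorial : ℝ) * (k.factorial * ((k + M).choose M : ℕ)) := by
          gcongr
          exact integral_empMoment_le hn hM k
      _ = _ := by field_simp
  have hFs : Summable fun k => ∫ G, F k G ∂μ :=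
    hsum.of_nonneg_of_le (fun k => integral_nonneg (hF0 k)) hFle
  have htsum : ∀ G, ∑' k, F k G = empExp G := fun G => (hasSum_empExp G).tsum_eq
  have hint : HasSum (fun k => ∫ G, F k G ∂μ) (∫ G, empExp G ∂μ) := by
    have := hasSum_integral_of_summable_integral_norm hF
      (by simpa only [Real.norm_of_nonneg (hF0 _ _)] using hFs)
    simpa only [htsum] using this
  refine ⟨?_, hasSum_le hFle hint hsum.hasSum⟩
  have hlim : ∀ G, Tendsto (fun N => ∑ k ∈ Finset.range N, F k G) atTop (𝓝 (empExp G)) :=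
    fun G => (hasSum_empExp G).tendsto_sum_nat
  have hmeas (N : ℕ) : AEStronglyMeasurable (fun G => ∑ k ∈ Finset.range N, F k G) μ :=
    (integrable_finsetSum _ fun k _ => hF k).aestronglyMeasurable
  refine ⟨aestronglyMeasurable_of_tendsto_ae _ hmeas (Eventually.of_forall hlim), ?_⟩
  have hfatou : ∫⁻ G, ‖empExp G‖ₑ ∂μ ≤
      liminf (fun N => ∫⁻ G, ‖∑ k ∈ Finset.range N, F k G‖ₑ ∂μ) atTop := by
    refine le_of_eq_of_le (lintegral_congr fun G => ((hlim G).enorm.liminf_eq).symm) ?_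
    exact lintegral_liminf_le' fun N => (hmeas N).aemeasurable.enorm
  refine (hfatou.trans ?_).trans_lt
    (ENNReal.ofReal_lt_top (r := ∑' k : ℕ, ((k + M).choose M : ℝ) * (1 / 2 : ℝ) ^ k))
  refine liminf_le_of_le (by isBoundedDefault) fun b hb => ?_
  obtain ⟨N, hN⟩ := hb.exists
  refine hN.trans ?_
  have h0 (G) : 0 ≤ ∑ k ∈ Finset.range N, F k G := Finset.sum_nonneg fun k _ => hF0 k G
  simp only [Real.enorm_eq_ofReal (h0 _)]
  rw [← ofReal_integral_eq_lintegral_ofReal (integrable_finsetSum _ fun k _ => hF k)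
    (Eventually.of_forall h0), integral_finsetSum _ fun k _ => hF k]
  refine ENNReal.ofReal_le_ofReal ?_
  exact (Finset.sum_le_sum fun k _ => hFle k).trans (hsum.sum_le_tsum _ fun k _ => hnn k)

end ExponentialMoments

section Approximation

lemma integral_map_le {α β : Type*} [MeasurableSpace α] [MeasurableSpace β] {μ : Measure α}
    {φ : α → β} {g : β → ℝ} {H : α → ℝ} (hg : ∀ b, 0 ≤ g b) (hH : Integrable H μ)
    (hle : ∀ a, g (φ a) ≤ H a) : ∫ b, g b ∂μ.map φ ≤ ∫ a, H a ∂μ := by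
  have hH0 : 0 ≤ ∫ a, H a ∂μ := integral_nonneg fun a => (hg _).trans (hle a)
  by_cases hφ : AEMeasurable φ μ
  · by_cases hgm : AEStronglyMeasurable g (μ.map φ)
    · rw [integral_map hφ hgm]
      exact integral_mono_of_nonneg (Eventually.of_forall fun a => hg _) hH
        (Eventually.of_forall hle)
    · rwa [integral_non_aestronglyMeasurable hgm]
  · rwa [Measure.map_of_not_aemeasurable hφ, integral_zero_measure]

lemma MemF.exists_exp_bound {f : ℝ → ℝ} (hf : MemF f) :
    ∃ C : ℝ, 0 ≤ C ∧ ∀ x, 0 ≤ x → |f x| ≤ C * Real.exp (x / 4) := by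
  have h := (hf.2.mono_left atTop_le_cocompact).eventually_lt_const (u := 1 / 4) (by norm_num)
  obtain ⟨R, hR⟩ := eventually_atTop.1 (h.and (eventually_gt_atTop 0))
  obtain ⟨C, hC⟩ := (isCompact_Icc (a := (0 : ℝ)) (b := R)).exists_bound_of_continuousOn
    hf.1.continuous.continuousOn
  refine ⟨max C 1, by positivity, fun x hx => ?_⟩
  have h1 : 1 ≤ Real.exp (x / 4) := Real.one_le_exp (by positivity)
  rcases le_total x R with hxR | hxR
  · calc |f x| ≤ C := hC x ⟨hx, hxR⟩
      _ ≤ max C 1 * 1 := by simp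
      _ ≤ _ := by gcongr
  · obtain ⟨h2, h3⟩ := hR x hxR
    rw [abs_of_pos h3, div_lt_iff₀ h3] at h2
    have h4 : |f x| ≤ Real.exp (x / 4) := by
      rcases eq_or_ne (f x) 0 with h0 | h0
      · rw [h0, abs_zero]; positivity
      · rw [← Real.exp_log (abs_pos.2 h0)]
        exact Real.exp_le_exp.2 (by linarith)
    calc |f x| ≤ 1 * Real.exp (x / 4) := by simpa using h4
      _ ≤ _ := by gcongr; exact le_max_right _ _

lemma abs_eval_le_of_one_le (p : Polynomial ℝ) : ∃ A : ℝ, 0 ≤ A ∧ ∀ x, 1 ≤ x →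
    |p.eval x| ≤ A * x ^ p.natDegree := by
  refine ⟨∑ k ∈ Finset.range (p.natDegree + 1), |p.coeff k|,
    Finset.sum_nonneg fun _ _ => abs_nonneg _, fun x hx => ?_⟩
  rw [Polynomial.eval_eq_sum_range, Finset.sum_mul]
  refine (Finset.abs_sum_le_sum_abs _ _).trans (Finset.sum_le_sum fun k hk => ?_)
  rw [abs_mul, abs_of_nonneg (by positivity : 0 ≤ x ^ k)]
  have := Finset.mem_range.1 hk
  gcongr
  omega

/-- Polynomial approximation on a compact interval, with control of the tails. -/
lemma exists_polynomial_approx {f : ℝ → ℝ} (hf : Continuous f) {C : ℝ} (hC0 : 0 ≤ C)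
    (hC : ∀ x, 0 ≤ x → |f x| ≤ C * Real.exp (x / 4)) {η : ℝ} (hη : 0 < η) {a : ℝ} (ha : 0 ≤ a)
    (B : ℝ) : ∃ (p : Polynomial ℝ) (D A : ℝ) (k : ℕ), 0 ≤ D ∧ 0 ≤ A ∧ D * B ≤ η ∧ A * a ^ k ≤ η ∧
      (∀ x ∈ Set.Icc 0 a, |f x - p.eval x| ≤ η) ∧
      ∀ x, 0 ≤ x → |f x - p.eval x| ≤ η + D * Real.exp (x / 2) + A * x ^ k := by
  have hlim : Tendsto (fun K : ℝ => C * Real.exp (-(K / 4)) * B) atTop (𝓝 0) := by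
    have h1 : Tendsto (fun K : ℝ => Real.exp (-(K / 4))) atTop (𝓝 0) :=
      Real.tendsto_exp_neg_atTop_nhds_zero.comp (tendsto_id.atTop_div_const (by norm_num))
    simpa using (h1.const_mul C).mul_const B
  obtain ⟨K, hKB, hK⟩ :=
    ((hlim.eventually_lt_const hη).and (eventually_gt_atTop (max 1 a))).exists
  have hK1 : 1 < K := (le_max_left _ _).trans_lt hK
  have hKa : a < K := (le_max_right _ _).trans_lt hK
  obtain ⟨p, hp⟩ := exists_polynomial_near_of_continuousOn 0 K f hf.continuousOn η hη
  obtain ⟨A, hA0, hA⟩ := abs_eval_le_of_one_le p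
  have hlim2 : Tendsto (fun r : ℕ => A * a ^ p.natDegree * (a / K) ^ r) atTop (𝓝 0) := by
    simpa using (tendsto_pow_atTop_nhds_zero_of_lt_one (by positivity)
      ((div_lt_one (by linarith)).2 hKa)).const_mul (A * a ^ p.natDegree)
  obtain ⟨r, hr⟩ := (hlim2.eventually_lt_const hη).exists
  refine ⟨p, C * Real.exp (-(K / 4)), A / K ^ r, p.natDegree + r, by positivity, by positivity,
    hKB.le, ?_, fun x hx => ?_, fun x hx => ?_⟩
  · refine le_of_eq_of_le ?_ hr.le
    rw [pow_add, div_pow]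
    ring
  · rw [abs_sub_comm]
    exact (hp x ⟨hx.1, hx.2.trans hKa.le⟩).le
  · rcases le_total x K with hxK | hxK
    · have h1 : |f x - p.eval x| ≤ η := by
        rw [abs_sub_comm]
        exact (hp x ⟨hx, hxK⟩).le
      have h2 : 0 ≤ C * Real.exp (-(K / 4)) * Real.exp (x / 2) := by positivity
      have h3 : 0 ≤ A / K ^ r * x ^ (p.natDegree + r) := by positivity
      linarith
    · have h1 : |f x| ≤ C * Real.exp (-(K / 4)) * Real.exp (x / 2) := by
        refine (hC x hx).trans ?_
        rw [mul_assoc, ← Real.exp_add]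
        gcongr
        linarith
      have h2 : |p.eval x| ≤ A / K ^ r * x ^ (p.natDegree + r) := by
        refine (hA x (by linarith)).trans ?_
        have h3 : 1 ≤ x ^ r / K ^ r := (one_le_div (by positivity)).2 (by gcongr)
        calc A * x ^ p.natDegree = A * x ^ p.natDegree * 1 := (mul_one _).symm
          _ ≤ A * x ^ p.natDegree * (x ^ r / K ^ r) := by gcongr
          _ = _ := by rw [pow_add]; ring
      have h3 := abs_sub (f x) (p.eval x)
      linarith

lemma mpX_mem_Icc {c θ : ℝ} (hc : 0 < c) (hθ : θ ∈ Set.Ioo 0 Real.pi) :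
    mpX c θ ∈ Set.Icc 0 (aplus c) := by
  have : mpX c θ ∈ Set.Ioo (aminus c) (aplus c) := image_mpX hc ▸ Set.mem_image_of_mem _ hθ
  exact ⟨(mpX_pos hc hθ).le, this.2.le⟩

lemma integrableOn_mpX {c : ℝ} (hc : 0 < c) {f : ℝ → ℝ} (hf : Continuous f) :
    IntegrableOn (fun θ => f (mpX c θ) * (Real.sin θ ^ 2 / mpX c θ)) (Set.Ioo 0 Real.pi) := by
  have h1 : IntegrableOn (fun θ => f (mpX c θ)) (Set.Ioo 0 Real.pi) :=
    ((hf.comp (continuous_mpX c)).integrableOn_Icc).mono_set Set.Ioo_subset_Icc_self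
  have hm : Measurable fun θ => Real.sin θ ^ 2 / mpX c θ :=
    (by fun_prop : Measurable fun θ => Real.sin θ ^ 2).div (continuous_mpX c).measurable
  refine Integrable.mul_bdd (c := 1) h1 hm.aestronglyMeasurable ?_
  refine (ae_restrict_iff' measurableSet_Ioo).2 (Eventually.of_forall fun θ hθ => ?_)
  have h0 := mpX_pos hc hθ
  rw [Real.norm_of_nonneg (by positivity), div_le_one h0, mpX]
  nlinarith [Real.sin_sq_add_cos_sq θ, sq_nonneg (√c + Real.cos θ), Real.sq_sqrt hc.le]

lemma gamC_mono {c : ℝ} (hc : 0 < c) {f g : ℝ → ℝ} (hf : Continuous f) (hg : Continuous g)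
    (h : ∀ x ∈ Set.Icc 0 (aplus c), f x ≤ g x) : gamC c f ≤ gamC c g := by
  rw [gamC_eq hc, gamC_eq hc]
  have hpi := Real.pi_pos
  refine mul_le_mul_of_nonneg_left ?_ (by positivity)
  refine setIntegral_mono_on (integrableOn_mpX hc hf) (integrableOn_mpX hc hg) measurableSet_Ioo
    fun θ hθ => ?_
  have h0 := mpX_pos hc hθ
  exact mul_le_mul_of_nonneg_right (h _ (mpX_mem_Icc hc hθ)) (by positivity)

lemma gamC_const_mul (c b : ℝ) (f : ℝ → ℝ) : gamC c (fun x => b * f x) = b * gamC c f := by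
  simp only [gamC, mul_assoc, mul_div_assoc]
  rw [intervalIntegral.integral_const_mul]
  ring

lemma gamC_const {c : ℝ} (hc : 1 ≤ c) (b : ℝ) : gamC c (fun _ => b) = b := by
  simpa [gamC_one hc] using gamC_const_mul c b fun _ => 1

lemma gamC_sum {c : ℝ} (hc : 0 < c) {ι : Type*} (s : Finset ι) {f : ι → ℝ → ℝ}
    (hf : ∀ i, Continuous (f i)) :
    gamC c (fun x => ∑ i ∈ s, f i x) = ∑ i ∈ s, gamC c (f i) := by
  simp only [gamC_eq hc, Finset.sum_mul, ← Finset.mul_sum]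
  rw [integral_finsetSum _ fun i _ => integrableOn_mpX hc (hf i)]

lemma gamC_polynomial {c : ℝ} (hc : 0 < c) (p : Polynomial ℝ) :
    gamC c (fun x => p.eval x) =
      ∑ k ∈ Finset.range (p.natDegree + 1), p.coeff k * gamC c fun x => x ^ k := by
  simp only [Polynomial.eval_eq_sum_range]
  rw [gamC_sum hc _ fun k => by fun_prop]
  simp only [gamC_const_mul]

lemma abs_gamC_sub_le {c : ℝ} (hc : 1 ≤ c) {f g : ℝ → ℝ} (hf : Continuous f) (hg : Continuous g)
    {η : ℝ} (h : ∀ x ∈ Set.Icc 0 (aplus c), |f x - g x| ≤ η) : |gamC c f - gamC c g| ≤ η := by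
  have hc0 : 0 < c := by linarith
  have key : ∀ {f g : ℝ → ℝ}, Continuous f → Continuous g →
      (∀ x ∈ Set.Icc 0 (aplus c), |f x - g x| ≤ η) → gamC c f ≤ gamC c g + η := by
    intro f g hf hg h
    have h1 : gamC c (fun x => ∑ b : Bool, cond b (g x) η) = gamC c g + η := by
      rw [gamC_sum hc0 (f := fun b x => cond b (g x) η) _ (by rintro (_ | _) <;> simp <;> fun_prop)]
      simp [gamC_const hc]
    rw [← h1]
    refine gamC_mono hc0 hf (by simp; fun_prop) fun x hx => ?_
    have := (abs_le.1 (h x hx)).2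
    simp
    linarith
  rw [abs_le]
  have h1 := key hf hg h
  have h2 := key hg hf fun x hx => by rw [abs_sub_comm]; exact h x hx
  constructor <;> linarith

lemma gamC_pow_le {c : ℝ} (hc : 1 ≤ c) (k : ℕ) : gamC c (fun x => x ^ k) ≤ aplus c ^ k := by
  rw [← gamC_const hc (aplus c ^ k)]
  refine gamC_mono (by linarith) (by fun_prop) continuous_const fun x hx => ?_
  have := hx.1
  have := hx.2
  gcongr

lemma sum_eval_normEig_div {n m : ℕ} (G : Matrix (Fin n) (Fin m) ℂ) (p : Polynomial ℝ) :
    (∑ i, p.eval (normEig G i)) / n =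
      ∑ k ∈ Finset.range (p.natDegree + 1), p.coeff k * empMoment G k := by
  simp only [Polynomial.eval_eq_sum_range, empMoment, mul_div_assoc', Finset.mul_sum]
  rw [Finset.sum_comm, Finset.sum_div]

/-- Deterministic comparison of a linear statistic with its limit. -/
lemma abs_linearStatistic_sub_le {c : ℝ} (hc : 1 ≤ c) {f : ℝ → ℝ} (hf : Continuous f)
    {p : Polynomial ℝ} {η D A : ℝ} {k : ℕ}
    (h1 : ∀ x ∈ Set.Icc 0 (aplus c), |f x - p.eval x| ≤ η)
    (h2 : ∀ x, 0 ≤ x → |f x - p.eval x| ≤ η + D * Real.exp (x / 2) + A * x ^ k)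
    {n m : ℕ} (hn : 0 < n) (G : Matrix (Fin n) (Fin m) ℂ) :
    |(∑ i, f (normEig G i)) / n - gamC c f| ≤ 2 * η + D * empExp G + A * empMoment G k +
      ∑ l ∈ Finset.range (p.natDegree + 1),
        |p.coeff l| * |empMoment G l - gamC c fun x => x ^ l| := by
  have hn' : (0 : ℝ) < n := by exact_mod_cast hn
  have e1 : |(∑ i, f (normEig G i)) / n - (∑ i, p.eval (normEig G i)) / n| ≤
      η + D * empExp G + A * empMoment G k := by
    rw [← sub_div, ← Finset.sum_sub_distrib, abs_div, abs_of_pos hn', div_le_iff₀ hn']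
    refine (Finset.abs_sum_le_sum_abs _ _).trans
      ((Finset.sum_le_sum fun i _ => h2 _ (normEig_nonneg G i)).trans_eq ?_)
    rw [Finset.sum_add_distrib, Finset.sum_add_distrib, ← Finset.mul_sum, ← Finset.mul_sum,
      empExp, empMoment]
    simp only [Finset.sum_const, Finset.card_univ, Fintype.card_fin, nsmul_eq_mul]
    field_simp
  have e2 : |(∑ i, p.eval (normEig G i)) / n - gamC c fun x => p.eval x| ≤
      ∑ l ∈ Finset.range (p.natDegree + 1),
        |p.coeff l| * |empMoment G l - gamC c fun x => x ^ l| := by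
    rw [sum_eval_normEig_div, gamC_polynomial (by linarith), ← Finset.sum_sub_distrib]
    refine (Finset.abs_sum_le_sum_abs _ _).trans_eq (Finset.sum_congr rfl fun l _ => ?_)
    rw [← mul_sub, abs_mul]
  have e3 := abs_gamC_sub_le hc hf p.continuous h1
  rw [abs_sub_comm] at e3
  have e4 := abs_sub_le ((∑ i, f (normEig G i)) / n) ((∑ i, p.eval (normEig G i)) / n) (gamC c f)
  have e5 := abs_sub_le ((∑ i, p.eval (normEig G i)) / n) (gamC c fun x => p.eval x) (gamC c f)
  linarith

lemma tendsto_integral_linearStatistic {c : ℝ} (hc : 1 ≤ c) {f : ℝ → ℝ} (hf : MemF f)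
    {n m : ℕ → ℕ} (hn0 : ∀ j, 0 < n j) (hn : Tendsto n atTop atTop)
    (hratio : Tendsto (fun j => (m j : ℝ) / (n j : ℝ)) atTop (𝓝 c)) :
    Tendsto (fun j => ∫ M, |(∑ k, f (eigs M k / (n j : ℝ))) / (n j : ℝ) - gamC c f|
      ∂wishart (n j) (m j)) atTop (𝓝 0) := by
  obtain ⟨C, hC0, hC⟩ := hf.exists_exp_bound
  obtain ⟨M, hM⟩ := exists_nat_gt c
  obtain ⟨B, -, hB⟩ := exists_bound_integral_empExp M
  rw [Metric.tendsto_atTop']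
  intro ε hε
  obtain ⟨p, D, A, k, hD, hA, hDB, hAk, h1, h2⟩ := exists_polynomial_approx hf.1.continuous hC0 hC
    (show 0 < ε / 5 by positivity) (show 0 ≤ aplus c from sq_nonneg _) B
  set P := Finset.range (p.natDegree + 1)
  have hmom (l : ℕ) (j : ℕ) : Integrable
      (fun G => |p.coeff l| * |empMoment G l - gamC c fun x => x ^ l|)
      (gaussMatrix (n j) (m j)) :=
    ((integrable_empMoment l).sub (integrable_const _)).abs.const_mul _
  have hlim : Tendsto (fun j => 2 * (ε / 5) + ε / 5 +
      A * (∫ G, empMoment G k ∂gaussMatrix (n j) (m j)) +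
      ∑ l ∈ P, |p.coeff l| *
        ∫ G, |empMoment G l - gamC c fun x => x ^ l| ∂gaussMatrix (n j) (m j)) atTop
      (𝓝 (2 * (ε / 5) + ε / 5 + A * (gamC c fun x => x ^ k) + ∑ l ∈ P, |p.coeff l| * 0)) := by
    have t1 : Tendsto (fun j => ∫ G, empMoment G k ∂gaussMatrix (n j) (m j)) atTop
        (𝓝 (gamC c fun x => x ^ k)) := by
      simpa [mixedE] using tendsto_mixedE hc hn0 hn hratio [k]
    exact ((t1.const_mul A).const_add _).add (tendsto_finsetSum _ fun l _ =>
      (tendsto_integral_abs_empMoment_sub hc hn0 hn hratio l).const_mul _)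
  have hlt : 2 * (ε / 5) + ε / 5 + A * (gamC c fun x => x ^ k) + ∑ l ∈ P, |p.coeff l| * 0 < ε := by
    have := mul_le_mul_of_nonneg_left (gamC_pow_le hc k) hA
    simp only [mul_zero, Finset.sum_const_zero]
    linarith
  have hev := (hlim.eventually_lt_const hlt).and
    (hratio.eventually_lt_const (hM.trans (lt_add_one _)))
  obtain ⟨N, hN⟩ := eventually_atTop.1 hev
  refine ⟨N, fun j hj => ?_⟩
  obtain ⟨h3, h4⟩ := hN j hj.le
  obtain ⟨hexp, hexpB⟩ := hB (n j) (m j) (hn0 j) h4.le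
  rw [Real.dist_eq, sub_zero, abs_of_nonneg (integral_nonneg fun _ => abs_nonneg _)]
  have hi1 : Integrable (fun _ => 2 * (ε / 5)) (gaussMatrix (n j) (m j)) := integrable_const _
  have hi2 := hi1.add (hexp.const_mul D)
  have hi3 := hi2.add ((integrable_empMoment (n := n j) (m := m j) k).const_mul A)
  have hi4 := integrable_finsetSum P fun l _ => hmom l j
  refine (integral_map_le (φ := fun G : Matrix (Fin (n j)) (Fin (m j)) ℂ => G * G.conjTranspose)
    (fun _ => abs_nonneg _) (hi3.add hi4) fun G =>
      abs_linearStatistic_sub_le hc hf.1.continuous h1 h2 (hn0 j) G).trans_lt ?_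
  refine lt_of_le_of_lt ?_ h3
  rw [integral_add' hi3 hi4, integral_add' hi2, integral_add' hi1, integral_const_mul,
    integral_const_mul, integral_finsetSum _ fun l _ => hmom l j]
  · simp only [integral_const_mul, integral_const, probReal_univ, one_smul]
    have := mul_le_mul_of_nonneg_left hexpB hD
    gcongr
    linarith
  · exact hexp.const_mul D
  · exact (integrable_empMoment k).const_mul A

end Approximation

/-- Theorem 2.3(1) of the paper: law of large numbers (in `L¹`) for linear eigenvalue
statistics of the complex Wishart--Laguerre ensemble, in the regime `m/n → c ∈ [1, ∞)`. -/
theorem wishart_linear_statistics_LLN (c : ℝ) (hc : 1 ≤ c) (ℓ : ℕ)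
    (f : Fin ℓ → ℝ → ℝ) (hf : ∀ i, MemF (f i)) (n m : ℕ → ℕ)
    (hn0 : ∀ j, 0 < n j) (hm0 : ∀ j, 0 < m j)
    (hn : Tendsto n atTop atTop)
    (hratio : Tendsto (fun j => (m j : ℝ) / (n j : ℝ)) atTop (𝓝 c)) (i : Fin ℓ) :
    Tendsto
      (fun j => ∫ M, |(∑ k, f i (eigs M k / (n j : ℝ))) / (n j : ℝ) - gamC c (f i)|
        ∂wishart (n j) (m j))
      atTop (𝓝 0) := by
  exact tendsto_integral_linearStatistic hc (hf i) hn0 hn hratio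
end
end

section
/- Fix c ∈ [1,∞) and for each positive integer i let h_i(x) = (x/a₊)^i, where a₊ = (1 + √c)². Then the limit α_c = lim_{i→∞} Γ_c(h_i, h_i) exists, and α_c > 0. -/
open MeasureTheory ProbabilityTheory Filter Topology

noncomputable section

/-- The bilinear form `Γ(f,g)` from the paper.  (The integrand is interpreted as `0` on the
measure-zero diagonal `x = y`, since in Lean division by zero yields zero.) -/
def Gam (f g : ℝ → ℝ) : ℝ :=
  (1 / Real.pi ^ 2) *
    ∫ x in (-1 : ℝ)..1, ∫ y in (-1 : ℝ)..1,
      ((f x - f y) / (x - y)) * ((g x - g y) / (x - y)) *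
        ((1 - x * y) / (Real.sqrt (1 - x ^ 2) * Real.sqrt (1 - y ^ 2)))

/-- `Φ_c(x) = 2√c·x + c + 1`. -/
def PhiC (c : ℝ) (x : ℝ) : ℝ := 2 * Real.sqrt c * x + c + 1

/-- `Γ_c(f,g) = Γ(f ∘ Φ_c, g ∘ Φ_c)`. -/
def GamC (c : ℝ) (f g : ℝ → ℝ) : ℝ := Gam (f ∘ PhiC c) (g ∘ PhiC c)

/-- The moments `∫₀^π (1 - cos θ)^m (1 - p (1 - cos θ))^k dθ`. -/
def cosMoment (p : ℝ) (m k : ℕ) : ℝ :=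
  ∫ θ in (0 : ℝ)..Real.pi, (1 - Real.cos θ) ^ m * (1 - p * (1 - Real.cos θ)) ^ k

/-- The number of pairs `(a, b)` with `a, b ≤ n` and `a + b = j`. -/
def pairCount (n j : ℕ) : ℕ := min j n + 1 - (j - n)

theorem card_filter_add_eq (n j : ℕ) :
    ((Finset.range (n + 1) ×ˢ Finset.range (n + 1)).filter fun q => q.1 + q.2 = j).card =
      pairCount n j := by
  have h : ((Finset.range (n + 1) ×ˢ Finset.range (n + 1)).filter fun q => q.1 + q.2 = j) =
      (Finset.Icc (j - n) (min j n)).image fun a => (a, j - a) := by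
    ext ⟨a, b⟩
    simp only [Finset.mem_filter, Finset.mem_product, Finset.mem_range, Finset.mem_image,
      Finset.mem_Icc, Prod.mk.injEq]
    constructor
    · intro h
      exact ⟨a, by omega, rfl, by omega⟩
    · rintro ⟨a', h, rfl, h2⟩
      omega
  rw [h, Finset.card_image_of_injective _ fun a b hab => (Prod.mk.inj hab).1, Nat.card_Icc]
  rfl

theorem sum_sum_add_eq (n : ℕ) (G : ℕ → ℝ) :
    ∑ a ∈ Finset.range (n + 1), ∑ b ∈ Finset.range (n + 1), G (a + b) =
      ∑ j ∈ Finset.range (2 * (n + 1)), (pairCount n j : ℝ) * G j := by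
  rw [← Finset.sum_product' (f := fun a b => G (a + b)),
    ← Finset.sum_fiberwise_of_maps_to (g := fun q : ℕ × ℕ => q.1 + q.2)
      (t := Finset.range (2 * (n + 1)))]
  · refine Finset.sum_congr rfl fun j _ => ?_
    rw [← card_filter_add_eq, ← nsmul_eq_mul]
    refine Finset.sum_eq_card_nsmul fun q hq => ?_
    rw [(Finset.mem_filter.1 hq).2]
  · intro q hq
    simp only [Finset.mem_product, Finset.mem_range] at hq ⊢
    omega

theorem integral_mul_inv_sqrt (f : ℝ → ℝ) :
    ∫ x in (-1 : ℝ)..1, f x * (Real.sqrt (1 - x ^ 2))⁻¹ =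
      ∫ θ in (0 : ℝ)..Real.pi, f (Real.cos θ) := by
  rw [← Polynomial.Chebyshev.integral_measureT_eq_integral_cos,
    Polynomial.Chebyshev.integral_measureT]
  simp only [Real.sqrt_inv]

/-- If the difference quotient of `f` extends to a kernel `S`, then `Γ(f, f)` is an angular
integral. -/
theorem Gam_self_eq (f : ℝ → ℝ) (S : ℝ → ℝ → ℝ)
    (hS : ∀ x y, f x - f y = S x y * (x - y)) :
    Gam f f = 1 / Real.pi ^ 2 * ∫ φ in (0 : ℝ)..Real.pi, ∫ θ in (0 : ℝ)..Real.pi,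
      S (Real.cos φ) (Real.cos θ) ^ 2 * (1 - Real.cos φ * Real.cos θ) := by
  have inner (x : ℝ) : (∫ y in (-1 : ℝ)..1,
      ((f x - f y) / (x - y)) * ((f x - f y) / (x - y)) *
        ((1 - x * y) / (Real.sqrt (1 - x ^ 2) * Real.sqrt (1 - y ^ 2)))) =
      (∫ θ in (0 : ℝ)..Real.pi, S x (Real.cos θ) ^ 2 * (1 - x * Real.cos θ)) *
        (Real.sqrt (1 - x ^ 2))⁻¹ := by
    rw [← integral_mul_inv_sqrt (fun y => S x y ^ 2 * (1 - x * y)),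
      ← intervalIntegral.integral_mul_const]
    refine intervalIntegral.integral_congr_ae ?_
    filter_upwards [compl_mem_ae_iff.2 (measure_singleton x)] with y hy _
    have hxy : x - y ≠ 0 := sub_ne_zero.2 fun h => hy h.symm
    rw [hS, mul_div_cancel_right₀ _ hxy, div_eq_mul_inv, mul_inv]
    ring
  unfold Gam
  simp only [inner]
  rw [integral_mul_inv_sqrt]

theorem Gam_affine_pow (p : ℝ) (n : ℕ) :
    Gam (fun x => (1 - p * (1 - x)) ^ (n + 1)) (fun x => (1 - p * (1 - x)) ^ (n + 1)) =
      p ^ 2 / Real.pi ^ 2 * ∑ j ∈ Finset.range (2 * (n + 1)), (pairCount n j : ℝ) *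
        (cosMoment p 1 j * cosMoment p 0 (2 * n - j) + cosMoment p 0 j * cosMoment p 1 (2 * n - j)
          - cosMoment p 1 j * cosMoment p 1 (2 * n - j)) := by
  rw [← sum_sum_add_eq n fun j => cosMoment p 1 j * cosMoment p 0 (2 * n - j) +
    cosMoment p 0 j * cosMoment p 1 (2 * n - j) - cosMoment p 1 j * cosMoment p 1 (2 * n - j),
    Gam_self_eq _ (fun x y => p * ∑ a ∈ Finset.range (n + 1),
      (1 - p * (1 - x)) ^ a * (1 - p * (1 - y)) ^ (n + 1 - 1 - a))]
  · have key (x y : ℝ) : (p * ∑ a ∈ Finset.range (n + 1),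
        (1 - p * (1 - x)) ^ a * (1 - p * (1 - y)) ^ (n + 1 - 1 - a)) ^ 2 * (1 - x * y) =
        p ^ 2 * ∑ a ∈ Finset.range (n + 1), ∑ b ∈ Finset.range (n + 1),
          ((1 - x) ^ 1 * (1 - p * (1 - x)) ^ (a + b) *
              ((1 - y) ^ 0 * (1 - p * (1 - y)) ^ (2 * n - (a + b))) +
            (1 - x) ^ 0 * (1 - p * (1 - x)) ^ (a + b) *
              ((1 - y) ^ 1 * (1 - p * (1 - y)) ^ (2 * n - (a + b))) -
            (1 - x) ^ 1 * (1 - p * (1 - x)) ^ (a + b) *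
              ((1 - y) ^ 1 * (1 - p * (1 - y)) ^ (2 * n - (a + b)))) := by
      rw [mul_pow, sq (Finset.sum _ _), Finset.sum_mul_sum, mul_assoc, Finset.sum_mul]
      congr 1
      refine Finset.sum_congr rfl fun a ha => ?_
      rw [Finset.sum_mul]
      refine Finset.sum_congr rfl fun b hb => ?_
      rw [Finset.mem_range] at ha hb
      have h : 2 * n - (a + b) = (n + 1 - 1 - a) + (n + 1 - 1 - b) := by omega
      rw [h, pow_add _ (n + 1 - 1 - a), pow_add _ a]
      ring
    have inner (x : ℝ) : (∫ θ in (0 : ℝ)..Real.pi, (p * ∑ a ∈ Finset.range (n + 1),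
        (1 - p * (1 - x)) ^ a * (1 - p * (1 - Real.cos θ)) ^ (n + 1 - 1 - a)) ^ 2 *
          (1 - x * Real.cos θ)) =
        p ^ 2 * ∑ a ∈ Finset.range (n + 1), ∑ b ∈ Finset.range (n + 1),
          ((1 - x) ^ 1 * (1 - p * (1 - x)) ^ (a + b) * cosMoment p 0 (2 * n - (a + b)) +
            (1 - x) ^ 0 * (1 - p * (1 - x)) ^ (a + b) * cosMoment p 1 (2 * n - (a + b)) -
            (1 - x) ^ 1 * (1 - p * (1 - x)) ^ (a + b) * cosMoment p 1 (2 * n - (a + b))) := by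
      simp only [key]
      rw [intervalIntegral.integral_const_mul, intervalIntegral.integral_finsetSum
        fun a _ => Continuous.intervalIntegrable (by fun_prop) _ _]
      congr 1
      refine Finset.sum_congr rfl fun a _ => ?_
      rw [intervalIntegral.integral_finsetSum
        fun b _ => Continuous.intervalIntegrable (by fun_prop) _ _]
      refine Finset.sum_congr rfl fun b _ => ?_
      rw [intervalIntegral.integral_sub (Continuous.intervalIntegrable (by fun_prop) _ _)
        (Continuous.intervalIntegrable (by fun_prop) _ _),
        intervalIntegral.integral_add (Continuous.intervalIntegrable (by fun_prop) _ _)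
        (Continuous.intervalIntegrable (by fun_prop) _ _)]
      simp only [intervalIntegral.integral_const_mul]
      rfl
    simp only [inner]
    rw [intervalIntegral.integral_const_mul, ← mul_assoc, one_div_mul_eq_div,
      intervalIntegral.integral_finsetSum
        fun a _ => Continuous.intervalIntegrable (by fun_prop) _ _]
    congr 1
    refine Finset.sum_congr rfl fun a _ => ?_
    rw [intervalIntegral.integral_finsetSum
      fun b _ => Continuous.intervalIntegrable (by fun_prop) _ _]
    refine Finset.sum_congr rfl fun b _ => ?_
    rw [intervalIntegral.integral_sub (Continuous.intervalIntegrable (by fun_prop) _ _)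
      (Continuous.intervalIntegrable (by fun_prop) _ _),
      intervalIntegral.integral_add (Continuous.intervalIntegrable (by fun_prop) _ _)
      (Continuous.intervalIntegrable (by fun_prop) _ _)]
    simp only [intervalIntegral.integral_mul_const]
    rfl
  · intro x y
    rw [← (Commute.all (1 - p * (1 - x)) (1 - p * (1 - y))).geom_sum₂_mul]
    ring

theorem cosMoment_nonneg {p : ℝ} (hp : 0 ≤ p) (hp' : p ≤ 1 / 2) (m k : ℕ) :
    0 ≤ cosMoment p m k := by
  refine intervalIntegral.integral_nonneg Real.pi_pos.le fun θ _ => ?_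
  have h1 := Real.cos_le_one θ
  have h2 := Real.neg_one_le_cos θ
  have h3 : 0 ≤ 1 - p * (1 - Real.cos θ) := by nlinarith
  have h4 : 0 ≤ 1 - Real.cos θ := by linarith
  positivity

theorem one_sub_cos_eq (x : ℝ) : 1 - Real.cos x = x ^ 2 / 2 * Real.sinc (x / 2) ^ 2 := by
  have h : Real.sin (x / 2) = x / 2 * Real.sinc (x / 2) := by
    rcases eq_or_ne (x / 2) 0 with h | h
    · simp [h]
    · rw [Real.sinc_of_ne_zero h, mul_div_cancel₀ _ h]
  have h2 := Real.cos_sq_add_sin_sq (x / 2)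
  have h3 := Real.cos_two_mul (x / 2)
  rw [mul_div_cancel₀ x two_ne_zero] at h3
  rw [h3]
  rw [h] at h2
  linear_combination (-2) * h2

theorem tendsto_mul_one_sub_cos (s : ℝ) :
    Tendsto (fun k : ℕ => ((k : ℝ) + 1) * (1 - Real.cos (s / Real.sqrt (k + 1)))) atTop
      (𝓝 (s ^ 2 / 2)) := by
  have hr : Tendsto (fun k : ℕ => Real.sqrt ((k : ℝ) + 1)) atTop atTop :=
    Real.tendsto_sqrt_atTop.comp (tendsto_atTop_add_const_right _ _ tendsto_natCast_atTop_atTop)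
  have h0 : Tendsto (fun k : ℕ => s / Real.sqrt ((k : ℝ) + 1) / 2) atTop (𝓝 0) := by
    simpa using (hr.const_div_atTop s).div_const 2
  have h1 := (Real.continuous_sinc.tendsto 0).comp h0
  have h2 := (h1.pow 2).const_mul (s ^ 2 / 2)
  rw [Real.sinc_zero, one_pow, mul_one] at h2
  refine h2.congr fun k => ?_
  have hk : (0 : ℝ) < k + 1 := by positivity
  rw [one_sub_cos_eq, div_pow s, Real.sq_sqrt hk.le, Function.comp_apply]
  field_simp

theorem integrable_sq_div_two_pow_mul_exp {b : ℝ} (hb : 0 < b) (m : ℕ) :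
    Integrable fun s : ℝ => (s ^ 2 / 2) ^ m * Real.exp (-b * s ^ 2) := by
  have h := (integrable_rpow_mul_exp_neg_mul_sq hb (s := ((2 * m : ℕ) : ℝ))
    (neg_one_lt_zero.trans_le (Nat.cast_nonneg _))).const_mul ((1 / 2) ^ m)
  refine h.congr (Eventually.of_forall fun s => ?_)
  simp only [Real.rpow_natCast, pow_mul, div_pow]
  ring

/-- The integrand of the rescaled moment, as a function on the half line. -/
def scaledIntegrand (p : ℝ) (m k : ℕ) : ℝ → ℝ :=
  (Set.Ioc 0 (Real.pi * Real.sqrt (k + 1))).indicator fun s =>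
    (((k : ℝ) + 1) * (1 - Real.cos (s / Real.sqrt (k + 1)))) ^ m *
      (1 - p * (1 - Real.cos (s / Real.sqrt (k + 1)))) ^ k

theorem scaled_cosMoment_eq (p : ℝ) (m k : ℕ) :
    ((k : ℝ) + 1) ^ m * Real.sqrt (k + 1) * cosMoment p m k =
      ∫ s in Set.Ioi 0, scaledIntegrand p m k s := by
  have hk : (0 : ℝ) < k + 1 := by positivity
  have hr : 0 < Real.sqrt ((k : ℝ) + 1) := Real.sqrt_pos.2 hk
  rw [scaledIntegrand, setIntegral_indicator measurableSet_Ioc, Set.inter_eq_self_of_subset_right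
    Set.Ioc_subset_Ioi_self, ← intervalIntegral.integral_of_le (by positivity),
    intervalIntegral.integral_comp_div (f := fun θ => (((k : ℝ) + 1) * (1 - Real.cos θ)) ^ m *
      (1 - p * (1 - Real.cos θ)) ^ k) hr.ne', zero_div, mul_div_cancel_right₀ _ hr.ne']
  simp only [mul_pow, mul_assoc]
  rw [intervalIntegral.integral_const_mul, smul_eq_mul, cosMoment]
  ring

theorem scaledIntegrand_norm_le {p : ℝ} (hp : 0 < p) (hp' : p ≤ 1 / 2) (m : ℕ) {k : ℕ}
    (hk : 1 ≤ k) (s : ℝ) :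
    ‖scaledIntegrand p m k s‖ ≤
      (s ^ 2 / 2) ^ m * Real.exp (-(p / Real.pi ^ 2) * s ^ 2) := by
  unfold scaledIntegrand
  by_cases hs : s ∈ Set.Ioc 0 (Real.pi * Real.sqrt (k + 1))
  swap
  · rw [Set.indicator_of_notMem hs, norm_zero]
    positivity
  rw [Set.indicator_of_mem hs]
  have hk0 : (0 : ℝ) < k + 1 := by positivity
  have hr : 0 < Real.sqrt ((k : ℝ) + 1) := Real.sqrt_pos.2 hk0
  have hx : (s / Real.sqrt (k + 1)) ^ 2 = s ^ 2 / (k + 1) := by rw [div_pow, Real.sq_sqrt hk0.le]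
  have hxpi : |s / Real.sqrt (k + 1)| ≤ Real.pi := by
    rw [abs_of_nonneg (by have := hs.1; positivity), div_le_iff₀ hr]
    exact hs.2
  have hup := Real.cos_le_one_sub_mul_cos_sq hxpi
  have hlow := Real.one_sub_sq_div_two_le_cos (x := s / Real.sqrt (k + 1))
  have hc1 := Real.cos_le_one (s / Real.sqrt (k + 1))
  have hc2 := Real.neg_one_le_cos (s / Real.sqrt (k + 1))
  set C := Real.cos (s / Real.sqrt (k + 1))
  rw [hx] at hup hlow
  have hnn : 0 ≤ 1 - p * (1 - C) := by nlinarith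
  have h1C : 0 ≤ 1 - C := by linarith
  rw [Real.norm_of_nonneg (by positivity)]
  have hfirst : ((k : ℝ) + 1) * (1 - C) ≤ s ^ 2 / 2 := by
    calc ((k : ℝ) + 1) * (1 - C) ≤ (k + 1) * (s ^ 2 / (k + 1) / 2) := by gcongr; linarith
      _ = s ^ 2 / 2 := by field_simp
  have hsecond : (1 - p * (1 - C)) ^ k ≤ Real.exp (-(p / Real.pi ^ 2) * s ^ 2) := by
    have hk1 : (1 : ℝ) ≤ k := by exact_mod_cast hk
    calc (1 - p * (1 - C)) ^ k ≤ Real.exp (-(p * (1 - C))) ^ k := by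
          gcongr
          linarith [Real.add_one_le_exp (-(p * (1 - C)))]
      _ = Real.exp (k * -(p * (1 - C))) := (Real.exp_nat_mul _ _).symm
      _ ≤ _ := by
          rw [Real.exp_le_exp]
          have h1 : 2 / Real.pi ^ 2 * (s ^ 2 / (k + 1)) ≤ 1 - C := by linarith
          have h2 : k * (p * (2 / Real.pi ^ 2 * (s ^ 2 / (k + 1)))) ≤ k * (p * (1 - C)) := by
            gcongr
          have h3 : p / Real.pi ^ 2 * s ^ 2 * 1 ≤
              p / Real.pi ^ 2 * s ^ 2 * (2 * k / (k + 1)) := by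
            gcongr
            rw [le_div_iff₀ hk0]
            linarith
          have h4 : p / Real.pi ^ 2 * s ^ 2 * (2 * k / (k + 1)) =
              k * (p * (2 / Real.pi ^ 2 * (s ^ 2 / (k + 1)))) := by ring
          linarith
  gcongr

theorem scaledIntegrand_tendsto (p : ℝ) (m : ℕ) {s : ℝ} (hs : 0 < s) :
    Tendsto (fun k => scaledIntegrand p m k s) atTop
      (𝓝 ((s ^ 2 / 2) ^ m * Real.exp (-(p / 2) * s ^ 2))) := by
  have hr : Tendsto (fun k : ℕ => Real.pi * Real.sqrt ((k : ℝ) + 1)) atTop atTop :=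
    (Real.tendsto_sqrt_atTop.comp (tendsto_atTop_add_const_right _ _
      tendsto_natCast_atTop_atTop)).const_mul_atTop Real.pi_pos
  have h := tendsto_mul_one_sub_cos s
  have h2 : Tendsto (fun k : ℕ => (k : ℝ) * (-(p * (1 - Real.cos (s / Real.sqrt (k + 1))))))
      atTop (𝓝 (-(p / 2) * s ^ 2)) := by
    have h3 := (tendsto_natCast_div_add_atTop (1 : ℝ)).mul (h.const_mul (-p))
    rw [show (1 : ℝ) * (-p * (s ^ 2 / 2)) = -(p / 2) * s ^ 2 by ring] at h3
    refine h3.congr fun k => ?_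
    have hk : (k : ℝ) + 1 ≠ 0 := by positivity
    field_simp
  have h4 := (h.pow m).mul (Real.tendsto_one_add_pow_exp_of_tendsto h2)
  refine h4.congr' ?_
  filter_upwards [hr.eventually_ge_atTop s] with k hk
  rw [scaledIntegrand, Set.indicator_of_mem (Set.mem_Ioc.2 ⟨hs, hk⟩)]
  ring

theorem cosMoment_tendsto {p : ℝ} (hp : 0 < p) (hp' : p ≤ 1 / 2) (m : ℕ) :
    ∃ A : ℝ, 0 < A ∧ Tendsto (fun k : ℕ => ((k : ℝ) + 1) ^ m * Real.sqrt (k + 1) *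
      cosMoment p m k) atTop (𝓝 A) := by
  refine ⟨∫ s in Set.Ioi 0, (s ^ 2 / 2) ^ m * Real.exp (-(p / 2) * s ^ 2), ?_, ?_⟩
  · rw [setIntegral_pos_iff_support_of_nonneg_ae (Eventually.of_forall fun s => by positivity)
      (integrable_sq_div_two_pow_mul_exp (by positivity) m).integrableOn]
    have h : Set.Ioi (0 : ℝ) ⊆ Function.support
        (fun s : ℝ => (s ^ 2 / 2) ^ m * Real.exp (-(p / 2) * s ^ 2)) ∩ Set.Ioi 0 := by
      intro s hs
      have hs' : 0 < s := hs
      exact ⟨(show 0 < (s ^ 2 / 2) ^ m * Real.exp (-(p / 2) * s ^ 2) by positivity).ne', hs⟩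
    exact lt_of_lt_of_le (by simp) (measure_mono h)
  · simp only [scaled_cosMoment_eq]
    refine tendsto_integral_filter_of_dominated_convergence _ ?_
      ((eventually_ge_atTop 1).mono fun k hk =>
        Eventually.of_forall (scaledIntegrand_norm_le hp hp' m hk))
      (integrable_sq_div_two_pow_mul_exp (by positivity) m).integrableOn ?_
    · refine Eventually.of_forall fun k => ?_
      refine (Measurable.indicator ?_ measurableSet_Ioc).aestronglyMeasurable
      fun_prop
    · exact (ae_restrict_iff' measurableSet_Ioi).2 (Eventually.of_forall fun s hs =>
        scaledIntegrand_tendsto p m hs)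

theorem integral_natFloor_eq_sum (g : ℕ → ℝ) (N : ℕ) :
    ∫ t in (0 : ℝ)..N, g ⌊t⌋₊ = ∑ j ∈ Finset.range N, g j := by
  have hae (k : ℕ) : ∀ t ∈ Set.Ioo (k : ℝ) ((k + 1 : ℕ) : ℝ), g k = g ⌊t⌋₊ := by
    intro t ht
    rw [(Nat.floor_eq_iff (k.cast_nonneg.trans ht.1.le)).2 ⟨ht.1.le, by exact_mod_cast ht.2⟩]
  have hle (k : ℕ) : (k : ℝ) ≤ ((k + 1 : ℕ) : ℝ) := by push_cast; linarith
  have := intervalIntegral.sum_integral_adjacent_intervals (f := fun t : ℝ => g ⌊t⌋₊)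
    (μ := volume) (a := fun k : ℕ => (k : ℝ)) (n := N) (fun k _ => by
      refine IntervalIntegrable.congr_ae (f := fun _ => g k) intervalIntegrable_const ?_
      rw [Set.uIoc_of_le (hle k), EventuallyEq, ← restrict_Ioo_eq_restrict_Ioc]
      exact (ae_restrict_iff' measurableSet_Ioo).2 (Eventually.of_forall (hae k)))
  rw [Nat.cast_zero] at this
  rw [← this]
  refine Finset.sum_congr rfl fun k _ => ?_
  rw [intervalIntegral.integral_of_le (hle k), ← restrict_Ioo_eq_restrict_Ioc,
    ← setIntegral_congr_fun measurableSet_Ioo (hae k)]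
  simp

theorem sum_eq_integral_natFloor_mul (g : ℕ → ℝ) (n : ℕ) :
    ∑ j ∈ Finset.range (2 * (n + 1)), g j =
      ∫ s in (0 : ℝ)..2, ((n : ℝ) + 1) * g ⌊((n : ℝ) + 1) * s⌋₊ := by
  rw [← integral_natFloor_eq_sum, intervalIntegral.integral_const_mul,
    intervalIntegral.mul_integral_comp_mul_left (f := fun t : ℝ => g ⌊t⌋₊)]
  push_cast
  rw [mul_zero, mul_comm]

theorem intervalIntegrable_inv_sqrt_mul_sqrt :
    IntervalIntegrable (fun s : ℝ => (Real.sqrt s * Real.sqrt ((2 - s) / 2))⁻¹) volume 0 2 := by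
  have h := (Polynomial.Chebyshev.intervalIntegrable_sqrt_one_sub_sq_inv.comp_sub_right
    1).const_mul (Real.sqrt 2)
  norm_num at h
  refine h.congr fun s hs => ?_
  rw [Set.uIoc_of_le (by norm_num)] at hs
  have h2 : 0 ≤ 2 - s := by linarith [hs.2]
  have h1 : 1 - (s - 1) ^ 2 = s * (2 - s) := by ring
  simp only [h1]
  rw [Real.sqrt_mul hs.1.le, Real.sqrt_div h2]
  simp only [mul_inv, inv_div]
  ring

theorem pairCount_cast {n j : ℕ} (h : j ≤ 2 * n) :
    (pairCount n j : ℝ) = min ((j : ℝ) + 1) (((2 * n - j : ℕ) : ℝ) + 1) := by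
  have : pairCount n j = min (j + 1) (2 * n - j + 1) := by unfold pairCount; omega
  rw [this]; push_cast; rfl

/-- The summand of `sum_pairCount_tendsto` in rescaled variables: `x` and `y` are the rescaled
indices, `z` is the inverse scale, and `a`, `b`, `a'`, `b'` are the normalized sequences. -/
def scaledSummand (x y z a b a' b' : ℝ) : ℝ :=
  (Real.sqrt x * Real.sqrt y)⁻¹ *
    (min x y / x * (b * a') + min x y / y * (a * b') - z / x * (min x y / y) * (b * b'))

theorem abs_scaledSummand_le {x y z a b a' b' K : ℝ} (hx : 0 < x) (hy : 0 < y) (hz : 0 ≤ z)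
    (hzx : z ≤ x) (ha : 0 ≤ a) (hb : 0 ≤ b) (ha' : 0 ≤ a') (hb' : 0 ≤ b') (haK : a ≤ K)
    (hbK : b ≤ K) (haK' : a' ≤ K) (hbK' : b' ≤ K) :
    |scaledSummand x y z a b a' b'| ≤ 2 * K ^ 2 * (Real.sqrt x * Real.sqrt y)⁻¹ := by
  have hm : 0 ≤ min x y := (lt_min hx hy).le
  have hmx : min x y / x ≤ 1 := (div_le_one hx).2 (min_le_left _ _)
  have hmy : min x y / y ≤ 1 := (div_le_one hy).2 (min_le_right _ _)
  have hz1 : z / x ≤ 1 := (div_le_one hx).2 hzx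
  have hK : 0 ≤ K := ha.trans haK
  have h1 : min x y / x * (b * a') ≤ 1 * (K * K) := by gcongr
  have h2 : min x y / y * (a * b') ≤ 1 * (K * K) := by gcongr
  have h3 : z / x * (min x y / y) * (b * b') ≤ 1 * 1 * (K * K) := by gcongr
  have h1' : 0 ≤ min x y / x * (b * a') := by positivity
  have h2' : 0 ≤ min x y / y * (a * b') := by positivity
  have h3' : 0 ≤ z / x * (min x y / y) * (b * b') := by positivity
  rw [scaledSummand, abs_mul, abs_of_nonneg (by positivity : 0 ≤ (Real.sqrt x * Real.sqrt y)⁻¹),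
    mul_comm]
  gcongr
  rw [abs_le]
  constructor <;> nlinarith

theorem pairCount_mul_eq_scaledSummand {n j : ℕ} (hj : j ≤ 2 * n) (L M : ℕ → ℝ) :
    ((n : ℝ) + 1) * ((pairCount n j : ℝ) *
      (L j * M (2 * n - j) + M j * L (2 * n - j) - L j * L (2 * n - j))) =
    scaledSummand (((j : ℝ) + 1) / (n + 1)) ((((2 * n - j : ℕ) : ℝ) + 1) / (n + 1))
      (1 / ((n : ℝ) + 1)) (Real.sqrt (j + 1) * M j) (((j : ℝ) + 1) * Real.sqrt (j + 1) * L j)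
      (Real.sqrt ((2 * n - j : ℕ) + 1) * M (2 * n - j))
      ((((2 * n - j : ℕ) : ℝ) + 1) * Real.sqrt ((2 * n - j : ℕ) + 1) * L (2 * n - j)) := by
  generalize hk : 2 * n - j = k
  have hr : (0 : ℝ) < n + 1 := by positivity
  have hj0 : (0 : ℝ) < j + 1 := by positivity
  have hk0 : (0 : ℝ) < k + 1 := by positivity
  rw [pairCount_cast hj, hk, scaledSummand, Real.sqrt_div hj0.le, Real.sqrt_div hk0.le,
    min_div_div_right hr.le]
  generalize min ((j : ℝ) + 1) (k + 1) = w
  have h1 := Real.sqrt_pos.2 hj0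
  have h2 := Real.sqrt_pos.2 hk0
  have h3 := Real.sqrt_pos.2 hr
  have h3' := Real.sq_sqrt hr.le
  generalize Real.sqrt ((j : ℝ) + 1) = X at *
  generalize Real.sqrt ((k : ℝ) + 1) = Y at *
  generalize Real.sqrt ((n : ℝ) + 1) = R at *
  generalize (j : ℝ) + 1 = x at *
  generalize (k : ℝ) + 1 = y at *
  generalize (n : ℝ) + 1 = r at *
  subst h3'
  field_simp

theorem scaledSummand_tendsto {ι : Type*} {l : Filter ι} {x y z a b a' b' : ι → ℝ}
    {x₀ y₀ A B : ℝ} (hx₀ : 0 < x₀) (hy₀ : 0 < y₀) (hx : Tendsto x l (𝓝 x₀))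
    (hy : Tendsto y l (𝓝 y₀)) (hz : Tendsto z l (𝓝 0)) (ha : Tendsto a l (𝓝 A))
    (hb : Tendsto b l (𝓝 B)) (ha' : Tendsto a' l (𝓝 A)) (hb' : Tendsto b' l (𝓝 B)) :
    Tendsto (fun i => scaledSummand (x i) (y i) (z i) (a i) (b i) (a' i) (b' i)) l
      (𝓝 (scaledSummand x₀ y₀ 0 A B A B)) := by
  have hm := hx.min hy
  have hsx := Real.sqrt_pos.2 hx₀
  have hsy := Real.sqrt_pos.2 hy₀
  exact ((hx.sqrt.mul hy.sqrt).inv₀ (by positivity)).mul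
    ((((hm.div hx hx₀.ne').mul (hb.mul ha')).add ((hm.div hy hy₀.ne').mul (ha.mul hb'))).sub
      (((hz.div hx hx₀.ne').mul (hm.div hy hy₀.ne')).mul (hb.mul hb')))

theorem sum_pairCount_tendsto {L M : ℕ → ℝ} {A B : ℝ} (hA : 0 < A) (hB : 0 < B)
    (hM0 : ∀ k, 0 ≤ M k) (hL0 : ∀ k, 0 ≤ L k)
    (hM : Tendsto (fun k : ℕ => Real.sqrt (k + 1) * M k) atTop (𝓝 A))
    (hL : Tendsto (fun k : ℕ => ((k : ℝ) + 1) * Real.sqrt (k + 1) * L k) atTop (𝓝 B)) :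
    ∃ α : ℝ, 0 < α ∧ Tendsto (fun n : ℕ => ∑ j ∈ Finset.range (2 * (n + 1)),
      (pairCount n j : ℝ) * (L j * M (2 * n - j) + M j * L (2 * n - j) - L j * L (2 * n - j)))
      atTop (𝓝 α) := by
  obtain ⟨K₁, hK₁⟩ := hM.bddAbove_range
  obtain ⟨K₂, hK₂⟩ := hL.bddAbove_range
  set K := max K₁ K₂
  have haK (k : ℕ) : Real.sqrt (k + 1) * M k ≤ K :=
    (hK₁ (Set.mem_range_self k)).trans (le_max_left _ _)
  have hbK (k : ℕ) : ((k : ℝ) + 1) * Real.sqrt (k + 1) * L k ≤ K :=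
    (hK₂ (Set.mem_range_self k)).trans (le_max_right _ _)
  have ha0 (k : ℕ) : 0 ≤ Real.sqrt (k + 1) * M k := mul_nonneg (by positivity) (hM0 k)
  have hb0 (k : ℕ) : 0 ≤ ((k : ℝ) + 1) * Real.sqrt (k + 1) * L k :=
    mul_nonneg (by positivity) (hL0 k)
  set bound : ℝ → ℝ := fun s => 2 * K ^ 2 * (Real.sqrt s * Real.sqrt ((2 - s) / 2))⁻¹
  have hbi : IntervalIntegrable bound volume 0 2 :=
    intervalIntegrable_inv_sqrt_mul_sqrt.const_mul _
  set F : ℕ → ℝ → ℝ := fun n s => ((n : ℝ) + 1) * (fun j : ℕ => (pairCount n j : ℝ) *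
    (L j * M (2 * n - j) + M j * L (2 * n - j) - L j * L (2 * n - j))) ⌊((n : ℝ) + 1) * s⌋₊
  have hFm (n : ℕ) : Measurable (F n) := by
    have hfloor : Measurable fun s : ℝ => ⌊((n : ℝ) + 1) * s⌋₊ :=
      Nat.measurable_floor.comp (by fun_prop)
    exact ((measurable_of_countable fun j : ℕ => (pairCount n j : ℝ) *
      (L j * M (2 * n - j) + M j * L (2 * n - j) - L j * L (2 * n - j))).comp hfloor).const_mul _
  have hne2 : ∀ᵐ s : ℝ, s ≠ 2 := compl_mem_ae_iff.2 (measure_singleton 2)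
  have hFb (n : ℕ) (s : ℝ) (hs : 0 < s) (hs2 : s < 2) : ‖F n s‖ ≤ bound s := by
    have hr : (0 : ℝ) < n + 1 := by positivity
    have hlt := Nat.lt_floor_add_one (((n : ℝ) + 1) * s)
    have hle := Nat.floor_le (mul_pos hr hs).le
    have hb : 0 ≤ bound s := by positivity
    simp only [F]
    generalize ⌊((n : ℝ) + 1) * s⌋₊ = j at *
    rcases le_or_gt j (2 * n) with hj | hj
    · rw [pairCount_mul_eq_scaledSummand hj, Real.norm_eq_abs]
      refine (abs_scaledSummand_le (by positivity) (by positivity) (by positivity) ?_ (ha0 _)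
        (hb0 _) (ha0 _) (hb0 _) (haK _) (hbK _) (haK _) (hbK _)).trans ?_
      · gcongr
        linarith [(Nat.cast_nonneg j : (0 : ℝ) ≤ j)]
      · have h2s : 0 < 2 - s := by linarith
        have h1 : s ≤ ((j : ℝ) + 1) / (n + 1) := by
          rw [le_div_iff₀ hr]; linarith
        have h2 : (2 - s) / 2 ≤ (((2 * n - j : ℕ) : ℝ) + 1) / (n + 1) := by
          rw [le_div_iff₀ hr]
          have h3 : (0 : ℝ) ≤ ((2 * n - j : ℕ) : ℝ) := Nat.cast_nonneg _
          rw [Nat.cast_sub hj] at h3 ⊢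
          push_cast at h3 ⊢
          linarith
        have h4 := Real.sqrt_pos.2 hs
        have h5 := Real.sqrt_pos.2 (half_pos h2s)
        simp only [bound]
        gcongr
    · have : pairCount n j = 0 := by unfold pairCount; omega
      simpa [this] using hb
  have hFl (s : ℝ) (hs : 0 < s) (hs2 : s < 2) :
      Tendsto (fun n => F n s) atTop (𝓝 (scaledSummand s (2 - s) 0 A B A B)) := by
    have hr : Tendsto (fun n : ℕ => (n : ℝ) + 1) atTop atTop :=
      tendsto_atTop_add_const_right _ _ tendsto_natCast_atTop_atTop
    have hz : Tendsto (fun n : ℕ => 1 / ((n : ℝ) + 1)) atTop (𝓝 0) :=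
      tendsto_one_div_add_atTop_nhds_zero_nat
    have hfl : Tendsto (fun n : ℕ => (⌊((n : ℝ) + 1) * s⌋₊ : ℝ) / (n + 1)) atTop (𝓝 s) := by
      have := (tendsto_nat_floor_mul_div_atTop hs.le).comp hr
      refine this.congr fun n => ?_
      simp [mul_comm]
    have hx : Tendsto (fun n : ℕ => ((⌊((n : ℝ) + 1) * s⌋₊ : ℝ) + 1) / (n + 1)) atTop (𝓝 s) := by
      simpa [add_div] using hfl.add hz
    have hlt : ∀ᶠ n : ℕ in atTop, ⌊((n : ℝ) + 1) * s⌋₊ ≤ 2 * n := by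
      filter_upwards [hx.eventually_lt_const hs2] with n hn
      rw [div_lt_iff₀ (by positivity)] at hn
      have : ⌊((n : ℝ) + 1) * s⌋₊ + 1 < 2 * (n + 1) := by exact_mod_cast hn
      omega
    have hy : Tendsto (fun n : ℕ => (((2 * n - ⌊((n : ℝ) + 1) * s⌋₊ : ℕ) : ℝ) + 1) / (n + 1))
        atTop (𝓝 (2 - s)) := by
      have h := (hx.const_sub 2)
      refine h.congr' ?_
      filter_upwards [hlt] with n hn
      rw [Nat.cast_sub hn]
      push_cast
      have : (n : ℝ) + 1 ≠ 0 := by positivity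
      field_simp
      ring
    have hjtop : Tendsto (fun n : ℕ => ⌊((n : ℝ) + 1) * s⌋₊) atTop atTop :=
      tendsto_nat_floor_atTop.comp (hr.atTop_mul_const hs)
    have hktop : Tendsto (fun n : ℕ => 2 * n - ⌊((n : ℝ) + 1) * s⌋₊) atTop atTop := by
      have h := hr.atTop_mul_pos (sub_pos.2 hs2) hy
      rw [← tendsto_natCast_atTop_iff (R := ℝ)]
      refine (tendsto_atTop_add_const_right _ (-1) h).congr fun n => ?_
      have : (n : ℝ) + 1 ≠ 0 := by positivity
      rw [mul_div_cancel₀ _ this, add_neg_cancel_right]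
    refine (scaledSummand_tendsto hs (sub_pos.2 hs2) hx hy hz (hM.comp hjtop) (hL.comp hjtop)
      (hM.comp hktop) (hL.comp hktop)).congr' ?_
    filter_upwards [hlt] with n hn
    simp only [F]
    rw [pairCount_mul_eq_scaledSummand hn]
    rfl
  have hlim : ∀ s ∈ Set.Ioo (0 : ℝ) 2, 0 < scaledSummand s (2 - s) 0 A B A B := by
    intro s hs
    have h1 : 0 < s := hs.1
    have h2 : 0 < 2 - s := sub_pos.2 hs.2
    have h3 : 0 < min s (2 - s) := lt_min h1 h2
    rw [scaledSummand, zero_div, zero_mul, zero_mul, sub_zero]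
    positivity
  have hmem {s : ℝ} (hs : s ∈ Set.uIoc (0 : ℝ) 2) (h2 : s ≠ 2) : 0 < s ∧ s < 2 := by
    rw [Set.uIoc_of_le zero_le_two] at hs
    exact ⟨hs.1, lt_of_le_of_ne hs.2 h2⟩
  have hlimb : IntervalIntegrable (fun s => scaledSummand s (2 - s) 0 A B A B) volume 0 2 := by
    refine hbi.mono_fun ?_ ?_
    · refine Measurable.aestronglyMeasurable ?_
      unfold scaledSummand
      fun_prop
    · rw [EventuallyLE, ae_restrict_iff' measurableSet_uIoc]
      filter_upwards [hne2] with s h2 hs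
      obtain ⟨h0, h2⟩ := hmem hs h2
      exact (le_of_tendsto (hFl s h0 h2).norm (Eventually.of_forall fun n => hFb n s h0 h2)).trans
        (le_abs_self _)
  refine ⟨∫ s in (0 : ℝ)..2, scaledSummand s (2 - s) 0 A B A B,
    intervalIntegral.intervalIntegral_pos_of_pos_on hlimb hlim two_pos, ?_⟩
  simp only [sum_eq_integral_natFloor_mul]
  refine intervalIntegral.tendsto_integral_filter_of_dominated_convergence bound
    (Eventually.of_forall fun n => (hFm n).aestronglyMeasurable) (Eventually.of_forall fun n => ?_)
    hbi ?_
  · filter_upwards [hne2] with s h2 hs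
    exact hFb n s (hmem hs h2).1 (hmem hs h2).2
  · filter_upwards [hne2] with s h2 hs
    exact hFl s (hmem hs h2).1 (hmem hs h2).2

/-- Lemma 2.5(2) of the paper: with `h_i(x) = (x/a₊)^i`, the limit
`α_c = lim_{i → ∞} Γ_c(h_i, h_i)` exists and is positive. -/
theorem GamC_diagonal_limit (c : ℝ) (hc : 1 ≤ c) :
    ∃ α : ℝ, 0 < α ∧
      Tendsto
        (fun i : ℕ => GamC c (fun x => (x / aplus c) ^ i) (fun x => (x / aplus c) ^ i))
        atTop (𝓝 α) := by
  set q := Real.sqrt c with hq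
  have hq0 : 0 < q := Real.sqrt_pos.2 (by linarith)
  have hqc : q ^ 2 = c := Real.sq_sqrt (by linarith)
  set p := 2 * q / (1 + q) ^ 2 with hp
  have hp0 : 0 < p := by positivity
  have hp1 : p ≤ 1 / 2 := by
    rw [hp, div_le_iff₀ (by positivity)]
    nlinarith [sq_nonneg (1 - q)]
  have hcomp (i : ℕ) : (fun x => (x / aplus c) ^ i) ∘ PhiC c =
      fun x => (1 - p * (1 - x)) ^ i := by
    funext x
    simp only [Function.comp, aplus, PhiC, ← hq]
    congr 1
    rw [hp, ← hqc]
    field_simp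
    ring
  obtain ⟨A, hA, hM⟩ := cosMoment_tendsto hp0 hp1 0
  obtain ⟨B, hB, hL⟩ := cosMoment_tendsto hp0 hp1 1
  simp only [pow_zero, one_mul, pow_one] at hM hL
  obtain ⟨α, hα, h⟩ := sum_pairCount_tendsto hA hB (cosMoment_nonneg hp0.le hp1 0)
    (cosMoment_nonneg hp0.le hp1 1) hM hL
  refine ⟨p ^ 2 / Real.pi ^ 2 * α, by positivity, ?_⟩
  rw [← tendsto_add_atTop_iff_nat 1]
  refine (h.const_mul _).congr fun n => ?_
  rw [GamC, hcomp, Gam_affine_pow]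
end
end

section
/- Fix c ∈ [1,∞) and for a real exponent r ≥ 1 let h_r(x) = (x/a₊)^r, where a₊ = (1 + √c)² (for real exponents the power is applied to the nonnegative quantity Φ_c(x)/a₊ ∈ [0,1] appearing inside Γ_c, so it is well defined). Then for every real A ≥ 1 the limit L_c(A) = lim_{i→∞} Γ_c(h_i, h_{Ai}) (limit over positive integers i) exists, and L_c(A) → 0 as A → ∞. -/
open MeasureTheory ProbabilityTheory Filter Topology

noncomputable section

section Auxiliary

open Real Set

/-- The function `(1 - k (1 - cos θ)) ^ r`. -/
def cosPow (k r θ : ℝ) : ℝ := (1 - k * (1 - cos θ)) ^ r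

theorem one_sub_mul_one_sub_cos_nonneg {k : ℝ} (hk : k ≤ 1 / 2) (θ : ℝ) :
    0 ≤ 1 - k * (1 - cos θ) := by
  nlinarith [cos_le_one θ, neg_one_le_cos θ]

theorem cosPow_nonneg {k : ℝ} (hk : k ≤ 1 / 2) (r θ : ℝ) : 0 ≤ cosPow k r θ :=
  rpow_nonneg (one_sub_mul_one_sub_cos_nonneg hk θ) r

theorem cosPow_le_exp {k r : ℝ} (hk : k ≤ 1 / 2) (hr : 0 ≤ r) (θ : ℝ) :
    cosPow k r θ ≤ exp (-(r * (k * (1 - cos θ)))) := by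
  have h1 : 1 - k * (1 - cos θ) ≤ exp (-(k * (1 - cos θ))) := by
    linarith [add_one_le_exp (-(k * (1 - cos θ)))]
  refine (rpow_le_rpow (one_sub_mul_one_sub_cos_nonneg hk θ) h1 hr).trans_eq ?_
  rw [← exp_mul]
  ring_nf

theorem cosPow_le_one {k r : ℝ} (hk0 : 0 ≤ k) (hk : k ≤ 1 / 2) (hr : 0 ≤ r) (θ : ℝ) :
    cosPow k r θ ≤ 1 :=
  rpow_le_one (one_sub_mul_one_sub_cos_nonneg hk θ) (by nlinarith [cos_le_one θ]) hr

theorem cosPow_le_gaussian {k r θ : ℝ} (hk0 : 0 ≤ k) (hk : k ≤ 1 / 2) (hr : 0 ≤ r)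
    (hθ : |θ| ≤ π) : cosPow k r θ ≤ exp (-(2 * k / π ^ 2 * (r * θ ^ 2))) := by
  refine (cosPow_le_exp hk hr θ).trans (exp_le_exp.2 (neg_le_neg ?_))
  have h := cos_le_one_sub_mul_cos_sq hθ
  calc 2 * k / π ^ 2 * (r * θ ^ 2) = r * (k * (2 / π ^ 2 * θ ^ 2)) := by ring
    _ ≤ r * (k * (1 - cos θ)) := by gcongr; linarith

theorem abs_cosPow_sub_le {k r : ℝ} (hk0 : 0 ≤ k) (hk : k ≤ 1 / 2) (hr : 1 ≤ r) (θ φ : ℝ) :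
    |cosPow k r θ - cosPow k r φ| ≤ 2 * √r * |θ - φ| := by
  have hd : ∀ x ∈ (univ : Set ℝ), HasDerivWithinAt (cosPow k r)
      (-(k * sin x) * r * (1 - k * (1 - cos x)) ^ (r - 1)) univ x := fun x _ => by
    have h : HasDerivAt (fun x => 1 - k * (1 - cos x)) (-(k * sin x)) x := by
      convert! (((hasDerivAt_cos x).const_sub 1).const_mul k).const_sub 1 using 1
      ring
    exact (h.rpow_const (Or.inr hr)).hasDerivWithinAt
  refine convex_univ.norm_image_sub_le_of_norm_hasDerivWithin_le hd (fun x _ => ?_)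
    (mem_univ φ) (mem_univ θ)
  rw [norm_eq_abs]
  refine abs_le_of_sq_le_sq ?_ (by positivity)
  set w := k * (1 - cos x) with hw
  have hw0 : 0 ≤ w := mul_nonneg hk0 (by linarith [cos_le_one x])
  have hw1 : w ≤ 1 := by linarith [one_sub_mul_one_sub_cos_nonneg hk x]
  have hE : (1 - w) ^ (r - 1) ≤ exp (-((r - 1) * w)) := cosPow_le_exp hk (by linarith) x
  have hE0 : 0 ≤ (1 - w) ^ (r - 1) := rpow_nonneg (by linarith) _
  have hsq : ((1 - w) ^ (r - 1)) ^ 2 * (1 + 2 * ((r - 1) * w)) ≤ 1 := by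
    calc ((1 - w) ^ (r - 1)) ^ 2 * (1 + 2 * ((r - 1) * w))
        ≤ exp (-((r - 1) * w)) ^ 2 * exp (2 * ((r - 1) * w)) := by
          have := mul_nonneg (sub_nonneg.2 hr) hw0
          gcongr
          linarith [add_one_le_exp (2 * ((r - 1) * w))]
      _ = 1 := by rw [← exp_nat_mul, ← exp_add]; simp
  have hs : (k * sin x) ^ 2 ≤ w := by
    have h1 : (k * sin x) ^ 2 = w * (k * (1 + cos x)) := by
      rw [mul_pow, sin_sq, hw]; ring
    rw [h1]
    exact mul_le_of_le_one_right hw0 (by nlinarith [cos_le_one x, neg_one_le_cos x])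
  have hrw : r * w ≤ 4 * (1 + 2 * ((r - 1) * w)) := by
    nlinarith [mul_nonneg (sub_nonneg.2 hr) hw0]
  calc (-(k * sin x) * r * (1 - w) ^ (r - 1)) ^ 2
      = (k * sin x) ^ 2 * r * (r * ((1 - w) ^ (r - 1)) ^ 2) := by ring
    _ ≤ w * r * (r * ((1 - w) ^ (r - 1)) ^ 2) := by gcongr
    _ = (r * w) * (r * ((1 - w) ^ (r - 1)) ^ 2) := by ring
    _ ≤ (4 * (1 + 2 * ((r - 1) * w))) * (r * ((1 - w) ^ (r - 1)) ^ 2) := by gcongr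
    _ = 4 * r * (((1 - w) ^ (r - 1)) ^ 2 * (1 + 2 * ((r - 1) * w))) := by ring
    _ ≤ 4 * r * 1 := by gcongr
    _ = (2 * √r) ^ 2 := by rw [mul_pow, sq_sqrt (by linarith)]; ring

theorem sq_sub_mul_one_sub_cos_mul_cos_le {θ φ : ℝ} (hθ : θ ∈ Ioo 0 π) (hφ : φ ∈ Ioo 0 π) :
    (θ - φ) ^ 2 * (1 - cos θ * cos φ) ≤ 5 * (cos θ - cos φ) ^ 2 := by
  obtain ⟨p, q, rfl, rfl⟩ : ∃ p q, θ = q + p ∧ φ = q - p :=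
    ⟨(θ - φ) / 2, (θ + φ) / 2, by ring, by ring⟩
  have hpos := mul_pos (sin_pos_of_mem_Ioo hθ) (sin_pos_of_mem_Ioo hφ)
  have hp : |p| ≤ π / 2 := abs_le.2 ⟨by linarith [hθ.1, hφ.2], by linarith [hθ.2, hφ.1]⟩
  have hsp : p ^ 2 ≤ 5 / 2 * sin p ^ 2 := by
    have h := mul_abs_le_abs_sin hp
    have h1 : |p| ≤ π / 2 * |sin p| := by
      calc |p| = π / 2 * (2 / π * |p|) := by field_simp
        _ ≤ _ := by gcongr
    have h2 : |p| ^ 2 ≤ (π / 2 * |sin p|) ^ 2 := by gcongr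
    rw [mul_pow, sq_abs, sq_abs] at h2
    have h3 : (π / 2) ^ 2 ≤ 5 / 2 := by nlinarith [pi_lt_d2, pi_pos]
    exact h2.trans (by gcongr)
  have e1 : sin (q + p) * sin (q - p) = sin q ^ 2 - sin p ^ 2 := by
    rw [sin_add, sin_sub]
    linear_combination (sin q ^ 2) * sin_sq_add_cos_sq p - (sin p ^ 2) * sin_sq_add_cos_sq q
  have e2 : 1 - cos (q + p) * cos (q - p) = sin q ^ 2 + sin p ^ 2 := by
    rw [cos_add, cos_sub]
    linear_combination (-cos q ^ 2) * sin_sq_add_cos_sq p +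
      (sin p ^ 2 - 1) * sin_sq_add_cos_sq q
  have e3 : cos (q + p) - cos (q - p) = -2 * sin q * sin p := by
    rw [cos_add, cos_sub]; ring
  rw [e2, e3]
  rw [e1] at hpos
  calc (q + p - (q - p)) ^ 2 * (sin q ^ 2 + sin p ^ 2)
      ≤ (4 * p ^ 2) * (2 * sin q ^ 2) := by
        rw [show (q + p - (q - p)) ^ 2 = 4 * p ^ 2 by ring]
        gcongr
        linarith
    _ ≤ (4 * (5 / 2 * sin p ^ 2)) * (2 * sin q ^ 2) := by gcongr
    _ = _ := by ring

theorem integral_div_sqrt_one_sub_sq {R : ℝ} (hR : 0 < R) (g : ℝ → ℝ) :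
    ∫ x in (-1 : ℝ)..1, g x / √(1 - x ^ 2) = ∫ a in Ioo 0 (π * R), g (cos (a / R)) / R := by
  have hmem : ∀ a ∈ Ioo 0 (π * R), a / R ∈ Ioo 0 π := fun a ha =>
    ⟨div_pos ha.1 hR, (div_lt_iff₀ hR).2 ha.2⟩
  have himg : (fun a => cos (a / R)) '' Ioo 0 (π * R) = Ioo (-1) 1 := by
    ext x
    constructor
    · rintro ⟨a, ha, rfl⟩
      exact mapsTo_cos_Ioo (hmem a ha)
    · intro hx
      refine ⟨arccos x * R, ⟨mul_pos (arccos_pos.2 hx.2) hR, ?_⟩, ?_⟩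
      · gcongr
        refine lt_of_le_of_ne (arccos_le_pi x) fun h => ?_
        linarith [arccos_eq_pi.1 h, hx.1]
      · simp only [mul_div_cancel_right₀ _ hR.ne']
        exact cos_arccos hx.1.le hx.2.le
  have hinj : InjOn (fun a => cos (a / R)) (Ioo 0 (π * R)) := fun a ha b hb hab => by
    have := injOn_cos (Ioo_subset_Icc_self (hmem a ha)) (Ioo_subset_Icc_self (hmem b hb)) hab
    exact (div_left_inj' hR.ne').1 this
  have hderiv : ∀ a ∈ Ioo 0 (π * R), HasDerivWithinAt (fun a => cos (a / R))
      (-sin (a / R) * (1 / R)) (Ioo 0 (π * R)) a := fun a _ =>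
    ((hasDerivAt_id a).div_const R).cos.hasDerivWithinAt
  rw [intervalIntegral.integral_of_le (by norm_num), integral_Ioc_eq_integral_Ioo, ← himg,
    integral_image_eq_integral_abs_deriv_smul measurableSet_Ioo hderiv hinj]
  refine setIntegral_congr_fun measurableSet_Ioo fun a ha => ?_
  have hs : 0 < sin (a / R) := sin_pos_of_mem_Ioo (hmem a ha)
  have h1 : √(1 - cos (a / R) ^ 2) = sin (a / R) := by
    rw [← sin_sq, sqrt_sq hs.le]
  simp only [h1, smul_eq_mul, abs_mul, abs_neg, abs_of_pos hs, abs_of_pos (one_div_pos.2 hR)]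
  field_simp

theorem Gam_eq_integral_cos {R : ℝ} (hR : 0 < R) (f g : ℝ → ℝ) :
    Gam f g = 1 / π ^ 2 * ∫ a in Ioo 0 (π * R), ∫ b in Ioo 0 (π * R),
      (f (cos (a / R)) - f (cos (b / R))) * (g (cos (a / R)) - g (cos (b / R))) *
        ((1 - cos (a / R) * cos (b / R)) / (cos (a / R) - cos (b / R)) ^ 2) / R ^ 2 := by
  have hinner : ∀ x : ℝ, (∫ y in (-1 : ℝ)..1, (f x - f y) / (x - y) * ((g x - g y) / (x - y)) *
      ((1 - x * y) / (√(1 - x ^ 2) * √(1 - y ^ 2)))) =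
      (∫ b in Ioo 0 (π * R), (f x - f (cos (b / R))) * (g x - g (cos (b / R))) *
        ((1 - x * cos (b / R)) / (x - cos (b / R)) ^ 2) / R) / √(1 - x ^ 2) := fun x => by
    rw [← integral_div_sqrt_one_sub_sq hR (fun y => (f x - f y) * (g x - g y) *
      ((1 - x * y) / (x - y) ^ 2)), ← intervalIntegral.integral_div]
    congr 1
    ext y
    simp only [div_eq_mul_inv, mul_inv, ← inv_pow]
    ring
  unfold Gam
  simp_rw [hinner]
  rw [integral_div_sqrt_one_sub_sq hR]
  simp_rw [← integral_div, div_div, ← sq]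

theorem integrable_min_one_mul_sqrt_div_sq :
    Integrable fun x : ℝ => min 1 |x| * √|x| / x ^ 2 := by
  have hIoi : IntegrableOn (fun x : ℝ => min 1 |x| * √|x| / x ^ 2) (Ioi 0) := by
    rw [← Ioc_union_Ioi_eq_Ioi zero_le_one]
    refine IntegrableOn.union ?_ ?_
    · have h : IntegrableOn (fun x : ℝ => x ^ (-(1 / 2) : ℝ)) (Ioc 0 1) :=
        (intervalIntegrable_iff_integrableOn_Ioc_of_le zero_le_one).1
          (intervalIntegral.intervalIntegrable_rpow' (by norm_num))
      refine h.congr_fun (fun x hx => ?_) measurableSet_Ioc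
      have hx0 : 0 < x := hx.1
      simp only
      rw [abs_of_pos hx0, min_eq_right hx.2, rpow_neg hx0.le, ← sqrt_eq_rpow,
        eq_div_iff (by positivity)]
      nth_rewrite 2 [← sq_sqrt hx0.le]
      have := sqrt_pos.2 hx0
      field_simp
      rw [sq_sqrt hx0.le]
    · have h : IntegrableOn (fun x : ℝ => x ^ (-(3 / 2) : ℝ)) (Ioi 1) :=
        integrableOn_Ioi_rpow_of_lt (by norm_num) one_pos
      refine h.congr_fun (fun x hx => ?_) measurableSet_Ioi
      have hx0 : 0 < x := one_pos.trans hx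
      simp only
      rw [abs_of_pos hx0, min_eq_left (le_of_lt hx), one_mul, sqrt_eq_rpow, ← rpow_natCast,
        ← rpow_sub hx0]
      norm_num
  have hIic : IntegrableOn (fun x : ℝ => min 1 |x| * √|x| / x ^ 2) (Iic 0) := by
    rw [← Measure.map_neg_eq_self (volume : Measure ℝ)]
    let m : MeasurableEmbedding fun x : ℝ => -x := (Homeomorph.neg ℝ).measurableEmbedding
    rw [m.integrableOn_map_iff]
    simp_rw [Function.comp_def, abs_neg, neg_sq, neg_preimage, neg_Iic, neg_zero]
    exact Iff.mpr integrableOn_Ici_iff_integrableOn_Ioi hIoi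
  rw [← integrableOn_univ, ← Iic_union_Ioi (a := (0 : ℝ))]
  exact hIic.union hIoi

theorem tendsto_natCast_mul_one_sub_cos (a : ℝ) :
    Tendsto (fun i : ℕ => (i : ℝ) * (1 - cos (a / √i))) atTop (𝓝 (a ^ 2 / 2)) := by
  have h0 : Tendsto (fun i : ℕ => a / √(i : ℝ) / 2) atTop (𝓝 0) := by
    have := (tendsto_const_nhds (x := a)).div_atTop
      (tendsto_sqrt_atTop.comp (tendsto_natCast_atTop_atTop (R := ℝ)))
    simpa using this.div_const 2
  have h1 : Tendsto (fun i : ℕ => a ^ 2 / 2 * sinc (a / √(i : ℝ) / 2) ^ 2) atTop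
      (𝓝 (a ^ 2 / 2)) := by
    have := (((continuous_sinc.tendsto 0).comp h0).pow 2).const_mul (a ^ 2 / 2)
    simpa using this
  refine h1.congr' ?_
  filter_upwards [eventually_gt_atTop 0] with i hi
  have hi' : (0 : ℝ) < i := Nat.cast_pos.2 hi
  have hs : sin (a / √i / 2) = a / √i / 2 * sinc (a / √i / 2) := by
    by_cases h : a / √(i : ℝ) / 2 = 0
    · simp [h]
    · rw [sinc_of_ne_zero h, mul_div_cancel₀ _ h]
  have hc : 1 - cos (a / √i) = 2 * sin (a / √i / 2) ^ 2 := by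
    have := cos_sq_add_sin_sq (a / √(i : ℝ) / 2)
    have h2 := cos_two_mul (a / √(i : ℝ) / 2)
    rw [mul_div_cancel₀ _ two_ne_zero] at h2
    linarith
  rw [hc, hs, mul_pow, div_pow, div_pow, sq_sqrt hi'.le]
  field_simp

theorem integral_mul_comp_sub {f g : ℝ → ℝ} (hf : Integrable f) (hg : Integrable g) :
    Integrable (fun p : ℝ × ℝ => f p.2 * g (p.1 - p.2)) ∧
      ∫ p : ℝ × ℝ, f p.2 * g (p.1 - p.2) = (∫ x, f x) * ∫ x, g x := by
  have h : Integrable (fun p : ℝ × ℝ => f p.2 * g (p.1 - p.2)) (volume.prod volume) :=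
    hf.convolution_integrand (ContinuousLinearMap.mul ℝ ℝ) hg
  refine ⟨h, ?_⟩
  rw [Measure.volume_eq_prod, integral_prod _ h]
  exact integral_convolution (ContinuousLinearMap.mul ℝ ℝ) hf hg

/-- A dominating function for the integrand of the rescaled form. -/
def gaussianMajorant (k A : ℝ) (p : ℝ × ℝ) : ℝ :=
  20 * √(√A) * ((exp (-(k / π ^ 2 * A) * p.1 ^ 2) + exp (-(k / π ^ 2 * A) * p.2 ^ 2)) *
    (min 1 |p.1 - p.2| * √|p.1 - p.2| / (p.1 - p.2) ^ 2))

theorem integral_gaussianMajorant {k A : ℝ} (hk : 0 < k) (hA : 0 < A) :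
    Integrable (gaussianMajorant k A) ∧
      ∫ p, gaussianMajorant k A p = 40 * √(√A) * (√(π / (k / π ^ 2 * A)) *
        ∫ x : ℝ, min 1 |x| * √|x| / x ^ 2) := by
  have hb : 0 < k / π ^ 2 * A := by positivity
  set H : ℝ × ℝ → ℝ := fun p => exp (-(k / π ^ 2 * A) * p.2 ^ 2) *
    (min 1 |p.1 - p.2| * √|p.1 - p.2| / (p.1 - p.2) ^ 2)
  have h1 : Integrable H := (integral_mul_comp_sub (integrable_exp_neg_mul_sq hb)
    integrable_min_one_mul_sqrt_div_sq).1
  have h2 : ∫ p, H p = √(π / (k / π ^ 2 * A)) * ∫ x : ℝ, min 1 |x| * √|x| / x ^ 2 := by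
    rw [← integral_gaussian]
    exact (integral_mul_comp_sub (integrable_exp_neg_mul_sq hb)
      integrable_min_one_mul_sqrt_div_sq).2
  have h3 : Integrable fun p : ℝ × ℝ => H p.swap := h1.swap
  have h4 : ∫ p : ℝ × ℝ, H p.swap = ∫ p, H p :=
    integral_prod_swap (μ := (volume : Measure ℝ)) (ν := (volume : Measure ℝ)) H
  have heq : gaussianMajorant k A = fun p => 20 * √(√A) * (H p.swap + H p) := by
    ext p
    simp only [gaussianMajorant, H, Prod.fst_swap, Prod.snd_swap]
    rw [abs_sub_comm p.2 p.1, ← neg_sub p.1 p.2, neg_sq]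
    ring
  rw [heq]
  refine ⟨(h3.add h1).const_mul _, ?_⟩
  rw [integral_const_mul, integral_add h3 h1, h4, h2]
  ring

/-- The integrand of `Γ_c(h_i, h_{Ai})` after the substitution `x = cos (a / √i)`. -/
def rescaledIntegrand (k A : ℝ) (i : ℕ) : ℝ × ℝ → ℝ :=
  (Ioo 0 (π * √i) ×ˢ Ioo 0 (π * √i)).indicator fun p =>
    (cosPow k i (p.1 / √i) - cosPow k i (p.2 / √i)) *
      (cosPow k (A * i) (p.1 / √i) - cosPow k (A * i) (p.2 / √i)) *
      ((1 - cos (p.1 / √i) * cos (p.2 / √i)) / (cos (p.1 / √i) - cos (p.2 / √i)) ^ 2) /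
      √i ^ 2

theorem measurable_rescaledIntegrand (k A : ℝ) (i : ℕ) :
    Measurable (rescaledIntegrand k A i) := by
  have h : ∀ r : ℝ, Measurable (cosPow k r) := fun r => by
    unfold cosPow
    fun_prop
  refine Measurable.indicator ?_ (measurableSet_Ioo.prod measurableSet_Ioo)
  have h1 := h i
  have h2 := h (A * i)
  fun_prop

theorem abs_rescaledIntegrand_le {k A : ℝ} (hk0 : 0 ≤ k) (hk : k ≤ 1 / 2) (hA : 1 ≤ A)
    {i : ℕ} (hi : 0 < i) (p : ℝ × ℝ) :
    |rescaledIntegrand k A i p| ≤ gaussianMajorant k A p := by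
  obtain ⟨a, b⟩ := p
  by_cases hp : (a, b) ∈ Ioo 0 (π * √i) ×ˢ Ioo 0 (π * √i)
  swap
  · rw [rescaledIntegrand, indicator_of_notMem hp, abs_zero]
    unfold gaussianMajorant
    positivity
  rw [rescaledIntegrand, indicator_of_mem hp]
  simp only [gaussianMajorant]
  rcases eq_or_ne a b with rfl | hab
  · simp
  have hi1 : (1 : ℝ) ≤ i := Nat.one_le_cast.2 hi
  have hi0 : (0 : ℝ) < i := by linarith
  have hR : 0 < √(i : ℝ) := sqrt_pos.2 hi0
  have hmem : ∀ a ∈ Ioo 0 (π * √i), a / √i ∈ Ioo 0 π := fun a ha =>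
    ⟨div_pos ha.1 hR, (div_lt_iff₀ hR).2 ha.2⟩
  have hθ := hmem a hp.1
  have hφ := hmem b hp.2
  have hAi : 1 ≤ A * i := one_le_mul_of_one_le_of_one_le hA hi1
  have hδ : 0 < |a - b| := abs_pos.2 (sub_ne_zero.2 hab)
  have hdist : |a / √i - b / √i| = |a - b| / √i := by
    rw [← sub_div, abs_div, abs_of_pos hR]
  have hP : |cosPow k i (a / √i) - cosPow k i (b / √i)| ≤ 2 * min 1 |a - b| := by
    have h1 := abs_cosPow_sub_le hk0 hk hi1 (a / √i) (b / √i)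
    rw [hdist, mul_assoc, mul_div_cancel₀ _ hR.ne'] at h1
    have h2 : |cosPow k i (a / √i) - cosPow k i (b / √i)| ≤ 1 :=
      abs_sub_le_iff.2
        ⟨by linarith [cosPow_le_one hk0 hk hi0.le (a / √i), cosPow_nonneg hk i (b / √i)],
        by linarith [cosPow_le_one hk0 hk hi0.le (b / √i), cosPow_nonneg hk i (a / √i)]⟩
    rw [mul_min_of_nonneg _ _ zero_le_two]
    exact le_min (by linarith) h1
  set E : ℝ → ℝ := fun a => exp (-(k / π ^ 2 * A) * a ^ 2) with hE
  have hgauss : ∀ x ∈ Ioo 0 (π * √i), cosPow k (A * i) (x / √i) ≤ E x ^ 2 := fun x hx => by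
    refine (cosPow_le_gaussian hk0 hk (by linarith) ?_).trans_eq ?_
    · rw [abs_of_pos (hmem x hx).1]
      exact (hmem x hx).2.le
    · rw [hE, ← exp_nat_mul, div_pow, sq_sqrt hi0.le]
      congr 1
      push_cast
      field_simp
  have hE0 : ∀ x, 0 < E x := fun x => exp_pos _
  have hQ : |cosPow k (A * i) (a / √i) - cosPow k (A * i) (b / √i)| ≤
      2 * √(√A) * √|a - b| * (E a + E b) := by
    set q := |cosPow k (A * i) (a / √i) - cosPow k (A * i) (b / √i)| with hq
    have hq0 : 0 ≤ q := abs_nonneg _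
    have h1 : q ≤ 2 * √A * |a - b| := by
      have h := abs_cosPow_sub_le hk0 hk hAi (a / √i) (b / √i)
      rw [hdist, sqrt_mul (by linarith)] at h
      calc q ≤ _ := h
        _ = _ := by field_simp
    have h2 : q ≤ (E a + E b) ^ 2 := by
      have ha := hgauss a hp.1
      have hb := hgauss b hp.2
      have := mul_pos (hE0 a) (hE0 b)
      exact abs_sub_le_iff.2
        ⟨by nlinarith [cosPow_nonneg hk (A * i) (b / √i), sq_nonneg (E b)],
        by nlinarith [cosPow_nonneg hk (A * i) (a / √i), sq_nonneg (E a)]⟩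
    have h3 : 0 < E a + E b := add_pos (hE0 a) (hE0 b)
    refine le_of_sq_le_sq ?_ (by positivity)
    calc q ^ 2 = q * q := sq q
      _ ≤ (2 * √A * |a - b|) * (E a + E b) ^ 2 := by gcongr
      _ ≤ (4 * √A * |a - b|) * (E a + E b) ^ 2 := by gcongr; norm_num
      _ = (2 * √(√A) * √|a - b| * (E a + E b)) ^ 2 := by
        rw [mul_pow, mul_pow, mul_pow, sq_sqrt (sqrt_nonneg A), sq_sqrt hδ.le]
        ring
  have hK : |(1 - cos (a / √i) * cos (b / √i)) / (cos (a / √i) - cos (b / √i)) ^ 2 / √i ^ 2| ≤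
      5 / (a - b) ^ 2 := by
    have h := sq_sub_mul_one_sub_cos_mul_cos_le hθ hφ
    have hne : cos (a / √i) - cos (b / √i) ≠ 0 := fun h0 => hab <|
      (div_left_inj' hR.ne').1 (injOn_cos (Ioo_subset_Icc_self hθ) (Ioo_subset_Icc_self hφ)
        (sub_eq_zero.1 h0))
    have hcc : 0 ≤ 1 - cos (a / √i) * cos (b / √i) := by
      have h1 := abs_le.1 (abs_cos_le_one (a / √i))
      have h2 := abs_le.1 (abs_cos_le_one (b / √i))
      nlinarith
    have hsq : 0 < (a - b) ^ 2 := sq_pos_of_ne_zero (sub_ne_zero.2 hab)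
    have hcsq : 0 < (cos (a / √i) - cos (b / √i)) ^ 2 := sq_pos_of_ne_zero hne
    rw [abs_of_nonneg (by positivity), div_div, div_le_div_iff₀ (by positivity) hsq]
    rw [← sub_div, div_pow] at h
    have h' := mul_le_mul_of_nonneg_right h (sq_nonneg √(i : ℝ))
    calc (1 - cos (a / √i) * cos (b / √i)) * (a - b) ^ 2
        = (a - b) ^ 2 / √i ^ 2 * (1 - cos (a / √i) * cos (b / √i)) * √i ^ 2 := by field_simp
      _ ≤ _ := h'
      _ = _ := by ring
  rw [mul_div_assoc, abs_mul, abs_mul]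
  calc _ ≤ (2 * min 1 |a - b|) * (2 * √(√A) * √|a - b| * (E a + E b)) * (5 / (a - b) ^ 2) := by
        have := hE0 a
        have := hE0 b
        gcongr
    _ = _ := by ring

/-- The pointwise limit of `rescaledIntegrand k A i` as `i → ∞`. -/
def limitIntegrand (k A : ℝ) : ℝ × ℝ → ℝ :=
  (Ioi 0 ×ˢ Ioi 0).indicator fun p =>
    (exp (-(k * (p.1 ^ 2 / 2))) - exp (-(k * (p.2 ^ 2 / 2)))) *
      (exp (-(k * (p.1 ^ 2 / 2))) ^ A - exp (-(k * (p.2 ^ 2 / 2))) ^ A) *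
      ((p.1 ^ 2 / 2 + p.2 ^ 2 / 2) / (p.2 ^ 2 / 2 - p.1 ^ 2 / 2) ^ 2)

theorem tendsto_cosPow_natCast (k a : ℝ) :
    Tendsto (fun i : ℕ => cosPow k i (a / √i)) atTop (𝓝 (exp (-(k * (a ^ 2 / 2))))) := by
  have h : Tendsto (fun i : ℕ => (i : ℝ) * (-(k * (1 - cos (a / √i))))) atTop
      (𝓝 (-(k * (a ^ 2 / 2)))) := by
    refine (((tendsto_natCast_mul_one_sub_cos a).const_mul k).neg).congr fun i => ?_
    ring
  refine (tendsto_one_add_pow_exp_of_tendsto h).congr fun i => ?_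
  rw [cosPow, rpow_natCast, sub_eq_add_neg (1 : ℝ) (k * _)]

theorem tendsto_rescaledIntegrand {k A : ℝ} (hk : k ≤ 1 / 2) (p : ℝ × ℝ) :
    Tendsto (fun i => rescaledIntegrand k A i p) atTop (𝓝 (limitIntegrand k A p)) := by
  obtain ⟨a, b⟩ := p
  by_cases hp : (a, b) ∈ (Ioi 0 ×ˢ Ioi 0 : Set (ℝ × ℝ))
  swap
  · rw [limitIntegrand, indicator_of_notMem hp]
    refine tendsto_const_nhds.congr fun i => ?_
    rw [rescaledIntegrand, indicator_of_notMem]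
    exact fun h => hp ⟨h.1.1, h.2.1⟩
  rw [limitIntegrand, indicator_of_mem hp]
  have hsqrt : Tendsto (fun i : ℕ => π * √(i : ℝ)) atTop atTop :=
    (tendsto_sqrt_atTop.comp tendsto_natCast_atTop_atTop).const_mul_atTop pi_pos
  have hmem : ∀ᶠ i : ℕ in atTop, (a, b) ∈ Ioo 0 (π * √(i : ℝ)) ×ˢ Ioo 0 (π * √(i : ℝ)) := by
    filter_upwards [hsqrt.eventually_gt_atTop a, hsqrt.eventually_gt_atTop b] with i ha hb
    exact ⟨⟨hp.1, ha⟩, ⟨hp.2, hb⟩⟩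
  rcases eq_or_ne a b with rfl | hab
  · refine Tendsto.congr' ?_ tendsto_const_nhds
    filter_upwards [hmem] with i hi
    rw [rescaledIntegrand, indicator_of_mem hi]
    simp
  have hQ : ∀ x : ℝ, Tendsto (fun i : ℕ => cosPow k (A * i) (x / √i)) atTop
      (𝓝 (exp (-(k * (x ^ 2 / 2))) ^ A)) := fun x => by
    refine ((tendsto_cosPow_natCast k x).rpow_const (Or.inl (exp_pos _).ne')).congr fun i => ?_
    rw [cosPow, cosPow, ← rpow_mul (one_sub_mul_one_sub_cos_nonneg hk _), mul_comm A]
  have hca := tendsto_natCast_mul_one_sub_cos a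
  have hcb := tendsto_natCast_mul_one_sub_cos b
  have hcos : Tendsto (fun i : ℕ => cos (a / √i)) atTop (𝓝 1) := by
    have h := (tendsto_const_nhds (x := a)).div_atTop
      (tendsto_sqrt_atTop.comp (tendsto_natCast_atTop_atTop (R := ℝ)))
    simpa [Function.comp_def] using (continuous_cos.tendsto 0).comp h
  have hne : (b ^ 2 / 2 - a ^ 2 / 2) ^ 2 ≠ 0 := by
    have ha : 0 < a := hp.1
    have hb : 0 < b := hp.2
    rw [show b ^ 2 / 2 - a ^ 2 / 2 = (b - a) * ((b + a) / 2) by ring]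
    have := sub_ne_zero.2 hab.symm
    positivity
  have hK := (hca.add (hcos.mul hcb)).div ((hcb.sub hca).pow 2) hne
  rw [one_mul] at hK
  refine ((((tendsto_cosPow_natCast k a).sub (tendsto_cosPow_natCast k b)).mul
    ((hQ a).sub (hQ b))).mul hK).congr' ?_
  filter_upwards [hmem, eventually_gt_atTop 0] with i hi hi0
  have hi' : (0 : ℝ) < i := Nat.cast_pos.2 hi0
  rw [rescaledIntegrand, indicator_of_mem hi, mul_div_assoc]
  simp only [Pi.div_apply]
  congr 1
  rw [sq_sqrt hi'.le, show (i : ℝ) * (1 - cos (a / √i)) + cos (a / √i) * (i * (1 - cos (b / √i))) =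
    i * (1 - cos (a / √i) * cos (b / √i)) by ring, ← mul_sub, mul_pow,
    show 1 - cos (b / √i) - (1 - cos (a / √i)) = cos (a / √i) - cos (b / √i) by ring, div_div,
    sq (i : ℝ), mul_assoc, mul_div_mul_left _ _ hi'.ne', mul_comm (i : ℝ)]

theorem PhiC_div_aplus {c : ℝ} (hc : 0 ≤ c) (x : ℝ) :
    PhiC c x / aplus c = 1 - 2 * √c / (1 + √c) ^ 2 * (1 - x) := by
  have h : (1 + √c) ^ 2 ≠ 0 := by positivity
  rw [PhiC, aplus]
  field_simp
  linear_combination -sq_sqrt hc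

theorem GamC_eq_integral_rescaledIntegrand {c A : ℝ} (hc : 0 < c) (hA : 1 ≤ A) {i : ℕ}
    (hi : 0 < i) :
    GamC c (fun x => (x / aplus c) ^ (i : ℝ)) (fun x => (x / aplus c) ^ (A * (i : ℝ))) =
      1 / π ^ 2 * ∫ p, rescaledIntegrand (2 * √c / (1 + √c) ^ 2) A i p := by
  have hk0 : 0 < 2 * √c / (1 + √c) ^ 2 := by positivity
  have hk : 2 * √c / (1 + √c) ^ 2 ≤ 1 / 2 := by
    rw [div_le_div_iff₀ (by positivity) two_pos]
    nlinarith [sq_nonneg (1 - √c)]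
  have hint : Integrable (rescaledIntegrand (2 * √c / (1 + √c) ^ 2) A i) :=
    (integral_gaussianMajorant hk0 (by linarith)).1.mono'
      (measurable_rescaledIntegrand _ _ _).aestronglyMeasurable
      (Eventually.of_forall fun p => abs_rescaledIntegrand_le hk0.le hk hA hi p)
  have hS : MeasurableSet (Ioo 0 (π * √(i : ℝ)) ×ˢ Ioo 0 (π * √(i : ℝ))) :=
    measurableSet_Ioo.prod measurableSet_Ioo
  rw [GamC, Gam_eq_integral_cos (sqrt_pos.2 (Nat.cast_pos.2 hi))]
  congr 1
  rw [rescaledIntegrand, integrable_indicator_iff hS] at hint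
  rw [rescaledIntegrand, integral_indicator hS, Measure.volume_eq_prod, setIntegral_prod _ hint]
  simp only [Function.comp_apply, PhiC_div_aplus hc.le, cosPow]

theorem exists_tendsto_GamC_and_abs_le {c A : ℝ} (hc : 0 < c) (hA : 1 ≤ A) :
    ∃ l, Tendsto (fun i : ℕ => GamC c (fun x => (x / aplus c) ^ (i : ℝ))
        (fun x => (x / aplus c) ^ (A * (i : ℝ)))) atTop (𝓝 l) ∧
      |l| ≤ 1 / π ^ 2 * ∫ p, gaussianMajorant (2 * √c / (1 + √c) ^ 2) A p := by
  have hk0 : 0 < 2 * √c / (1 + √c) ^ 2 := by positivity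
  have hk : 2 * √c / (1 + √c) ^ 2 ≤ 1 / 2 := by
    rw [div_le_div_iff₀ (by positivity) two_pos]
    nlinarith [sq_nonneg (1 - √c)]
  have hM := (integral_gaussianMajorant hk0 (by linarith : 0 < A)).1
  have hbound : ∀ᶠ i : ℕ in atTop, ∀ p, |rescaledIntegrand (2 * √c / (1 + √c) ^ 2) A i p| ≤
      gaussianMajorant (2 * √c / (1 + √c) ^ 2) A p :=
    (eventually_gt_atTop 0).mono fun i hi p => abs_rescaledIntegrand_le hk0.le hk hA hi p
  have hlim := (tendsto_integral_filter_of_dominated_convergence _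
    (Eventually.of_forall fun i =>
      (measurable_rescaledIntegrand (2 * √c / (1 + √c) ^ 2) A i).aestronglyMeasurable)
    (hbound.mono fun i hi => Eventually.of_forall hi) hM
    (Eventually.of_forall fun p => tendsto_rescaledIntegrand (A := A) hk p)).const_mul (1 / π ^ 2)
  refine ⟨_, hlim.congr' ?_, le_of_tendsto hlim.abs ?_⟩
  · filter_upwards [eventually_gt_atTop 0] with i hi
    exact (GamC_eq_integral_rescaledIntegrand hc hA hi).symm
  · filter_upwards [hbound] with i hi
    rw [abs_mul, abs_of_pos (by positivity : 0 < 1 / π ^ 2)]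
    gcongr
    exact norm_integral_le_of_norm_le (f := rescaledIntegrand _ A i) hM (Eventually.of_forall hi)

theorem tendsto_integral_gaussianMajorant {k : ℝ} (hk : 0 < k) :
    Tendsto (fun A => ∫ p, gaussianMajorant k A p) atTop (𝓝 0) := by
  have h : Tendsto (fun A : ℝ => 40 * √(π / (k / π ^ 2)) *
      (∫ x : ℝ, min 1 |x| * √|x| / x ^ 2) * (√(√A))⁻¹) atTop (𝓝 0) := by
    simpa using (tendsto_inv_atTop_zero.comp
      (tendsto_sqrt_atTop.comp tendsto_sqrt_atTop)).const_mul _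
  refine h.congr' ?_
  filter_upwards [eventually_gt_atTop 0] with A hA
  have hs : 0 < √(√A) := sqrt_pos.2 (sqrt_pos.2 hA)
  have hss : √A = √(√A) * √(√A) := (mul_self_sqrt (sqrt_nonneg A)).symm
  rw [(integral_gaussianMajorant hk hA).2, ← div_div, sqrt_div' _ hA.le]
  nth_rewrite 3 [hss]
  field_simp

end Auxiliary

/-- Lemma 2.5(3) of the paper: with `h_r(x) = (x/a₊)^r` (real powers), for each real `A ≥ 1`
the limit `L_c(A) = lim_{i → ∞} Γ_c(h_i, h_{Ai})` (over positive integers `i`) exists, and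
`L_c(A) → 0` as `A → ∞`. -/
theorem GamC_offdiagonal_limit (c : ℝ) (hc : 1 ≤ c) :
    ∃ L : ℝ → ℝ,
      (∀ A : ℝ, 1 ≤ A →
        Tendsto
          (fun i : ℕ => GamC c (fun x => (x / aplus c) ^ (i : ℝ))
            (fun x => (x / aplus c) ^ (A * (i : ℝ))))
          atTop (𝓝 (L A))) ∧
      Tendsto L atTop (𝓝 0) := by
  have hc0 : 0 < c := one_pos.trans_le hc
  choose! L hL using fun A : ℝ => exists_tendsto_GamC_and_abs_le (c := c) (A := A) hc0
  refine ⟨L, fun A hA => (hL A hA).1, ?_⟩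
  have hk0 : 0 < 2 * Real.sqrt c / (1 + Real.sqrt c) ^ 2 := by positivity
  refine squeeze_zero_norm' ((eventually_ge_atTop 1).mono fun A hA => (hL A hA).2) ?_
  simpa only [mul_zero] using (tendsto_integral_gaussianMajorant hk0).const_mul (1 / Real.pi ^ 2)
end
end

section
/- For each positive integer i let p_i(x) = x^i. Then the limit α = lim_{i→∞} Γ(p_i, p_i) exists, and α > 0. -/
open MeasureTheory ProbabilityTheory Filter Topology

noncomputable section

/-- The `k`-th moment of the arcsine distribution on `[-1, 1]`. -/
def arcsineMoment (k : ℕ) : ℝ :=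
  (1 / Real.pi) * ∫ θ in (0 : ℝ)..Real.pi, Real.cos θ ^ k

theorem arcsineMoment_zero : arcsineMoment 0 = 1 := by
  simp [arcsineMoment, Real.pi_ne_zero]

theorem arcsineMoment_one : arcsineMoment 1 = 0 := by
  simp [arcsineMoment]

theorem arcsineMoment_add_two (k : ℕ) :
    arcsineMoment (k + 2) = (k + 1) / (k + 2) * arcsineMoment k := by
  simp only [arcsineMoment, integral_cos_pow, Real.sin_pi, Real.sin_zero]
  ring

theorem arcsineMoment_odd (k : ℕ) : arcsineMoment (2 * k + 1) = 0 := by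
  induction k with
  | zero => exact arcsineMoment_one
  | succ k ih =>
    rw [show 2 * (k + 1) + 1 = 2 * k + 1 + 2 by ring, arcsineMoment_add_two, ih, mul_zero]

theorem arcsineMoment_even_succ (k : ℕ) :
    arcsineMoment (2 * (k + 1)) = (2 * k + 1) / (2 * k + 2) * arcsineMoment (2 * k) := by
  rw [mul_add, mul_one, arcsineMoment_add_two]
  push_cast
  rfl

theorem integral_pow_mul_inv_sqrt (k : ℕ) :
    ∫ x in (-1 : ℝ)..1, x ^ k * (Real.sqrt (1 - x ^ 2))⁻¹ = Real.pi * arcsineMoment k := by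
  simp only [← Real.sqrt_inv]
  rw [← Polynomial.Chebyshev.integral_measureT (fun x => x ^ k),
    Polynomial.Chebyshev.integral_measureT_eq_integral_cos, arcsineMoment]
  field_simp [Real.pi_ne_zero]

theorem intervalIntegrable_pow_mul_inv_sqrt (k : ℕ) :
    IntervalIntegrable (fun x : ℝ => x ^ k * (Real.sqrt (1 - x ^ 2))⁻¹) volume (-1) 1 := by
  simp only [← Real.sqrt_inv]
  exact Polynomial.Chebyshev.intervalIntegrable_sqrt_one_sub_sq_inv.continuousOn_mul
    (continuous_pow k).continuousOn

/-- The squared moments of even order are the reciprocals of the Wallis products,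
up to normalization. -/
theorem arcsineMoment_sq_mul_W (k : ℕ) :
    (2 * k + 1) * arcsineMoment (2 * k) ^ 2 * Real.Wallis.W k = 1 := by
  induction k with
  | zero => simp [arcsineMoment_zero, Real.Wallis.W]
  | succ k ih =>
    rw [arcsineMoment_even_succ, Real.Wallis.W_succ]
    push_cast
    field_simp
    linear_combination (2 * (k : ℝ) + 3) * ih

theorem sum_sum_second_difference (G : ℕ → ℝ) (n : ℕ) :
    ∑ i ∈ Finset.range n, ∑ j ∈ Finset.range n,
      (G (i + j + 2) - 2 * G (i + j + 1) + G (i + j)) = G (2 * n) - 2 * G n + G 0 := by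
  have inner (i : ℕ) : ∑ j ∈ Finset.range n, (G (i + j + 2) - 2 * G (i + j + 1) + G (i + j)) =
      (G (i + 1 + n) - G (i + 1)) - (G (i + n) - G i) := by
    have h := Finset.sum_range_sub (fun j => G (i + j + 1) - G (i + j)) n
    rw [show i + 1 + n = i + n + 1 by ring]
    simp only [← add_assoc, add_zero] at h
    rw [sub_sub_sub_comm, ← h]
    exact Finset.sum_congr rfl fun j _ => by ring
  simp only [inner]
  rw [Finset.sum_range_sub (fun i => G (i + n) - G i) n, two_mul n, zero_add]
  ring

/-- A function whose second difference in `s` is, up to sign, the coefficient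
`m_s m_{2n-2-s} - m_{s+1} m_{2n-1-s}` built from the arcsine moments `m`. -/
def momentPotential (n s : ℕ) : ℝ :=
  s * ((n : ℝ) - (s / 2 : ℕ)) / n *
    (arcsineMoment (2 * (s / 2)) * arcsineMoment (2 * (n - s / 2)))

theorem moment_eq_second_difference {n s t : ℕ} (h : s + t + 2 = 2 * n) :
    arcsineMoment s * arcsineMoment t - arcsineMoment (s + 1) * arcsineMoment (t + 1) =
      -(momentPotential n (s + 2) - 2 * momentPotential n (s + 1) + momentPotential n s) := by
  obtain ⟨k, rfl | rfl⟩ := Nat.even_or_odd' s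
  · obtain ⟨r, rfl⟩ : ∃ r, t = 2 * r := ⟨t / 2, by omega⟩
    obtain rfl : n = k + 1 + r := by omega
    simp only [momentPotential, show (2 * k + 2) / 2 = k + 1 by omega,
      show (2 * k + 1) / 2 = k by omega, show 2 * k / 2 = k by omega,
      show k + 1 + r - (k + 1) = r by omega, show k + 1 + r - k = r + 1 by omega,
      arcsineMoment_odd, arcsineMoment_even_succ]
    push_cast
    field_simp
    ring
  · have hs : 2 * k + 1 + 1 = 2 * (k + 1) := by ring
    obtain ⟨r, rfl⟩ : ∃ r, t = 2 * r + 1 := ⟨t / 2, by omega⟩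
    obtain rfl : n = k + 1 + (r + 1) := by omega
    simp only [momentPotential, show (2 * k + 1 + 2) / 2 = k + 1 by omega,
      show (2 * k + 1 + 1) / 2 = k + 1 by omega, show (2 * k + 1) / 2 = k by omega,
      show k + 1 + (r + 1) - (k + 1) = r + 1 by omega,
      show k + 1 + (r + 1) - k = r + 1 + 1 by omega,
      show 2 * r + 1 + 1 = 2 * (r + 1) by ring,
      arcsineMoment_odd]
    simp only [hs, arcsineMoment_even_succ]
    push_cast
    field_simp
    ring

theorem two_mul_momentPotential_self (n : ℕ) :
    2 * momentPotential n n = n * arcsineMoment (2 * (n / 2)) ^ 2 := by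
  obtain ⟨k, rfl | rfl⟩ := Nat.even_or_odd' n
  · rcases eq_or_ne k 0 with rfl | hk
    · simp [momentPotential]
    simp only [momentPotential, show 2 * k / 2 = k by omega, show 2 * k - k = k by omega]
    push_cast
    field_simp
    ring
  · simp only [momentPotential, show (2 * k + 1) / 2 = k by omega,
      show 2 * k + 1 - k = k + 1 by omega, arcsineMoment_even_succ]
    push_cast
    field_simp
    ring

theorem integral_sum_sum_pow_mul_inv_sqrt (n : ℕ) (A B : ℕ → ℕ → ℝ) (a b : ℕ → ℕ → ℕ) :
    ∫ x in (-1 : ℝ)..1, ∑ i ∈ Finset.range n, ∑ j ∈ Finset.range n,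
      (A i j * (x ^ a i j * (Real.sqrt (1 - x ^ 2))⁻¹) -
        B i j * (x ^ b i j * (Real.sqrt (1 - x ^ 2))⁻¹)) =
    ∑ i ∈ Finset.range n, ∑ j ∈ Finset.range n,
      (A i j * (Real.pi * arcsineMoment (a i j)) - B i j * (Real.pi * arcsineMoment (b i j))) := by
  have integrable (c : ℝ) (k : ℕ) := (intervalIntegrable_pow_mul_inv_sqrt k).const_mul c
  have integrable_sub (i j : ℕ) :=
    (integrable (A i j) (a i j)).sub (integrable (B i j) (b i j))
  rw [intervalIntegral.integral_finsetSum fun i _ => by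
    simpa only [Finset.sum_fn] using
      IntervalIntegrable.sum (Finset.range n) fun j _ => integrable_sub i j]
  refine Finset.sum_congr rfl fun i _ => ?_
  rw [intervalIntegral.integral_finsetSum fun j _ => integrable_sub i j]
  refine Finset.sum_congr rfl fun j _ => ?_
  rw [intervalIntegral.integral_sub (integrable _ _) (integrable _ _),
    intervalIntegral.integral_const_mul, intervalIntegral.integral_const_mul,
    integral_pow_mul_inv_sqrt, integral_pow_mul_inv_sqrt]

theorem Gam_pow_eq_sum (n : ℕ) :
    Gam (fun x => x ^ n) (fun x => x ^ n) =
      ∑ i ∈ Finset.range n, ∑ j ∈ Finset.range n,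
        (arcsineMoment (i + j) * arcsineMoment (n - 1 - i + (n - 1 - j)) -
          arcsineMoment (i + j + 1) * arcsineMoment (n - 1 - i + (n - 1 - j) + 1)) := by
  set w : ℝ → ℝ := fun x => (Real.sqrt (1 - x ^ 2))⁻¹ with hw
  have pointwise (x y : ℝ) (hxy : y ≠ x) :
      ((x ^ n - y ^ n) / (x - y)) * ((x ^ n - y ^ n) / (x - y)) *
        ((1 - x * y) / (Real.sqrt (1 - x ^ 2) * Real.sqrt (1 - y ^ 2))) =
      ∑ i ∈ Finset.range n, ∑ j ∈ Finset.range n,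
        (x ^ (i + j) * w x * (y ^ (n - 1 - i + (n - 1 - j)) * w y) -
          x ^ (i + j + 1) * w x * (y ^ (n - 1 - i + (n - 1 - j) + 1) * w y)) := by
    have hdiv : (x ^ n - y ^ n) / (x - y) =
        ∑ i ∈ Finset.range n, x ^ i * y ^ (n - 1 - i) := by
      rw [div_eq_iff (sub_ne_zero.2 hxy.symm), (Commute.all x y).geom_sum₂_mul]
    rw [hdiv, Finset.sum_mul_sum, Finset.sum_mul]
    refine Finset.sum_congr rfl fun i _ => ?_
    rw [Finset.sum_mul]
    refine Finset.sum_congr rfl fun j _ => ?_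
    rw [hw, div_eq_mul_inv, mul_inv]
    ring
  have inner (x : ℝ) :
      ∫ y in (-1 : ℝ)..1, ((x ^ n - y ^ n) / (x - y)) * ((x ^ n - y ^ n) / (x - y)) *
        ((1 - x * y) / (Real.sqrt (1 - x ^ 2) * Real.sqrt (1 - y ^ 2))) =
      ∑ i ∈ Finset.range n, ∑ j ∈ Finset.range n,
        (Real.pi * arcsineMoment (n - 1 - i + (n - 1 - j)) * (x ^ (i + j) * w x) -
          Real.pi * arcsineMoment (n - 1 - i + (n - 1 - j) + 1) * (x ^ (i + j + 1) * w x)) := by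
    rw [intervalIntegral.integral_congr_ae
      ((Measure.ae_ne volume x).mono fun y hy _ => pointwise x y hy)]
    rw [integral_sum_sum_pow_mul_inv_sqrt]
    refine Finset.sum_congr rfl fun i _ => Finset.sum_congr rfl fun j _ => ?_
    ring
  simp only [Gam, inner]
  rw [integral_sum_sum_pow_mul_inv_sqrt, Finset.mul_sum]
  refine Finset.sum_congr rfl fun i _ => ?_
  rw [Finset.mul_sum]
  refine Finset.sum_congr rfl fun j _ => ?_
  field_simp

theorem Gam_pow_self (n : ℕ) :
    Gam (fun x => x ^ n) (fun x => x ^ n) = n * arcsineMoment (2 * (n / 2)) ^ 2 := by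
  rw [Gam_pow_eq_sum, ← two_mul_momentPotential_self]
  have h (i : ℕ) (hi : i ∈ Finset.range n) (j : ℕ) (hj : j ∈ Finset.range n) :=
    moment_eq_second_difference (n := n) (s := i + j) (t := n - 1 - i + (n - 1 - j))
      (by rw [Finset.mem_range] at hi hj; omega)
  rw [Finset.sum_congr rfl fun i hi => Finset.sum_congr rfl fun j hj => h i hi j hj]
  simp only [Finset.sum_neg_distrib]
  rw [sum_sum_second_difference]
  simp [momentPotential]

theorem Gam_pow_self_eq_div_W (n : ℕ) :
    Gam (fun x => x ^ n) (fun x => x ^ n) =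
      n / (2 * (n / 2 : ℕ) + 1) * (Real.Wallis.W (n / 2))⁻¹ := by
  have hW := (Real.Wallis.W_pos (n / 2)).ne'
  rw [Gam_pow_self]
  have h := arcsineMoment_sq_mul_W (n / 2)
  field_simp
  linear_combination (n : ℝ) * h

theorem tendsto_div_two_mul_half_add_one :
    Tendsto (fun n : ℕ => (n : ℝ) / (2 * (n / 2 : ℕ) + 1)) atTop (𝓝 1) := by
  refine tendsto_of_tendsto_of_tendsto_of_le_of_le (tendsto_natCast_div_add_atTop (1 : ℝ))
    tendsto_const_nhds (fun n => ?_) fun n => ?_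
  · have h : (2 * (n / 2 : ℕ) : ℝ) ≤ n := by exact_mod_cast Nat.mul_div_le n 2
    dsimp only
    gcongr
  · have h : (n : ℝ) ≤ 2 * (n / 2 : ℕ) + 1 := by
      exact_mod_cast (by omega : n ≤ 2 * (n / 2) + 1)
    exact div_le_one_of_le₀ h (by positivity)

/-- Lemma 2.10(1) of the paper: with `p_i(x) = x^i`, the limit `α = lim_{i → ∞} Γ(p_i, p_i)`
exists and is positive. -/
theorem Gam_diagonal_limit :
    ∃ α : ℝ, 0 < α ∧
      Tendsto (fun i : ℕ => Gam (fun x => x ^ i) (fun x => x ^ i)) atTop (𝓝 α) := by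
  refine ⟨(Real.pi / 2)⁻¹, by positivity, ?_⟩
  simp only [Gam_pow_self_eq_div_W]
  rw [← one_mul (Real.pi / 2)⁻¹]
  exact tendsto_div_two_mul_half_add_one.mul
    ((Real.Wallis.tendsto_W_nhds_pi_div_two.comp
      (Nat.tendsto_div_const_atTop two_ne_zero)).inv₀ (by positivity))
end
end
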